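/- Fix d ∈ ℕ. There exists a constant C_d > 0, depending only on d, such that for every p ≥ 1, every n ∈ ℕ, and every homogeneous polynomial f : ℝⁿ → ℝ of degree d with coeff_d(f) > 0, if X is uniformly distributed on the isotropic L_p ball B̃_{p,n}, then for every ε > 0, P(|f(X)| ≤ ε) ≤ C_d · (ε / coeff_d(f))^{1/d}. -/

import Mathlib

open MeasureTheory

/-- The `d`-level content of a multivariate polynomial. -/
noncomputable def coeffd {n : ℕ} (d : ℕ) (f : MvPolynomial (Fin n) ℝ) : ℝ :=
  Real.sqrt (∑ m ∈ f.support.filter (fun m => (∑ i, m i) = d), f.coeff m ^ 2)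

/-- The `L_p` ball of radius `r` in `ℝⁿ`. -/
def pball (p : ℝ) (n : ℕ) (r : ℝ) : Set (Fin n → ℝ) :=
  {x | (∑ i, |x i| ^ p) ^ (1 / p) ≤ r}

/-- The uniform (normalized Lebesgue) probability measure on a set `s ⊆ ℝⁿ`. -/
noncomputable def unif {n : ℕ} (s : Set (Fin n → ℝ)) : Measure (Fin n → ℝ) :=
  (volume s)⁻¹ • volume.restrict s

theorem Polynomial.norm_eval_le_of_separated_nodes {ι : Type*} [DecidableEq ι] {d : ℕ}
    (Q : Polynomial ℂ) (hQ : Q.natDegree ≤ d) (s : Finset ι) (v : ι → ℂ) (hs : s.card = d + 1)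
    {δ ε : ℝ} (hδ : 0 < δ)
    (hsep : ∀ j ∈ s, ∀ k ∈ s, j ≠ k → δ ≤ ‖v j - v k‖) (hv : ∀ j ∈ s, ‖v j‖ ≤ 1)
    (hε : ∀ j ∈ s, ‖Q.eval (v j)‖ ≤ ε) {ζ : ℂ} (hζ : ‖ζ‖ ≤ 1) :
    ‖Q.eval ζ‖ ≤ (d + 1) * (2 / δ) ^ d * ε := by
  have hinj : Set.InjOn v s := by
    intro j hj k hk h
    by_contra hne
    have := hsep j hj k hk hne
    rw [h, sub_self, norm_zero] at this
    linarith
  have hdeg : Q.degree < s.card := by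
    rw [hs]
    exact lt_of_le_of_lt Polynomial.degree_le_natDegree (by exact_mod_cast Nat.lt_succ_of_le hQ)
  rw [Lagrange.eq_interpolate (f := Q) hinj hdeg, Lagrange.interpolate_apply,
    Polynomial.eval_finsetSum]
  have hterm : ∀ j ∈ s, ‖Polynomial.eval ζ (Polynomial.C (Q.eval (v j)) * Lagrange.basis s v j)‖
      ≤ (2 / δ) ^ d * ε := by
    intro j hj
    rw [Polynomial.eval_mul, Polynomial.eval_C, norm_mul, Lagrange.basis, Polynomial.eval_prod,
      norm_prod, mul_comm]
    have h1 : ∏ k ∈ s.erase j, ‖Polynomial.eval ζ (Lagrange.basisDivisor (v j) (v k))‖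
        ≤ ∏ k ∈ s.erase j, (2 / δ) := by
      refine Finset.prod_le_prod (fun _ _ => norm_nonneg _) fun k hk => ?_
      obtain ⟨hkj, hk⟩ := Finset.mem_erase.mp hk
      rw [Lagrange.basisDivisor, Polynomial.eval_mul, Polynomial.eval_C, Polynomial.eval_sub,
        Polynomial.eval_X, Polynomial.eval_C, norm_mul, norm_inv, div_eq_inv_mul]
      have := hsep j hj k hk (Ne.symm hkj)
      have h2 : ‖ζ - v k‖ ≤ 2 := (norm_sub_le _ _).trans (by linarith [hv k hk])
      gcongr
    rw [Finset.prod_const, Finset.card_erase_of_mem hj, hs, Nat.add_sub_cancel] at h1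
    have h0 : 0 ≤ (2 / δ) ^ d := by positivity
    exact mul_le_mul h1 (hε j hj) (norm_nonneg _) h0
  refine (norm_sum_le _ _).trans ((Finset.sum_le_sum hterm).trans ?_)
  rw [Finset.sum_const, hs, nsmul_eq_mul]
  push_cast
  exact le_of_eq (by ring)

/-- The polynomial function with exponents in `S` and coefficients `c`. -/
noncomputable def polyEval {n : ℕ} (S : Finset (Fin n →₀ ℕ)) (c : (Fin n →₀ ℕ) → ℝ)
    (x : Fin n → ℝ) : ℝ :=
  ∑ m ∈ S, c m * ∏ i, x i ^ m i

/-- The complexification of `polyEval`. -/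
noncomputable def polyEvalC {n : ℕ} (S : Finset (Fin n →₀ ℕ)) (c : (Fin n →₀ ℕ) → ℝ)
    (z : Fin n → ℂ) : ℂ :=
  ∑ m ∈ S, (c m : ℂ) * ∏ i, z i ^ m i

/-- The real part of `z` rotated by the angle `t` in every coordinate. -/
noncomputable def rotRe {n : ℕ} (z : Fin n → ℂ) (t : ℝ) : Fin n → ℝ :=
  fun i => (Complex.exp (t * Complex.I) * z i).re

theorem Complex.half_conj_add_half_mul_exp (z : ℂ) (t : ℝ) :
    (starRingEnd ℂ) z / 2 + z / 2 * Complex.exp ((2 * t : ℝ) * Complex.I) =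
      Complex.exp (t * Complex.I) * ((Complex.exp (t * Complex.I) * z).re : ℂ) := by
  rw [Complex.re_eq_add_conj]
  have h1 : Complex.exp ((2 * t : ℝ) * Complex.I)
      = Complex.exp (t * Complex.I) * Complex.exp (t * Complex.I) := by
    rw [← Complex.exp_add]; congr 1; push_cast; ring
  have h2 : Complex.exp (t * Complex.I) * (starRingEnd ℂ) (Complex.exp (t * Complex.I)) = 1 := by
    rw [Complex.mul_conj, Complex.normSq_eq_norm_sq, Complex.norm_exp_ofReal_mul_I]; simp
  rw [h1, map_mul, mul_div_assoc', mul_add, ← mul_assoc _ _ ((starRingEnd ℂ) z), h2]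
  ring

theorem exists_polynomial_rotRe {n d : ℕ} (S : Finset (Fin n →₀ ℕ)) (c : (Fin n →₀ ℕ) → ℝ)
    (hS : ∀ m ∈ S, ∑ i, m i = d) (z : Fin n → ℂ) :
    ∃ Q : Polynomial ℂ, Q.natDegree ≤ d ∧
      (∀ t : ℝ, ‖Q.eval (Complex.exp ((2 * t : ℝ) * Complex.I))‖
        = |polyEval S c (rotRe z t)|) ∧
      ‖polyEvalC S c z‖ = 2 ^ d * ‖Q.eval 0‖ := by
  refine ⟨∑ m ∈ S, Polynomial.C (c m : ℂ) * ∏ i, (Polynomial.C ((starRingEnd ℂ) (z i) / 2) +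
    Polynomial.C (z i / 2) * Polynomial.X) ^ m i, ?_, ?_, ?_⟩
  · refine Polynomial.natDegree_sum_le_of_forall_le _ _ fun m hm => ?_
    refine (Polynomial.natDegree_C_mul_le _ _).trans ((Polynomial.natDegree_prod_le _ _).trans ?_)
    rw [← hS m hm]
    refine Finset.sum_le_sum fun i _ => ?_
    refine Polynomial.natDegree_pow_le.trans ?_
    have : (Polynomial.C ((starRingEnd ℂ) (z i) / 2) +
        Polynomial.C (z i / 2) * Polynomial.X).natDegree ≤ 1 := by
      rw [add_comm]; exact Polynomial.natDegree_linear_le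
    nlinarith [Nat.zero_le (m i)]
  · intro t
    have key : Polynomial.eval (Complex.exp ((2 * t : ℝ) * Complex.I))
        (∑ m ∈ S, Polynomial.C (c m : ℂ) * ∏ i, (Polynomial.C ((starRingEnd ℂ) (z i) / 2) +
          Polynomial.C (z i / 2) * Polynomial.X) ^ m i)
        = Complex.exp (t * Complex.I) ^ d * (polyEval S c (rotRe z t) : ℂ) := by
      simp only [Polynomial.eval_finsetSum, Polynomial.eval_mul, Polynomial.eval_prod,
        Polynomial.eval_pow, Polynomial.eval_add, Polynomial.eval_C, Polynomial.eval_X, polyEval,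
        Complex.half_conj_add_half_mul_exp]
      push_cast
      rw [Finset.mul_sum]
      refine Finset.sum_congr rfl fun m hm => ?_
      simp only [mul_pow, Finset.prod_mul_distrib, Finset.prod_pow_eq_pow_sum, hS m hm, rotRe]
      ring
    rw [key, norm_mul, norm_pow, Complex.norm_exp_ofReal_mul_I, one_pow, one_mul,
      Complex.norm_real, Real.norm_eq_abs]
  · have key : Polynomial.eval 0
        (∑ m ∈ S, Polynomial.C (c m : ℂ) * ∏ i, (Polynomial.C ((starRingEnd ℂ) (z i) / 2) +
          Polynomial.C (z i / 2) * Polynomial.X) ^ m i)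
        = (starRingEnd ℂ) (polyEvalC S c z) / 2 ^ d := by
      simp only [Polynomial.eval_finsetSum, Polynomial.eval_mul, Polynomial.eval_prod,
        Polynomial.eval_pow, Polynomial.eval_add, Polynomial.eval_C, Polynomial.eval_X, polyEvalC,
        mul_zero, add_zero, map_sum, map_mul, map_prod, map_pow, Complex.conj_ofReal]
      rw [Finset.sum_div]
      refine Finset.sum_congr rfl fun m hm => ?_
      simp only [div_pow, Finset.prod_div_distrib, Finset.prod_pow_eq_pow_sum, hS m hm]
      ring
    rw [key, norm_div, norm_pow, Complex.norm_conj]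
    simp
    field_simp

theorem four_div_le_norm_exp_sub_exp {N l k : ℕ} (hl : l < N) (hk : k < N) (hlk : l ≠ k) (θ : ℝ) :
    4 / (N : ℝ) ≤ ‖Complex.exp ((2 * (θ + Real.pi * l / N) : ℝ) * Complex.I) -
      Complex.exp ((2 * (θ + Real.pi * k / N) : ℝ) * Complex.I)‖ := by
  wlog h : k < l generalizing l k
  · rw [norm_sub_rev]
    exact this hk hl hlk.symm (by omega)
  obtain ⟨j, rfl⟩ : ∃ j, l = k + j := ⟨l - k, by omega⟩
  have hN : (0 : ℝ) < N := by exact_mod_cast (by omega : 0 < N)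
  have hj1 : (1 : ℝ) ≤ j := by exact_mod_cast (by omega : 1 ≤ j)
  have hjN : (j : ℝ) + 1 ≤ N := by exact_mod_cast (by omega : j + 1 ≤ N)
  have hsplit : Complex.exp ((2 * (θ + Real.pi * (k + j : ℕ) / N) : ℝ) * Complex.I) -
      Complex.exp ((2 * (θ + Real.pi * k / N) : ℝ) * Complex.I)
      = Complex.exp ((2 * (θ + Real.pi * k / N) : ℝ) * Complex.I) *
        (Complex.exp (Complex.I * (2 * (Real.pi * j / N) : ℝ)) - 1) := by
    rw [mul_sub, ← Complex.exp_add, mul_one]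
    congr 2
    push_cast
    ring
  rw [hsplit, norm_mul, Complex.norm_exp_ofReal_mul_I, one_mul,
    Complex.norm_exp_I_mul_ofReal_sub_one, Real.norm_eq_abs,
    mul_div_cancel_left₀ _ (two_ne_zero' ℝ)]
  refine le_trans ?_ (le_abs_self _)
  have hpi := Real.pi_pos
  have hs : 2 / (N : ℝ) ≤ Real.sin (Real.pi * j / N) := by
    rcases le_total (Real.pi * j / N) (Real.pi / 2) with h2 | h2
    · refine le_trans ?_ (Real.mul_le_sin (by positivity) h2)
      rw [div_mul_div_comm, div_le_div_iff₀ hN (by positivity)]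
      nlinarith [mul_pos hpi hN]
    · rw [← Real.sin_pi_sub]
      have h3 : Real.pi - Real.pi * j / N = Real.pi * (N - j) / N := by field_simp
      refine le_trans ?_ (Real.mul_le_sin ?_ (by linarith))
      · rw [h3, div_mul_div_comm, div_le_div_iff₀ hN (by positivity)]
        nlinarith [mul_pos hpi hN]
      · rw [h3]
        have : (0 : ℝ) ≤ N - j := by linarith
        positivity
  have : 4 / (N : ℝ) = 2 * (2 / N) := by ring
  linarith

theorem polyEval_rotRe_le_of_card {n d N : ℕ} {S : Finset (Fin n →₀ ℕ)} {c : (Fin n →₀ ℕ) → ℝ}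
    (hS : ∀ m ∈ S, ∑ i, m i = d) (z : Fin n → ℂ) (θ : ℝ) {ε : ℝ} (hε : 0 ≤ ε)
    (h : d < ((Finset.range N).filter
      fun l : ℕ => |polyEval S c (rotRe z (θ + Real.pi * l / N))| ≤ ε).card) :
    (∀ t, |polyEval S c (rotRe z t)| ≤ (d + 1) * N ^ d * ε) ∧
      ‖polyEvalC S c z‖ ≤ 2 ^ d * ((d + 1) * N ^ d * ε) := by
  obtain ⟨Q, hQ, hQt, hQ0⟩ := exists_polynomial_rotRe S c hS z
  obtain ⟨s, hs, hcard⟩ := Finset.exists_subset_card_eq (Nat.succ_le_of_lt h)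
  have hmem : ∀ l ∈ s, l < N ∧ |polyEval S c (rotRe z (θ + Real.pi * l / N))| ≤ ε := by
    intro l hl
    simpa using hs hl
  have hN : (0 : ℝ) < N := by
    obtain ⟨l, hl⟩ : s.Nonempty := Finset.card_pos.mp (by omega)
    exact_mod_cast (Nat.zero_le l).trans_lt (hmem l hl).1
  have key : ∀ ζ : ℂ, ‖ζ‖ ≤ 1 → ‖Q.eval ζ‖ ≤ (d + 1) * N ^ d * ε := by
    intro ζ hζ
    refine (Q.norm_eval_le_of_separated_nodes hQ s
      (fun l : ℕ => Complex.exp ((2 * (θ + Real.pi * l / N) : ℝ) * Complex.I)) hcard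
      (δ := 4 / N) (ε := ε) (by positivity) ?_ ?_ ?_ hζ).trans ?_
    · exact fun j hj k hk hjk => four_div_le_norm_exp_sub_exp (hmem j hj).1 (hmem k hk).1 hjk θ
    · exact fun j _ => (Complex.norm_exp_ofReal_mul_I _).le
    · intro j hj
      rw [hQt]
      exact (hmem j hj).2
    · gcongr
      rw [div_div_eq_mul_div]
      linarith
  refine ⟨fun t => ?_, ?_⟩
  · rw [← hQt]
    exact key _ (Complex.norm_exp_ofReal_mul_I _).le
  · rw [hQ0]
    gcongr
    exact key 0 (by simp)

theorem exists_le_of_contraction {d : ℕ} (hd : 0 < d) {γ c δ : ℝ} (hγ : 0 < γ) (hc : 0 < c)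
    (hc1 : c < 1) (hδ : 0 < δ) :
    ∃ K > 0, ∀ (φ : ℝ → ℝ) (s : ℝ), Monotone φ → (∀ t, 0 ≤ φ t) → 0 < s → φ s ≤ 1 - c →
      (∀ ε > 0, ∀ N : ℕ, 0 < N →
        φ ε ≤ φ ((d + 1) * N ^ d * ε) ^ (1 + γ) + d / N) →
      φ (s * K) ≤ δ := by
  set ρ := (1 - c) ^ γ with hρ
  have hρ0 : 0 < ρ := Real.rpow_pos_of_pos (by linarith) _
  have hρ1 : ρ < 1 := Real.rpow_lt_one (by linarith) (by linarith) hγ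
  obtain ⟨N, hN⟩ := exists_nat_gt ((d : ℝ) / (δ / 2 * (1 - ρ)))
  have hpos : 0 < δ / 2 * (1 - ρ) := mul_pos (by linarith) (by linarith)
  have hd' : (0 : ℝ) < d := by exact_mod_cast hd
  have hN0' : (0 : ℝ) < N := lt_trans (by positivity) hN
  have hN0 : 0 < N := by exact_mod_cast hN0'
  have hη : (d : ℝ) / N / (1 - ρ) ≤ δ / 2 := by
    rw [div_lt_iff₀ hpos] at hN
    rw [div_div, div_le_iff₀ (mul_pos hN0' (by linarith))]
    nlinarith
  obtain ⟨k, hk⟩ := exists_pow_lt_of_lt_one (show 0 < δ / 2 by linarith) hρ1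
  set A : ℝ := (d + 1) * N ^ d with hA
  have hN1 : (1 : ℝ) ≤ N := by exact_mod_cast hN0
  have hA1 : 1 ≤ A := by
    have : (1 : ℝ) ≤ N ^ d := one_le_pow₀ hN1
    nlinarith
  refine ⟨1 / A ^ k, by positivity, fun φ s hmono h0 hs hsc h => ?_⟩
  have key : ∀ j : ℕ, φ (s * (1 / A ^ j)) ≤ ρ ^ j + (d : ℝ) / N / (1 - ρ) := by
    intro j
    induction j with
    | zero =>
      have : 0 ≤ (d : ℝ) / N / (1 - ρ) := div_nonneg (by positivity) (by linarith)
      simp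
      linarith
    | succ j ih =>
      have hstep := h (s * (1 / A ^ (j + 1))) (by positivity) N hN0
      have harg : (d + 1) * (N : ℝ) ^ d * (s * (1 / A ^ (j + 1))) = s * (1 / A ^ j) := by
        rw [← hA, pow_succ]; field_simp
      rw [harg] at hstep
      have hle : φ (s * (1 / A ^ j)) ≤ 1 - c := by
        refine (hmono ?_).trans hsc
        have : 1 / A ^ j ≤ 1 := by
          rw [div_le_one (by positivity)]; exact one_le_pow₀ hA1
        nlinarith
      have hpow : φ (s * (1 / A ^ j)) ^ (1 + γ) ≤ φ (s * (1 / A ^ j)) * ρ := by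
        rcases (h0 (s * (1 / A ^ j))).eq_or_lt with h00 | h00
        · rw [← h00, Real.zero_rpow (by linarith)]; simp
        · rw [Real.rpow_add h00, Real.rpow_one]
          gcongr
          exact Real.rpow_le_rpow h00.le hle hγ.le
      have heq : ρ ^ (j + 1) + (d : ℝ) / N / (1 - ρ)
          = (ρ ^ j + (d : ℝ) / N / (1 - ρ)) * ρ + d / N := by
        have : (1 - ρ) ≠ 0 := by linarith
        field_simp
        ring
      rw [heq]
      have := mul_le_mul_of_nonneg_right ih hρ0.le
      linarith
  linarith [key k]

theorem le_mul_prod_one_add_of_le_add_sum {y w : ℕ → ℝ} {a : ℝ} (hw : ∀ k, 0 ≤ w k)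
    (h : ∀ k, y k ≤ a + ∑ i ∈ Finset.range k, w i * y i) (k : ℕ) :
    y k ≤ a * ∏ i ∈ Finset.range k, (1 + w i) := by
  have hprod : ∀ k, a * ∏ i ∈ Finset.range k, (1 + w i)
      = a + ∑ i ∈ Finset.range k, w i * (a * ∏ j ∈ Finset.range i, (1 + w j)) := by
    intro k
    induction k with
    | zero => simp
    | succ k ih => rw [Finset.prod_range_succ, Finset.sum_range_succ, ← add_assoc, ← ih]; ring
  induction k using Nat.strong_induction_on with
  | _ k ih =>
    rw [hprod]
    refine (h k).trans ?_
    gcongr with i hi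
    · exact hw i
    · exact ih i (Finset.mem_range.mp hi)

theorem exists_geometric_decay {d : ℕ} (hd : 0 < d) {γ : ℝ} (hγ : 0 < γ) :
    ∃ δ > 0, ∃ E > 0, ∀ x : ℕ → ℝ, (∀ k, 0 ≤ x k) → (∀ k, x k ≤ 1) → (∀ k, x k ≤ δ) →
      (∀ k, x (k + 1) ≤ x k ^ (1 + γ) +
        ∑ j ∈ Finset.range k, d / 2 ^ j * x (k - 1 - j) ^ (1 + γ) + d / 2 ^ k) →
      ∀ k, x k ≤ E * (1 / 2) ^ k := by
  have hd' : (1 : ℝ) ≤ d := by exact_mod_cast hd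
  set q : ℝ := (3 / 4) ^ γ with hq
  have hq0 : 0 < q := Real.rpow_pos_of_pos (by norm_num) _
  have hq1 : q < 1 := Real.rpow_lt_one (by norm_num) (by norm_num) hγ
  refine ⟨(1 / (8 * d)) ^ (1 / γ), by positivity,
    2 * d * Real.exp (4 * d * (2 * d) ^ γ * (1 - q)⁻¹), by positivity,
    fun x h0 h1 hδ h => ?_⟩
  have hw : ∀ k, 0 ≤ 4 * d * x k ^ γ := fun k => by have := h0 k; positivity
  have hsplit : ∀ k, x k ^ (1 + γ) = x k ^ γ * x k := by
    intro k
    rcases (h0 k).eq_or_lt with h00 | h00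
    · rw [← h00, Real.zero_rpow (by linarith)]; simp
    · rw [Real.rpow_add h00, Real.rpow_one, mul_comm]
  have hy : ∀ k, 2 ^ k * x k ≤ 2 * d +
      ∑ i ∈ Finset.range k, (4 * d * x i ^ γ) * (2 ^ i * x i) := by
    intro k
    cases k with
    | zero => simp; linarith [h1 0]
    | succ k =>
      rw [Finset.sum_range_succ]
      have hrefl : ∑ j ∈ Finset.range k, (d : ℝ) / 2 ^ j * x (k - 1 - j) ^ (1 + γ)
          = ∑ i ∈ Finset.range k, (d : ℝ) / 2 ^ (k - 1 - i) * x i ^ (1 + γ) := by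
        rw [← Finset.sum_range_reflect]
        refine Finset.sum_congr rfl fun j hj => ?_
        have := Finset.mem_range.mp hj
        rw [show k - 1 - (k - 1 - j) = j by omega]
      have hsum : 2 ^ (k + 1) *
          ∑ i ∈ Finset.range k, (d : ℝ) / 2 ^ (k - 1 - i) * x i ^ (1 + γ)
          = ∑ i ∈ Finset.range k, (4 * d * x i ^ γ) * (2 ^ i * x i) := by
        rw [Finset.mul_sum]
        refine Finset.sum_congr rfl fun i hi => ?_
        have hi' := Finset.mem_range.mp hi
        have : (2 : ℝ) ^ (k + 1) = 2 ^ (k - 1 - i) * 2 ^ i * 4 := by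
          rw [← pow_add, show (4 : ℝ) = 2 ^ 2 by norm_num, ← pow_add]
          congr 1; omega
        rw [hsplit, this]
        field_simp
      have hmul := mul_le_mul_of_nonneg_left (h k) (show (0 : ℝ) ≤ 2 ^ (k + 1) by positivity)
      rw [hrefl, mul_add, mul_add, hsum, hsplit] at hmul
      have h3 : (2 : ℝ) ^ (k + 1) * (d / 2 ^ k) = 2 * d := by rw [pow_succ]; field_simp
      rw [h3] at hmul
      have h4 : (2 : ℝ) ^ (k + 1) * (x k ^ γ * x k) ≤ 4 * d * x k ^ γ * (2 ^ k * x k) := by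
        have : 0 ≤ x k ^ γ * (2 ^ k * x k) := by have := h0 k; positivity
        rw [pow_succ]
        nlinarith
      linarith
  have hg := le_mul_prod_one_add_of_le_add_sum hw hy
  have hsmall : ∀ i, 1 + 4 * d * x i ^ γ ≤ 3 / 2 := by
    intro i
    have h2 : x i ^ γ ≤ 1 / (8 * d) := by
      refine (Real.rpow_le_rpow (h0 i) (hδ i) hγ.le).trans ?_
      rw [← Real.rpow_mul (by positivity), one_div_mul_cancel hγ.ne', Real.rpow_one]
    have h3 : 4 * d * x i ^ γ ≤ 4 * d * (1 / (8 * d)) := by gcongr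
    have h4 : 4 * (d : ℝ) * (1 / (8 * d)) = 1 / 2 := by field_simp; norm_num
    linarith
  have hfirst : ∀ k, x k ≤ 2 * d * (3 / 4) ^ k := by
    intro k
    have h2 : ∏ i ∈ Finset.range k, (1 + 4 * d * x i ^ γ) ≤ (3 / 2) ^ k := by
      calc _ ≤ ∏ i ∈ Finset.range k, (3 / 2 : ℝ) :=
            Finset.prod_le_prod (fun i _ => by linarith [hw i]) fun i _ => hsmall i
        _ = _ := by rw [Finset.prod_const, Finset.card_range]
    have h3 : (2 : ℝ) ^ k * x k ≤ 2 * d * (3 / 2) ^ k :=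
      (hg k).trans (by gcongr)
    have h4 : (2 : ℝ) * d * (3 / 2) ^ k = 2 ^ k * (2 * d * (3 / 4) ^ k) := by
      rw [show (3 / 2 : ℝ) = 2 * (3 / 4) by norm_num, mul_pow]; ring
    rw [h4] at h3
    exact le_of_mul_le_mul_left h3 (by positivity)
  intro k
  have h2 : ∏ i ∈ Finset.range k, (1 + 4 * d * x i ^ γ)
      ≤ Real.exp (4 * d * (2 * d) ^ γ * (1 - q)⁻¹) := by
    calc _ ≤ ∏ i ∈ Finset.range k, Real.exp (4 * d * x i ^ γ) :=
          Finset.prod_le_prod (fun i _ => by linarith [hw i]) fun i _ => by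
            rw [add_comm]; exact Real.add_one_le_exp _
      _ = Real.exp (∑ i ∈ Finset.range k, 4 * d * x i ^ γ) := (Real.exp_sum _ _).symm
      _ ≤ _ := by
        refine Real.exp_le_exp.mpr ?_
        calc _ ≤ ∑ i ∈ Finset.range k, 4 * d * (2 * d) ^ γ * q ^ i := by
              refine Finset.sum_le_sum fun i _ => ?_
              have := Real.rpow_le_rpow (h0 i) (hfirst i) hγ.le
              rw [Real.mul_rpow (by positivity) (by positivity), ← Real.rpow_natCast,
                ← Real.rpow_mul (by norm_num), mul_comm (i : ℝ), Real.rpow_mul (by norm_num),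
                Real.rpow_natCast] at this
              rw [mul_assoc (4 * (d : ℝ))]
              gcongr
          _ = 4 * d * (2 * d) ^ γ * ∑ i ∈ Finset.range k, q ^ i := by rw [Finset.mul_sum]
          _ ≤ _ := by
            gcongr
            rw [← tsum_geometric_of_lt_one hq0.le hq1]
            exact (summable_geometric_of_lt_one hq0.le hq1).sum_le_tsum _
              fun _ _ => by positivity
  have h3 : (2 : ℝ) ^ k * x k ≤ 2 * d * Real.exp (4 * d * (2 * d) ^ γ * (1 - q)⁻¹) :=
    (hg k).trans (by gcongr)
  rw [one_div, inv_pow, ← div_eq_mul_inv, le_div_iff₀ (by positivity)]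
  linarith

theorem small_ball_of_recursion {d : ℕ} (hd : 0 < d) {γ c : ℝ} (hγ : 0 < γ) (hc : 0 < c)
    (hc1 : c < 1) :
    ∃ C > 0, ∀ (φ : ℝ → ℝ) (s : ℝ), Monotone φ → (∀ t, 0 ≤ φ t) → (∀ t, φ t ≤ 1) →
      0 < s → φ s ≤ 1 - c →
      (∀ ε > 0, ∀ N : ℕ, 0 < N →
        φ ε ≤ φ ((d + 1) * N ^ d * ε) ^ (1 + γ) + d / N) →
      (∀ ε > 0, ∀ J : ℕ, φ ε ≤ φ ((d + 1) * ε) ^ (1 + γ) +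
        ∑ j ∈ Finset.range J, d / 2 ^ j * φ ((d + 1) * (2 ^ (j + 1)) ^ d * ε) ^ (1 + γ)
          + d / 2 ^ J) →
      ∀ ε > 0, φ ε ≤ C * (ε / s) ^ ((1 : ℝ) / d) := by
  obtain ⟨δ, hδ, E, hE, hgeo⟩ := exists_geometric_decay hd hγ
  obtain ⟨K, hK, hcon⟩ := exists_le_of_contraction hd hγ hc hc1 hδ
  have hd' : (0 : ℝ) < d := by exact_mod_cast hd
  refine ⟨(2 * E + 1) * K⁻¹ ^ ((1 : ℝ) / d), by positivity,
    fun φ s hmono h0 h1 hs hsc hr1 hr2 ε hε => ?_⟩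
  have hstart := hcon φ s hmono h0 hs hsc hr1
  have hs0 : 0 < s * K := by positivity
  have hdec := hgeo (fun k => φ (s * K * ((1 / 2) ^ k) ^ d)) (fun k => h0 _) (fun k => h1 _)
    (fun k => (hmono (by
      have : (((1 : ℝ) / 2) ^ k) ^ d ≤ 1 :=
        pow_le_one₀ (by positivity) (pow_le_one₀ (by norm_num) (by norm_num))
      nlinarith)).trans hstart) (by
    intro k
    have hkap : ((d : ℝ) + 1) ≤ 2 ^ d := by exact_mod_cast Nat.lt_two_pow_self
    refine (hr2 _ (by positivity) k).trans ?_
    gcongr with j hj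
    · exact h0 _
    · refine hmono ?_
      rw [pow_succ (1 / 2 : ℝ) k, mul_pow _ (1 / 2 : ℝ), one_div 2, inv_pow 2 d]
      have : ((d : ℝ) + 1) * (2 ^ d)⁻¹ ≤ 1 := by
        rw [← div_eq_mul_inv, div_le_one (by positivity)]; exact hkap
      calc (d + 1) * (s * K * (((2⁻¹ : ℝ) ^ k) ^ d * (2 ^ d)⁻¹))
          = (s * K * ((2⁻¹ : ℝ) ^ k) ^ d) * ((d + 1) * (2 ^ d)⁻¹) := by ring
        _ ≤ (s * K * ((2⁻¹ : ℝ) ^ k) ^ d) * 1 := by gcongr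
        _ = _ := by ring
    · exact h0 _
    · refine hmono ?_
      have hj' := Finset.mem_range.mp hj
      have e : ((1 / 2 : ℝ) ^ (k + 1)) = (1 / 2) ^ (k - 1 - j) * (1 / 2) ^ (j + 1) * (1 / 2) := by
        rw [← pow_add, ← pow_succ]; congr 1; omega
      have e2 : (2 : ℝ) ^ (j + 1) * (1 / 2) ^ (j + 1) = 1 := by
        rw [← mul_pow]; norm_num
      calc (d + 1) * ((2 : ℝ) ^ (j + 1)) ^ d * (s * K * ((1 / 2 : ℝ) ^ (k + 1)) ^ d)
          = (s * K * ((1 / 2 : ℝ) ^ (k - 1 - j)) ^ d) * ((d + 1) * (1 / 2) ^ d)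
            * ((2 : ℝ) ^ (j + 1) * (1 / 2) ^ (j + 1)) ^ d := by
              rw [e]; simp only [mul_pow]; ring
        _ ≤ (s * K * ((1 / 2 : ℝ) ^ (k - 1 - j)) ^ d) * 1 * 1 := by
          rw [e2, one_pow]
          gcongr
          rw [one_div, inv_pow, ← div_eq_mul_inv, div_le_one (by positivity)]; exact hkap
        _ = _ := by ring)
  have hscale : (ε / s) ^ ((1 : ℝ) / d) * K⁻¹ ^ ((1 : ℝ) / d) = (ε / (s * K)) ^ ((1 : ℝ) / d) := by
    rw [← Real.mul_rpow (by positivity) (by positivity)]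
    congr 1; field_simp
  rw [mul_assoc, mul_comm (K⁻¹ ^ _), hscale]
  set u := (ε / (s * K)) ^ ((1 : ℝ) / d) with hu
  have hu0 : 0 < u := by positivity
  have hud : u ^ d = ε / (s * K) := by
    rw [hu, ← Real.rpow_natCast, ← Real.rpow_mul (by positivity), one_div_mul_cancel hd'.ne',
      Real.rpow_one]
  rcases le_or_gt 1 u with hu1 | hu1
  · nlinarith [h1 ε]
  · obtain ⟨k, hk1, hk2⟩ := exists_nat_pow_near_of_lt_one hu0 hu1.le
      (show (0 : ℝ) < 1 / 2 by norm_num) (by norm_num)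
    have h2 : φ ε ≤ E * (1 / 2) ^ k := by
      refine (hmono ?_).trans (hdec k)
      have : ε = s * K * u ^ d := by rw [hud]; field_simp
      rw [this]
      gcongr
    rw [pow_succ] at hk1
    nlinarith

theorem lintegral_Ioo_deriv_of_nonneg {g g' : ℝ → ℝ} {a b : ℝ} (hab : a ≤ b)
    (hcont : ContinuousOn g (Set.Icc a b)) (hderiv : ∀ x ∈ Set.Ioo a b, HasDerivAt g (g' x) x)
    (hpos : ∀ x ∈ Set.Ioo a b, 0 ≤ g' x) :
    ∫⁻ x in Set.Ioo a b, ENNReal.ofReal (g' x) = ENNReal.ofReal (g b - g a) := by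
  have hinteg := intervalIntegral.integrableOn_deriv_of_nonneg hcont hderiv hpos
  have hinteg' : IntervalIntegrable g' volume a b :=
    (intervalIntegrable_iff_integrableOn_Ioc_of_le hab).mpr hinteg
  rw [← intervalIntegral.integral_eq_sub_of_hasDerivAt_of_le hab hcont hderiv hinteg',
    intervalIntegral.integral_of_le hab, ← integral_Ioc_eq_integral_Ioo.symm,
    ofReal_integral_eq_lintegral_ofReal]
  · exact hinteg.mono_set Set.Ioo_subset_Ioc_self
  · filter_upwards [ae_restrict_mem measurableSet_Ioo] with x hx using hpos x hx

theorem setLIntegral_eq_setLIntegral_of_subset {α : Type*} [MeasurableSpace α] {μ : Measure α}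
    {s t : Set α} (hs : MeasurableSet s) (ht : MeasurableSet t) (hst : s ⊆ t)
    {f : α → ENNReal} (hf : ∀ x, x ∉ s → f x = 0) :
    ∫⁻ x in t, f x ∂μ = ∫⁻ x in s, f x ∂μ := by
  rw [← lintegral_indicator hs, ← lintegral_indicator ht]
  congr 1
  ext x
  by_cases hx : x ∈ s
  · rw [Set.indicator_of_mem hx, Set.indicator_of_mem (hst hx)]
  · rw [Set.indicator_of_notMem hx]
    by_cases hx' : x ∈ t
    · rw [Set.indicator_of_mem hx', hf x hx]
    · rw [Set.indicator_of_notMem hx']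

/-- The uniform probability measure on `[-1, 1]`. -/
noncomputable def unifInterval : Measure ℝ :=
  (2 : ENNReal)⁻¹ • volume.restrict (Set.Icc (-1) 1)

instance : IsProbabilityMeasure unifInterval := ⟨by
  simp only [unifInterval, Measure.smul_apply, Measure.restrict_apply MeasurableSet.univ,
    Set.univ_inter, Real.volume_Icc, smul_eq_mul]
  norm_num
  exact ENNReal.inv_mul_cancel (by norm_num) (by norm_num)⟩

theorem lintegral_unifInterval (f : ℝ → ENNReal) :
    ∫⁻ x, f x ∂unifInterval = 2⁻¹ * ∫⁻ x in Set.Icc (-1) 1, f x := by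
  simp [unifInterval]

/-- The density, relative to the product of uniform laws on `[-1, 1]`, of the projection to a plane
of the uniform law on the unit sphere. -/
noncomputable def discKernel (a b : ℝ) : ℝ := 2 / Real.pi * (√(1 - a ^ 2 - b ^ 2))⁻¹

theorem discKernel_nonneg (a b : ℝ) : 0 ≤ discKernel a b := by
  unfold discKernel; positivity

theorem discKernel_comm (a b : ℝ) : discKernel a b = discKernel b a := by
  unfold discKernel; congr 3; ring

theorem discKernel_eq_zero {a b : ℝ} (h : 1 ≤ a ^ 2 + b ^ 2) : discKernel a b = 0 := by
  rw [discKernel, Real.sqrt_eq_zero'.mpr (by linarith)]; simp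

theorem two_div_pi_le_discKernel {a b : ℝ} (h : a ^ 2 + b ^ 2 < 1) :
    2 / Real.pi ≤ discKernel a b := by
  rw [discKernel]
  have h1 : 0 < √(1 - a ^ 2 - b ^ 2) := Real.sqrt_pos.mpr (by linarith)
  have h2 : √(1 - a ^ 2 - b ^ 2) ≤ 1 := Real.sqrt_le_one.mpr
    (by nlinarith [sq_nonneg a, sq_nonneg b])
  have : 1 ≤ (√(1 - a ^ 2 - b ^ 2))⁻¹ := (one_le_inv₀ h1).mpr h2
  have hpi : 0 < 2 / Real.pi := by positivity
  nlinarith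

theorem lintegral_unifInterval_eq_of_support {b : ℝ} (hb : |b| < 1) {f : ℝ → ENNReal}
    (hf : ∀ a, 1 ≤ a ^ 2 + b ^ 2 → f a = 0) :
    ∫⁻ a, f a ∂unifInterval =
      2⁻¹ * ∫⁻ a in Set.Ioo (-√(1 - b ^ 2)) (√(1 - b ^ 2)), f a := by
  have hb2 : b ^ 2 < 1 := (sq_lt_one_iff_abs_lt_one b).mpr hb
  rw [lintegral_unifInterval]
  congr 1
  have hR : √(1 - b ^ 2) ≤ 1 := Real.sqrt_le_one.mpr (by nlinarith [sq_nonneg b])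
  refine setLIntegral_eq_setLIntegral_of_subset measurableSet_Ioo measurableSet_Icc
    (fun x hx => ⟨by linarith [hx.1], by linarith [hx.2]⟩) fun a ha => hf a ?_
  by_contra hlt
  refine ha (abs_lt.mp ?_)
  rw [← Real.sqrt_sq_eq_abs]
  exact Real.sqrt_lt_sqrt (sq_nonneg a) (by linarith)

theorem lintegral_discKernel {b : ℝ} (hb : |b| < 1) :
    ∫⁻ a, ENNReal.ofReal (discKernel a b) ∂unifInterval = 1 := by
  rw [lintegral_unifInterval_eq_of_support hb
    (fun a ha => by rw [discKernel_eq_zero ha, ENNReal.ofReal_zero])]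
  have hb2 : b ^ 2 < 1 := (sq_lt_one_iff_abs_lt_one b).mpr hb
  set R := √(1 - b ^ 2) with hR
  have hR0 : 0 < R := Real.sqrt_pos.mpr (by linarith)
  have hR2 : R ^ 2 = 1 - b ^ 2 := Real.sq_sqrt (by linarith)
  rw [lintegral_Ioo_deriv_of_nonneg (g := fun a => 2 / Real.pi * Real.arcsin (a / R))
    (by linarith) (by fun_prop) ?_ (fun a _ => discKernel_nonneg a b)]
  · rw [neg_div, div_self hR0.ne', Real.arcsin_neg, Real.arcsin_one]
    have : 2 / Real.pi * (Real.pi / 2) - 2 / Real.pi * -(Real.pi / 2) = 2 := by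
      have := Real.pi_ne_zero; field_simp; norm_num
    rw [this, ENNReal.ofReal_ofNat]
    exact ENNReal.inv_mul_cancel (by norm_num) (by norm_num)
  · intro a ha
    have h1 : a / R ≠ -1 := by
      rw [Ne, div_eq_iff hR0.ne']; intro h; linarith [ha.1]
    have h2 : a / R ≠ 1 := by
      rw [Ne, div_eq_iff hR0.ne']; intro h; linarith [ha.2]
    have := ((Real.hasDerivAt_arcsin h1 h2).comp a ((hasDerivAt_id a).div_const R)).const_mul
      (2 / Real.pi)
    refine this.congr_deriv ?_
    rw [discKernel]
    congr 1
    rw [show 1 - a ^ 2 - b ^ 2 = (1 - (a / R) ^ 2) * R ^ 2 by field_simp; linarith,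
      Real.sqrt_mul' _ (sq_nonneg R), Real.sqrt_sq hR0.le]
    field_simp

theorem inv_mul_rpow_le {R a : ℝ} (ha : a ∈ Set.Ioo (-R) R) :
    ((√(R ^ 2 - a ^ 2))⁻¹) ^ ((3 : ℝ) / 2)
      ≤ R ^ (-(3 : ℝ) / 4) * ((R - a) ^ (-(3 : ℝ) / 4) + (R + a) ^ (-(3 : ℝ) / 4)) := by
  have h1 : 0 < R - a := by linarith [ha.2]
  have h2 : 0 < R + a := by linarith [ha.1]
  have hR : 0 < R := by linarith
  have e : ((√(R ^ 2 - a ^ 2))⁻¹) ^ ((3 : ℝ) / 2)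
      = (R - a) ^ (-(3 : ℝ) / 4) * (R + a) ^ (-(3 : ℝ) / 4) := by
    rw [← Real.mul_rpow h1.le h2.le, Real.sqrt_eq_rpow, ← Real.rpow_neg (by nlinarith),
      ← Real.rpow_mul (by nlinarith)]
    congr 1 <;> ring
  rw [e]
  have p1 : 0 < (R - a) ^ (-(3 : ℝ) / 4) := by positivity
  have p2 : 0 < (R + a) ^ (-(3 : ℝ) / 4) := by positivity
  rcases le_total 0 a with h | h
  · have : (R + a) ^ (-(3 : ℝ) / 4) ≤ R ^ (-(3 : ℝ) / 4) :=
      Real.rpow_le_rpow_of_nonpos hR (by linarith) (by norm_num)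
    nlinarith
  · have : (R - a) ^ (-(3 : ℝ) / 4) ≤ R ^ (-(3 : ℝ) / 4) :=
      Real.rpow_le_rpow_of_nonpos hR (by linarith) (by norm_num)
    nlinarith

theorem lintegral_discKernel_rpow_le (b : ℝ) :
    ∫⁻ a, ENNReal.ofReal (discKernel a b ^ ((3 : ℝ) / 2)) ∂unifInterval
      ≤ ENNReal.ofReal (8 * √(1 - b ^ 2) ^ (-(1 : ℝ) / 2)) := by
  rcases lt_or_ge |b| 1 with hb | hb
  swap
  · have : ∀ a, discKernel a b = 0 := fun a => discKernel_eq_zero (by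
      have := (one_le_sq_iff_one_le_abs b).mpr hb
      nlinarith [sq_nonneg a])
    simp [this]
  rw [lintegral_unifInterval_eq_of_support hb
    (fun a ha => by rw [discKernel_eq_zero ha, Real.zero_rpow (by norm_num), ENNReal.ofReal_zero])]
  have hb2 : b ^ 2 < 1 := (sq_lt_one_iff_abs_lt_one b).mpr hb
  set R := √(1 - b ^ 2) with hR
  have hR0 : 0 < R := Real.sqrt_pos.mpr (by linarith)
  have hR2 : R ^ 2 = 1 - b ^ 2 := Real.sq_sqrt (by linarith)
  have hle : ∫⁻ a in Set.Ioo (-R) R, ENNReal.ofReal (discKernel a b ^ ((3 : ℝ) / 2))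
      ≤ ∫⁻ a in Set.Ioo (-R) R, ENNReal.ofReal
        (R ^ (-(3 : ℝ) / 4) * ((R - a) ^ (-(3 : ℝ) / 4) + (R + a) ^ (-(3 : ℝ) / 4))) := by
    refine setLIntegral_mono_ae' measurableSet_Ioo (Filter.Eventually.of_forall fun a ha => ?_)
    refine ENNReal.ofReal_le_ofReal (le_trans ?_ (inv_mul_rpow_le ha))
    refine Real.rpow_le_rpow (discKernel_nonneg a b) ?_ (by norm_num)
    rw [discKernel, hR2, show 1 - a ^ 2 - b ^ 2 = 1 - b ^ 2 - a ^ 2 by ring]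
    have : 2 / Real.pi ≤ 1 := by
      rw [div_le_one Real.pi_pos]; exact Real.two_le_pi
    exact mul_le_of_le_one_left (by positivity) this
  have hinteg : ∫⁻ a in Set.Ioo (-R) R, ENNReal.ofReal
        (R ^ (-(3 : ℝ) / 4) * ((R - a) ^ (-(3 : ℝ) / 4) + (R + a) ^ (-(3 : ℝ) / 4)))
      = ENNReal.ofReal (R ^ (-(3 : ℝ) / 4) * (8 * (2 * R) ^ ((1 : ℝ) / 4))) := by
    rw [lintegral_Ioo_deriv_of_nonneg
      (g := fun a => R ^ (-(3 : ℝ) / 4) *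
        (4 * (R + a) ^ ((1 : ℝ) / 4) - 4 * (R - a) ^ ((1 : ℝ) / 4)))
      (by linarith) ?_ ?_ ?_]
    · congr 1
      rw [sub_self, show R + -R = 0 by ring, show R - -R = 2 * R by ring,
        show R + R = 2 * R by ring, Real.zero_rpow (by norm_num)]
      ring
    · have h1 : ContinuousOn (fun a : ℝ => (R + a) ^ ((1 : ℝ) / 4)) (Set.Icc (-R) R) :=
        ContinuousOn.rpow_const (by fun_prop) fun _ _ => Or.inr (by norm_num)
      have h2 : ContinuousOn (fun a : ℝ => (R - a) ^ ((1 : ℝ) / 4)) (Set.Icc (-R) R) :=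
        ContinuousOn.rpow_const (by fun_prop) fun _ _ => Or.inr (by norm_num)
      fun_prop
    · intro a ha
      have h1 : R + a ≠ 0 := by linarith [ha.1]
      have h2 : R - a ≠ 0 := by linarith [ha.2]
      have d1 :=
        (((hasDerivAt_id a).const_add R).rpow_const (p := (1 : ℝ) / 4) (Or.inl h1)).const_mul 4
      have d2 :=
        (((hasDerivAt_id a).const_sub R).rpow_const (p := (1 : ℝ) / 4) (Or.inl h2)).const_mul 4
      refine ((d1.sub d2).const_mul (R ^ (-(3 : ℝ) / 4))).congr_deriv ?_
      rw [show (1 : ℝ) / 4 - 1 = -(3 : ℝ) / 4 by norm_num]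
      simp only [id]
      ring
    · intro a ha
      have h1 : 0 < R + a := by linarith [ha.1]
      have h2 : 0 < R - a := by linarith [ha.2]
      positivity
  refine (mul_le_mul_right (hle.trans hinteg.le) _).trans ?_
  rw [show (2 : ENNReal)⁻¹ = ENNReal.ofReal 2⁻¹ by
    rw [ENNReal.ofReal_inv_of_pos (by norm_num), ENNReal.ofReal_ofNat],
    ← ENNReal.ofReal_mul (by norm_num)]
  refine ENNReal.ofReal_le_ofReal ?_
  rw [Real.mul_rpow (by norm_num) hR0.le]
  have h2 : (2 : ℝ) ^ ((1 : ℝ) / 4) ≤ 2 := by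
    calc (2 : ℝ) ^ ((1 : ℝ) / 4) ≤ 2 ^ (1 : ℝ) :=
          Real.rpow_le_rpow_of_exponent_le (by norm_num) (by norm_num)
      _ = 2 := Real.rpow_one 2
  have h3 : R ^ (-(1 : ℝ) / 2) = R ^ (-(3 : ℝ) / 4) * R ^ ((1 : ℝ) / 4) := by
    rw [← Real.rpow_add hR0]; norm_num
  rw [h3]
  have : 0 < R ^ (-(3 : ℝ) / 4) * R ^ ((1 : ℝ) / 4) := by positivity
  nlinarith

/-- `discKernel` as an extended nonnegative function. -/
noncomputable def discKernelE (a b : ℝ) : ENNReal := ENNReal.ofReal (discKernel a b)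

@[fun_prop]
theorem Measurable.discKernelE {α : Type*} [MeasurableSpace α] {f g : α → ℝ} (hf : Measurable f)
    (hg : Measurable g) : Measurable (fun x => discKernelE (f x) (g x)) := by
  unfold _root_.discKernelE discKernel
  fun_prop

theorem discKernelE_comm (a b : ℝ) : discKernelE a b = discKernelE b a := by
  rw [discKernelE, discKernel_comm, discKernelE]

theorem ae_unifInterval_abs_lt_one : ∀ᵐ x ∂unifInterval, |x| < 1 := by
  have h : ∀ᵐ x ∂(volume.restrict (Set.Icc (-1 : ℝ) 1)), |x| < 1 := by
    rw [← restrict_Ioo_eq_restrict_Icc]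
    filter_upwards [ae_restrict_mem measurableSet_Ioo] with x hx using abs_lt.mpr hx
  exact Measure.ae_smul_measure h _

theorem lintegral_discKernelE {b : ℝ} (hb : |b| < 1) :
    ∫⁻ a, discKernelE a b ∂unifInterval = 1 := lintegral_discKernel hb

theorem lintegral_discKernelE_mul_pow_three_le {G : ℝ → ENNReal} (hG : Measurable G) (b : ℝ) :
    (∫⁻ a, discKernelE a b * G a ∂unifInterval) ^ 3 ≤
      (∫⁻ a, discKernelE a b ^ ((3 : ℝ) / 2) ∂unifInterval) ^ ((3 : ℝ) / 2) *
      (∫⁻ a, discKernelE a b ^ ((3 : ℝ) / 4) * G a ^ 2 ∂unifInterval) *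
      (∫⁻ a, G a ^ 2 ∂unifInterval) ^ ((1 : ℝ) / 2) := by
  have hk : Measurable fun a => discKernelE a b := by fun_prop
  have h := ENNReal.lintegral_prod_norm_pow_le (μ := unifInterval) (Finset.univ : Finset (Fin 3))
    (f := ![fun a => discKernelE a b ^ ((3 : ℝ) / 2),
      fun a => discKernelE a b ^ ((3 : ℝ) / 4) * G a ^ 2, fun a => G a ^ 2])
    (p := ![1 / 2, 1 / 3, 1 / 6]) (by
      intro i _
      fin_cases i
      · exact (hk.pow_const _).aemeasurable
      · exact ((hk.pow_const _).mul (hG.pow_const _)).aemeasurable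
      · exact (hG.pow_const _).aemeasurable)
    (by simp [Fin.sum_univ_three]; norm_num)
    (by intro i _; fin_cases i <;> simp)
  simp only [Fin.prod_univ_three, Matrix.cons_val_zero, Matrix.cons_val_one, Matrix.cons_val] at h
  have e : ∀ a, (discKernelE a b ^ ((3 : ℝ) / 2)) ^ ((1 : ℝ) / 2) *
      (discKernelE a b ^ ((3 : ℝ) / 4) * G a ^ 2) ^ ((1 : ℝ) / 3) * (G a ^ 2) ^ ((1 : ℝ) / 6)
      = discKernelE a b * G a := by
    intro a
    rw [ENNReal.mul_rpow_of_nonneg _ _ (by norm_num), ← ENNReal.rpow_mul, ← ENNReal.rpow_mul,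
      ← ENNReal.rpow_natCast, ← ENNReal.rpow_mul, ← ENNReal.rpow_mul, ← mul_assoc,
      ← ENNReal.rpow_add_of_nonneg _ _ (by norm_num) (by norm_num), mul_assoc,
      ← ENNReal.rpow_add_of_nonneg _ _ (by norm_num) (by norm_num)]
    norm_num
  simp only [e] at h
  refine (pow_le_pow_left' h 3).trans (le_of_eq ?_)
  rw [mul_pow, mul_pow]
  simp only [← ENNReal.rpow_natCast (n := 3), ← ENNReal.rpow_mul]
  norm_num

theorem lintegral_lintegral_discKernelE_pow_three_le {G : ℝ → ENNReal} (hG : Measurable G) :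
    ∫⁻ b, (∫⁻ a, discKernelE a b * G a ∂unifInterval) ^ 3 ∂unifInterval ≤
      1024 * (∫⁻ a, G a ^ 2 ∂unifInterval) ^ ((3 : ℝ) / 2) := by
  set D := ∫⁻ a, G a ^ 2 ∂unifInterval with hD
  have hpow : ∀ a b, discKernelE a b ^ ((3 : ℝ) / 2)
      = ENNReal.ofReal (discKernel a b ^ ((3 : ℝ) / 2)) := fun a b =>
    ENNReal.ofReal_rpow_of_nonneg (discKernel_nonneg a b) (by norm_num)
  have hA : ∀ b, (∫⁻ a, discKernelE a b ^ ((3 : ℝ) / 2) ∂unifInterval) ^ ((3 : ℝ) / 2)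
      ≤ ENNReal.ofReal (64 * √(1 - b ^ 2) ^ (-(3 : ℝ) / 4)) := by
    intro b
    simp only [hpow]
    refine (ENNReal.rpow_le_rpow (lintegral_discKernel_rpow_le b) (by norm_num)).trans ?_
    rw [ENNReal.ofReal_rpow_of_nonneg (by positivity) (by norm_num)]
    refine ENNReal.ofReal_le_ofReal ?_
    rw [Real.mul_rpow (by norm_num) (by positivity), ← Real.rpow_mul (by positivity)]
    have h8 : (8 : ℝ) ^ ((3 : ℝ) / 2) ≤ 64 := by
      calc (8 : ℝ) ^ ((3 : ℝ) / 2) ≤ 8 ^ (2 : ℝ) :=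
            Real.rpow_le_rpow_of_exponent_le (by norm_num) (by norm_num)
        _ = 64 := by norm_num
    rw [show -(1 : ℝ) / 2 * (3 / 2) = -3 / 4 by norm_num]
    gcongr
  have hinner : ∀ a, ∫⁻ b, ENNReal.ofReal (64 * √(1 - b ^ 2) ^ (-(3 : ℝ) / 4)) *
      discKernelE a b ^ ((3 : ℝ) / 4) ∂unifInterval ≤ 1024 := by
    intro a
    have hpt : ∀ b, ENNReal.ofReal (64 * √(1 - b ^ 2) ^ (-(3 : ℝ) / 4)) *
        discKernelE a b ^ ((3 : ℝ) / 4) ≤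
        ENNReal.ofReal (128 * √(1 - a ^ 2) ^ ((3 : ℝ) / 4)) *
          ENNReal.ofReal (discKernel b a ^ ((3 : ℝ) / 2)) := by
      intro b
      rw [discKernelE, ENNReal.ofReal_rpow_of_nonneg (discKernel_nonneg a b) (by norm_num),
        ← ENNReal.ofReal_mul (by positivity), ← ENNReal.ofReal_mul (by positivity),
        discKernel_comm]
      refine ENNReal.ofReal_le_ofReal ?_
      rcases le_or_gt 1 (a ^ 2 + b ^ 2) with h | h
      · rw [discKernel_comm, discKernel_eq_zero h, Real.zero_rpow (by norm_num),
          Real.zero_rpow (by norm_num)]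
        simp
      have hb : 0 < 1 - b ^ 2 := by nlinarith [sq_nonneg a]
      have ha : 0 < 1 - a ^ 2 := by nlinarith [sq_nonneg b]
      have hsb := Real.sqrt_pos.mpr hb
      have hsa := Real.sqrt_pos.mpr ha
      have hk : 0 < discKernel b a := lt_of_lt_of_le (by positivity)
        (two_div_pi_le_discKernel (by linarith))
      have hinv : (√(1 - b ^ 2))⁻¹ ≤ √(1 - a ^ 2) * (Real.pi / 2 * discKernel b a) := by
        have hw : 0 < 1 - b ^ 2 - a ^ 2 := by linarith
        have : Real.pi / 2 * discKernel b a = (√(1 - b ^ 2 - a ^ 2))⁻¹ := by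
          rw [discKernel]
          have := Real.pi_ne_zero
          field_simp
        rw [this, inv_le_comm₀ hsb (by positivity), mul_inv, inv_inv, ← div_eq_inv_mul,
          ← Real.sqrt_div' _ ha.le]
        refine Real.sqrt_le_sqrt ?_
        rw [div_le_iff₀ ha]
        nlinarith [mul_nonneg (sq_nonneg a) (sq_nonneg b)]
      have hpow2 := Real.rpow_le_rpow (by positivity) hinv (show (0 : ℝ) ≤ 3 / 4 by norm_num)
      rw [Real.mul_rpow hsa.le (by positivity), Real.mul_rpow (by positivity) hk.le,
        Real.inv_rpow hsb.le, ← Real.rpow_neg hsb.le] at hpow2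
      have hpi : (Real.pi / 2) ^ ((3 : ℝ) / 4) ≤ 2 := by
        calc (Real.pi / 2) ^ ((3 : ℝ) / 4) ≤ 2 ^ ((3 : ℝ) / 4) :=
              Real.rpow_le_rpow (by positivity) (by linarith [Real.pi_le_four]) (by norm_num)
          _ ≤ 2 ^ (1 : ℝ) := Real.rpow_le_rpow_of_exponent_le (by norm_num) (by norm_num)
          _ = 2 := Real.rpow_one 2
      have hk2 : discKernel b a ^ ((3 : ℝ) / 2)
          = discKernel b a ^ ((3 : ℝ) / 4) * discKernel b a ^ ((3 : ℝ) / 4) := by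
        rw [← Real.rpow_add hk]; norm_num
      rw [hk2, neg_div]
      calc 64 * √(1 - b ^ 2) ^ (-((3 : ℝ) / 4)) * discKernel b a ^ ((3 : ℝ) / 4)
          ≤ 64 * (√(1 - a ^ 2) ^ ((3 : ℝ) / 4) * (2 * discKernel b a ^ ((3 : ℝ) / 4)))
            * discKernel b a ^ ((3 : ℝ) / 4) := by
            gcongr
            refine hpow2.trans ?_
            gcongr
        _ = _ := by ring
    refine (lintegral_mono hpt).trans ?_
    rw [lintegral_const_mul' _ _ ENNReal.ofReal_ne_top]
    refine (mul_le_mul_right (lintegral_discKernel_rpow_le a) _).trans ?_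
    rw [← ENNReal.ofReal_mul (by positivity), show (1024 : ENNReal) = ENNReal.ofReal 1024 by simp]
    refine ENNReal.ofReal_le_ofReal ?_
    have hR1 : √(1 - a ^ 2) ≤ 1 := Real.sqrt_le_one.mpr (by nlinarith [sq_nonneg a])
    have hfin : √(1 - a ^ 2) ^ ((3 : ℝ) / 4) * √(1 - a ^ 2) ^ (-(1 : ℝ) / 2) ≤ 1 := by
      rcases (Real.sqrt_nonneg (1 - a ^ 2)).eq_or_lt with h | h
      · rw [← h, Real.zero_rpow (by norm_num)]; simp
      · rw [← Real.rpow_add h]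
        exact Real.rpow_le_one h.le hR1 (by norm_num)
    linarith
  calc ∫⁻ b, (∫⁻ a, discKernelE a b * G a ∂unifInterval) ^ 3 ∂unifInterval
      ≤ ∫⁻ b, (∫⁻ a, ENNReal.ofReal (64 * √(1 - b ^ 2) ^ (-(3 : ℝ) / 4)) *
        discKernelE a b ^ ((3 : ℝ) / 4) * G a ^ 2 ∂unifInterval) * D ^ ((1 : ℝ) / 2)
          ∂unifInterval := by
        refine lintegral_mono fun b => (lintegral_discKernelE_mul_pow_three_le hG b).trans ?_
        gcongr
        simp only [mul_assoc]
        rw [lintegral_const_mul]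
        · gcongr
          exact hA b
        · fun_prop
    _ = (∫⁻ a, (∫⁻ b, ENNReal.ofReal (64 * √(1 - b ^ 2) ^ (-(3 : ℝ) / 4)) *
        discKernelE a b ^ ((3 : ℝ) / 4) ∂unifInterval) * G a ^ 2 ∂unifInterval)
          * D ^ ((1 : ℝ) / 2) := by
        have hm : Measurable (Function.uncurry fun b a : ℝ =>
            ENNReal.ofReal (64 * √(1 - b ^ 2) ^ (-(3 : ℝ) / 4)) *
            discKernelE a b ^ ((3 : ℝ) / 4) * G a ^ 2) := by
          simp only [Function.uncurry_def]
          fun_prop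
        have hm' : Measurable fun b => ∫⁻ a, ENNReal.ofReal (64 * √(1 - b ^ 2) ^ (-(3 : ℝ) / 4)) *
            discKernelE a b ^ ((3 : ℝ) / 4) * G a ^ 2 ∂unifInterval := hm.lintegral_prod_right'
        rw [lintegral_mul_const _ hm', lintegral_lintegral_swap hm.aemeasurable]
        congr 2
        ext a
        rw [lintegral_mul_const]
        fun_prop
    _ ≤ (∫⁻ a, 1024 * G a ^ 2 ∂unifInterval) * D ^ ((1 : ℝ) / 2) := by
        gcongr with a
        exact hinner a
    _ = 1024 * D ^ ((3 : ℝ) / 2) := by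
        rw [lintegral_const_mul _ (hG.pow_const _), ← hD, mul_assoc]
        congr 1
        nth_rw 1 [← ENNReal.rpow_one D]
        rw [← ENNReal.rpow_add_of_nonneg _ _ (by norm_num) (by norm_num)]
        norm_num

theorem lintegral_lintegral_sub_sq_add {α : Type*} [MeasurableSpace α] (ρ : Measure α)
    [IsProbabilityMeasure ρ] {H : α → ENNReal} (hH : Measurable H) (hH1 : ∀ a, H a ≤ 1) :
    ∫⁻ a, ∫⁻ c, ENNReal.ofReal (((H a).toReal - (H c).toReal) ^ 2) ∂ρ ∂ρ +
      2 * (∫⁻ a, H a ∂ρ) ^ 2 = 2 * ∫⁻ a, H a ^ 2 ∂ρ := by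
  have hpt : ∀ a c, ENNReal.ofReal (((H a).toReal - (H c).toReal) ^ 2) + 2 * (H a * H c)
      = H a ^ 2 + H c ^ 2 := by
    intro a c
    have ha := ENNReal.ofReal_toReal (ne_top_of_le_ne_top ENNReal.one_ne_top (hH1 a))
    have hc := ENNReal.ofReal_toReal (ne_top_of_le_ne_top ENNReal.one_ne_top (hH1 c))
    set x := (H a).toReal
    set y := (H c).toReal
    have hx : 0 ≤ x := ENNReal.toReal_nonneg
    have hy : 0 ≤ y := ENNReal.toReal_nonneg
    rw [← ha, ← hc, ← ENNReal.ofReal_mul hx, ← ENNReal.ofReal_pow hx, ← ENNReal.ofReal_pow hy,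
      show (2 : ENNReal) = ENNReal.ofReal 2 by simp, ← ENNReal.ofReal_mul (by norm_num),
      ← ENNReal.ofReal_add (by positivity) (by positivity),
      ← ENNReal.ofReal_add (by positivity) (by positivity)]
    congr 1
    ring
  have hin : ∀ a, ∫⁻ c, ENNReal.ofReal (((H a).toReal - (H c).toReal) ^ 2) ∂ρ
      + 2 * (H a * ∫⁻ c, H c ∂ρ) = H a ^ 2 + ∫⁻ c, H c ^ 2 ∂ρ := by
    intro a
    rw [← lintegral_const_mul _ hH, ← lintegral_const_mul _ (hH.const_mul _),
      ← lintegral_add_right _ ((hH.const_mul _).const_mul _)]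
    simp only [hpt]
    rw [lintegral_add_left measurable_const]
    simp
  have hm : Measurable fun a => 2 * (H a * ∫⁻ c, H c ∂ρ) := (hH.mul_const _).const_mul _
  calc _ = ∫⁻ a, (∫⁻ c, ENNReal.ofReal (((H a).toReal - (H c).toReal) ^ 2) ∂ρ
      + 2 * (H a * ∫⁻ c, H c ∂ρ)) ∂ρ := by
        rw [lintegral_add_right _ hm, lintegral_const_mul _ (hH.mul_const _),
          lintegral_mul_const _ hH, sq]
    _ = _ := by
        simp only [hin]
        rw [lintegral_add_right _ measurable_const]
        simp [two_mul]

theorem two_div_pi_le_lintegral_discKernelE_mul {a c : ℝ} (ha : |a| < 1) (hc : |c| < 1) :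
    ENNReal.ofReal (2 / Real.pi) ≤
      ∫⁻ b, discKernelE a b * discKernelE c b ∂unifInterval := by
  wlog h : |c| ≤ |a| generalizing a c
  · have := this hc ha (le_of_not_ge h)
    simpa only [mul_comm] using this
  have h1 : ∫⁻ b, discKernelE a b ∂unifInterval = 1 := by
    simp only [discKernelE_comm a]
    exact lintegral_discKernelE ha
  calc ENNReal.ofReal (2 / Real.pi)
      = ∫⁻ b, ENNReal.ofReal (2 / Real.pi) * discKernelE a b ∂unifInterval := by
        rw [lintegral_const_mul _ (by fun_prop), h1, mul_one]
    _ ≤ _ := by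
        refine lintegral_mono fun b => ?_
        rw [mul_comm]
        rcases le_or_gt 1 (a ^ 2 + b ^ 2) with hab | hab
        · simp [discKernelE, discKernel_eq_zero hab]
        · gcongr
          refine ENNReal.ofReal_le_ofReal (two_div_pi_le_discKernel ?_)
          have := sq_le_sq.mpr h
          linarith

theorem lintegral_discKernelE_swap {H : ℝ → ENNReal} (hH : Measurable H) :
    ∫⁻ b, ∫⁻ a, discKernelE a b * H a ∂unifInterval ∂unifInterval = ∫⁻ a, H a ∂unifInterval := by
  rw [lintegral_lintegral_swap]
  · refine lintegral_congr_ae ?_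
    filter_upwards [ae_unifInterval_abs_lt_one] with a ha
    simp only [discKernelE_comm a]
    rw [lintegral_mul_const _ (by fun_prop), lintegral_discKernelE ha, one_mul]
  · simp only [Function.uncurry_def]
    fun_prop

theorem lintegral_discKernelE_sq_add_of_abs_lt_one {H : ℝ → ENNReal} (hH : Measurable H)
    (hH1 : ∀ a, H a ≤ 1) {b : ℝ} (hb : |b| < 1) :
    ∫⁻ a, discKernelE a b * ∫⁻ c, discKernelE c b *
        ENNReal.ofReal (((H a).toReal - (H c).toReal) ^ 2) ∂unifInterval ∂unifInterval +
      2 * (∫⁻ a, discKernelE a b * H a ∂unifInterval) ^ 2 =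
      2 * ∫⁻ a, discKernelE a b * H a ^ 2 ∂unifInterval := by
  set D : ℝ → ℝ → ENNReal := fun a c => ENNReal.ofReal (((H a).toReal - (H c).toReal) ^ 2) with hD
  have hDm : Measurable (Function.uncurry D) := by
    simp only [Function.uncurry_def, hD]
    fun_prop
  have hDm' : ∀ a, Measurable (D a) := fun a => by
    simp only [hD]
    fun_prop
  have hk : Measurable fun a => discKernelE a b := by fun_prop
  let ρ := unifInterval.withDensity fun a => discKernelE a b
  have : IsProbabilityMeasure ρ := ⟨by
    rw [withDensity_apply _ MeasurableSet.univ, setLIntegral_univ, lintegral_discKernelE hb]⟩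
  have h := lintegral_lintegral_sub_sq_add ρ hH hH1
  simp only [ρ] at h
  rw [lintegral_withDensity_eq_lintegral_mul _ hk hH,
    lintegral_withDensity_eq_lintegral_mul _ hk (hH.pow_const 2),
    lintegral_withDensity_eq_lintegral_mul₀ hk.aemeasurable (by
      exact (hDm.lintegral_prod_right').aemeasurable)] at h
  refine Eq.trans ?_ h
  congr 1
  refine lintegral_congr fun a => ?_
  simp only [Pi.mul_apply]
  rw [lintegral_withDensity_eq_lintegral_mul _ hk (hDm' a)]
  rfl

theorem lintegral_discKernelE_sq_add_le {H : ℝ → ENNReal} (hH : Measurable H)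
    (hH1 : ∀ a, H a ≤ 1) :
    ENNReal.ofReal (2 / Real.pi) * ∫⁻ a, ∫⁻ c, ENNReal.ofReal (((H a).toReal - (H c).toReal) ^ 2)
        ∂unifInterval ∂unifInterval +
      2 * ∫⁻ b, (∫⁻ a, discKernelE a b * H a ∂unifInterval) ^ 2 ∂unifInterval ≤
      2 * ∫⁻ a, H a ^ 2 ∂unifInterval := by
  set D : ℝ → ℝ → ENNReal := fun a c => ENNReal.ofReal (((H a).toReal - (H c).toReal) ^ 2) with hD
  have hDm : Measurable (Function.uncurry D) := by
    simp only [Function.uncurry_def, hD]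
    fun_prop
  have hDm' : ∀ a, Measurable (D a) := fun a => by
    simp only [hD]
    fun_prop
  have hA1 : Measurable fun y : (ℝ × ℝ) => ∫⁻ c, discKernelE c y.1 * D y.2 c ∂unifInterval := by
    have : Measurable fun w : (ℝ × ℝ) × ℝ => discKernelE w.2 w.1.1 * D w.1.2 w.2 := by
      simp only [hD]
      fun_prop
    exact this.lintegral_prod_right'
  have hA2 : Measurable fun b => ∫⁻ a, discKernelE a b * H a ∂unifInterval := by
    have : Measurable fun w : ℝ × ℝ => discKernelE w.2 w.1 * H w.2 := by fun_prop
    exact this.lintegral_prod_right'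
  have hsum : ∫⁻ b, ∫⁻ a, discKernelE a b * ∫⁻ c, discKernelE c b * D a c
        ∂unifInterval ∂unifInterval ∂unifInterval
      + 2 * ∫⁻ b, (∫⁻ a, discKernelE a b * H a ∂unifInterval) ^ 2 ∂unifInterval
      = 2 * ∫⁻ a, H a ^ 2 ∂unifInterval := by
    rw [← lintegral_const_mul _ (hA2.pow_const 2),
      ← lintegral_add_right _ ((hA2.pow_const 2).const_mul _),
      ← lintegral_discKernelE_swap (hH.pow_const 2), ← lintegral_const_mul]
    · refine lintegral_congr_ae ?_
      filter_upwards [ae_unifInterval_abs_lt_one] with b hb using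
        lintegral_discKernelE_sq_add_of_abs_lt_one hH hH1 hb
    · have : Measurable fun w : ℝ × ℝ => discKernelE w.2 w.1 * H w.2 ^ 2 := by fun_prop
      exact this.lintegral_prod_right'
  rw [← hsum]
  gcongr
  change ENNReal.ofReal (2 / Real.pi) * ∫⁻ a, ∫⁻ c, D a c ∂unifInterval ∂unifInterval ≤ _
  have hD1 : Measurable fun a => ∫⁻ c, D a c ∂unifInterval := hDm.lintegral_prod_right'
  rw [lintegral_lintegral_swap (f := fun b a => discKernelE a b * ∫⁻ c, discKernelE c b * D a c
    ∂unifInterval)]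
  · rw [← lintegral_const_mul _ hD1]
    refine lintegral_mono_ae ?_
    filter_upwards [ae_unifInterval_abs_lt_one] with a ha
    have e : ∫⁻ b, discKernelE a b * ∫⁻ c, discKernelE c b * D a c ∂unifInterval ∂unifInterval
        = ∫⁻ b, ∫⁻ c, discKernelE a b * discKernelE c b * D a c ∂unifInterval ∂unifInterval := by
      refine lintegral_congr fun b => ?_
      have hc : Measurable fun c => discKernelE c b * D a c := by
        simp only [hD]
        fun_prop
      rw [← lintegral_const_mul _ hc]
      simp only [mul_assoc]
    rw [e, lintegral_lintegral_swap]
    · change ENNReal.ofReal _ * ∫⁻ c, D a c ∂unifInterval ≤ _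
      rw [← lintegral_const_mul _ (hDm' a)]
      refine lintegral_mono_ae ?_
      filter_upwards [ae_unifInterval_abs_lt_one] with c hc
      rw [lintegral_mul_const _ (by fun_prop)]
      gcongr
      exact two_div_pi_le_lintegral_discKernelE_mul ha hc
    · simp only [Function.uncurry_def, hD]
      fun_prop
  · simp only [Function.uncurry_def]
    have : Measurable fun w : ℝ × ℝ => discKernelE w.2 w.1 := by fun_prop
    exact (this.mul hA1).aemeasurable

theorem rpow_mul_rpow_le_of_gap {m W i2 i3 : ℝ} (hm : 0 ≤ m) (hmW : m ^ 2 ≤ W) (hi2 : 0 ≤ i2)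
    (hi3 : 0 ≤ i3) (h2 : i2 ≤ W - 2 / Real.pi * (W - m ^ 2))
    (h3 : i3 + 3 * m ^ 2 * m ≤ 3 * m * i2 + m ^ 3 + 1024 * (W - m ^ 2) ^ ((3 : ℝ) / 2)) :
    i2 ^ ((3999 : ℝ) / 4000) * i3 ^ ((1 : ℝ) / 4000) ≤ W ^ ((8001 : ℝ) / 8000) := by
  have hG : 0 ≤ W - m ^ 2 := by linarith
  have hW : 0 ≤ W := (sq_nonneg m).trans hmW
  have hpi : (3 : ℝ) / 5 ≤ 2 / Real.pi := by
    rw [div_le_div_iff₀ (by norm_num) Real.pi_pos]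
    linarith [Real.pi_lt_d2]
  have h2' : i2 ≤ W - 3 / 5 * (W - m ^ 2) := by nlinarith
  rcases hW.eq_or_lt with h0 | hW0
  · have : i2 = 0 := by nlinarith
    rw [this, Real.zero_rpow (by norm_num), zero_mul]
    positivity
  set s := √W with hs
  have hs0 : 0 < s := Real.sqrt_pos.mpr hW0
  have hss : s ^ 2 = W := Real.sq_sqrt hW
  have hms : m ≤ s := Real.le_sqrt_of_sq_le hmW
  have hGs : (W - m ^ 2) ^ ((3 : ℝ) / 2) ≤ s * (W - m ^ 2) := by
    rw [show (3 : ℝ) / 2 = 1 / 2 + 1 by norm_num, Real.rpow_add_one' hG (by norm_num),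
      ← Real.sqrt_eq_rpow]
    gcongr
    rw [hs]
    exact Real.sqrt_le_sqrt (by linarith [sq_nonneg m])
  have h3' : i3 / s ≤ m ^ 2 + 1027 * (W - m ^ 2) := by
    rw [div_le_iff₀ hs0]
    nlinarith [mul_nonneg hm hG, mul_le_mul_of_nonneg_right hms hG,
      mul_le_mul_of_nonneg_right hms (sq_nonneg m), mul_le_mul_of_nonneg_left h2' hm]
  have hamgm := Real.geom_mean_le_arith_mean2_weighted (w₁ := 3999 / 4000) (w₂ := 1 / 4000)
    (p₁ := i2) (p₂ := i3 / s) (by norm_num) (by norm_num) hi2 (by positivity) (by norm_num)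
  have hle : i2 ^ ((3999 : ℝ) / 4000) * (i3 / s) ^ ((1 : ℝ) / 4000) ≤ W := by linarith
  have e : i3 = i3 / s * s := by field_simp
  rw [e, Real.mul_rpow (by positivity) hs0.le, ← mul_assoc]
  calc _ ≤ W * s ^ ((1 : ℝ) / 4000) := by gcongr
    _ = W ^ ((8001 : ℝ) / 8000) := by
      rw [hs, Real.sqrt_eq_rpow, ← Real.rpow_mul hW]
      nth_rw 1 [← Real.rpow_one W]
      rw [← Real.rpow_add hW0]
      norm_num

theorem pow_three_add_le_of_le_add {U M V : ENNReal} (hU : U ≠ ⊤) (hM : M ≠ ⊤) (h : U ≤ M + V) :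
    U ^ 3 + 3 * M ^ 2 * U ≤ 3 * M * U ^ 2 + M ^ 3 + V ^ 3 := by
  rcases eq_or_ne V ⊤ with rfl | hV
  · simp
  lift U to NNReal using hU
  lift M to NNReal using hM
  lift V to NNReal using hV
  norm_cast at h ⊢
  rw [← NNReal.coe_le_coe] at h ⊢
  push_cast at h ⊢
  have : ((U : ℝ) - M) ^ 3 ≤ (V : ℝ) ^ 3 :=
    (Odd.strictMono_pow (by decide)).monotone (by linarith)
  nlinarith

theorem lintegral_discKernelE_mul_le_one {H : ℝ → ENNReal} (hH1 : ∀ a, H a ≤ 1) {b : ℝ}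
    (hb : |b| < 1) : ∫⁻ a, discKernelE a b * H a ∂unifInterval ≤ 1 := by
  rw [← lintegral_discKernelE hb]
  exact lintegral_mono fun a => mul_le_of_le_one_right' (hH1 a)

theorem measurable_lintegral_discKernelE_mul {H : ℝ → ENNReal} (hH : Measurable H) :
    Measurable fun b => ∫⁻ a, discKernelE a b * H a ∂unifInterval := by
  have : Measurable fun w : ℝ × ℝ => discKernelE w.2 w.1 * H w.2 := by fun_prop
  exact this.lintegral_prod_right'

theorem lintegral_abs_sub_mean_sq_add {H : ℝ → ENNReal} (hH : Measurable H)
    (hH1 : ∀ a, H a ≤ 1) :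
    ∫⁻ a, ENNReal.ofReal |(H a).toReal - (∫⁻ a, H a ∂unifInterval).toReal| ^ 2 ∂unifInterval
      + (∫⁻ a, H a ∂unifInterval) ^ 2 = ∫⁻ a, H a ^ 2 ∂unifInterval := by
  set M := ∫⁻ a, H a ∂unifInterval with hM
  have hM1 : M ≤ 1 := by
    calc M ≤ ∫⁻ _, 1 ∂unifInterval := lintegral_mono hH1
      _ = 1 := by simp
  have hMt : M ≠ ⊤ := ne_top_of_le_ne_top ENNReal.one_ne_top hM1
  have hpt : ∀ a, ENNReal.ofReal |(H a).toReal - M.toReal| ^ 2 + 2 * (H a * M)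
      = H a ^ 2 + M ^ 2 := by
    intro a
    have ha := ENNReal.ofReal_toReal (ne_top_of_le_ne_top ENNReal.one_ne_top (hH1 a))
    have hc := ENNReal.ofReal_toReal hMt
    set x := (H a).toReal
    set y := M.toReal
    have hx : 0 ≤ x := ENNReal.toReal_nonneg
    have hy : 0 ≤ y := ENNReal.toReal_nonneg
    rw [← ha, ← hc, ← ENNReal.ofReal_mul hx, ← ENNReal.ofReal_pow hx, ← ENNReal.ofReal_pow hy,
      show (2 : ENNReal) = ENNReal.ofReal 2 by simp, ← ENNReal.ofReal_mul (by norm_num),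
      ← ENNReal.ofReal_pow (abs_nonneg _), sq_abs,
      ← ENNReal.ofReal_add (by positivity) (by positivity),
      ← ENNReal.ofReal_add (by positivity) (by positivity)]
    congr 1
    ring
  have h := lintegral_congr (μ := unifInterval) hpt
  rw [lintegral_add_right _ ((hH.mul_const _).const_mul _), lintegral_add_right _ measurable_const,
    lintegral_const_mul _ (hH.mul_const _), lintegral_mul_const _ hH, ← hM] at h
  simp only [lintegral_const, measure_univ, mul_one] at h
  rw [two_mul, ← add_assoc, ← sq] at h
  exact (ENNReal.add_left_inj (ENNReal.pow_ne_top hMt)).mp h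

theorem lintegral_discKernelE_pow_three_add_le {H : ℝ → ENNReal} (hH : Measurable H)
    (hH1 : ∀ a, H a ≤ 1) :
    ∫⁻ b, (∫⁻ a, discKernelE a b * H a ∂unifInterval) ^ 3 ∂unifInterval +
      3 * (∫⁻ a, H a ∂unifInterval) ^ 2 * ∫⁻ a, H a ∂unifInterval ≤
    3 * (∫⁻ a, H a ∂unifInterval) *
        ∫⁻ b, (∫⁻ a, discKernelE a b * H a ∂unifInterval) ^ 2 ∂unifInterval
      + (∫⁻ a, H a ∂unifInterval) ^ 3
      + 1024 * (∫⁻ a, ENNReal.ofReal |(H a).toReal - (∫⁻ a, H a ∂unifInterval).toReal| ^ 2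
          ∂unifInterval) ^ ((3 : ℝ) / 2) := by
  set M := ∫⁻ a, H a ∂unifInterval with hM
  set U : ℝ → ENNReal := fun b => ∫⁻ a, discKernelE a b * H a ∂unifInterval with hU
  set G : ℝ → ENNReal := fun a => ENNReal.ofReal |(H a).toReal - M.toReal| with hG
  have hM1 : M ≤ 1 := by
    calc M ≤ ∫⁻ _, 1 ∂unifInterval := lintegral_mono hH1
      _ = 1 := by simp
  have hMt : M ≠ ⊤ := ne_top_of_le_ne_top ENNReal.one_ne_top hM1
  have hUm : Measurable U := measurable_lintegral_discKernelE_mul hH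
  have hGm : Measurable G := by
    simp only [hG, ← Real.norm_eq_abs]
    fun_prop
  have hVm := measurable_lintegral_discKernelE_mul hGm
  have hUM : ∫⁻ b, U b ∂unifInterval = M := lintegral_discKernelE_swap hH
  have hHG : ∀ a, H a ≤ M + G a := by
    intro a
    have ha := ENNReal.ofReal_toReal (ne_top_of_le_ne_top ENNReal.one_ne_top (hH1 a))
    have hc := ENNReal.ofReal_toReal hMt
    calc H a = ENNReal.ofReal (H a).toReal := ha.symm
      _ ≤ ENNReal.ofReal (M.toReal + |(H a).toReal - M.toReal|) :=
        ENNReal.ofReal_le_ofReal (by linarith [le_abs_self ((H a).toReal - M.toReal)])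
      _ = M + G a := by
        rw [ENNReal.ofReal_add ENNReal.toReal_nonneg (abs_nonneg _), hc]
  have hle : ∫⁻ b, (U b ^ 3 + 3 * M ^ 2 * U b) ∂unifInterval ≤
      ∫⁻ b, (3 * M * U b ^ 2 + M ^ 3 + (∫⁻ a, discKernelE a b * G a ∂unifInterval) ^ 3)
        ∂unifInterval := by
    refine lintegral_mono_ae ?_
    filter_upwards [ae_unifInterval_abs_lt_one] with b hb
    refine pow_three_add_le_of_le_add
      (ne_top_of_le_ne_top ENNReal.one_ne_top (lintegral_discKernelE_mul_le_one hH1 hb)) hMt ?_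
    calc U b ≤ ∫⁻ a, (discKernelE a b * M + discKernelE a b * G a) ∂unifInterval :=
          lintegral_mono fun a => by rw [← mul_add]; gcongr; exact hHG a
      _ = _ := by
          rw [lintegral_add_left (by fun_prop), lintegral_mul_const _ (by fun_prop),
            lintegral_discKernelE hb, one_mul]
  rw [lintegral_add_left (hUm.pow_const 3), lintegral_const_mul _ hUm, hUM,
    lintegral_add_right _ (hVm.pow_const 3), lintegral_add_right _ measurable_const,
    lintegral_const_mul _ (hUm.pow_const 2)] at hle
  simp only [lintegral_const, measure_univ, mul_one] at hle
  refine hle.trans ?_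
  gcongr
  exact lintegral_lintegral_discKernelE_pow_three_le hGm

theorem lintegral_discKernelE_rpow_le {H : ℝ → ENNReal} (hH : Measurable H)
    (hH1 : ∀ a, H a ≤ 1) :
    ∫⁻ b, (∫⁻ a, discKernelE a b * H a ∂unifInterval) ^ ((8001 : ℝ) / 4000) ∂unifInterval ≤
      (∫⁻ a, H a ^ 2 ∂unifInterval) ^ ((8001 : ℝ) / 8000) := by
  have hvar := lintegral_abs_sub_mean_sq_add hH hH1
  have h3 := lintegral_discKernelE_pow_three_add_le hH hH1
  have h2 := lintegral_discKernelE_sq_add_le hH hH1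
  have hD := lintegral_lintegral_sub_sq_add unifInterval hH hH1
  have hUm := measurable_lintegral_discKernelE_mul hH
  have hU1 : ∀ᵐ b ∂unifInterval, ∫⁻ a, discKernelE a b * H a ∂unifInterval ≤ 1 := by
    filter_upwards [ae_unifInterval_abs_lt_one] with b hb using
      lintegral_discKernelE_mul_le_one hH1 hb
  have hI : ∀ k : ℕ, ∫⁻ b, (∫⁻ a, discKernelE a b * H a ∂unifInterval) ^ k ∂unifInterval ≤ 1 := by
    intro k
    calc _ ≤ ∫⁻ _, 1 ∂unifInterval := by
          refine lintegral_mono_ae ?_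
          filter_upwards [hU1] with b hb using pow_le_one' hb k
      _ = 1 := by simp
  have hM1 : ∫⁻ a, H a ∂unifInterval ≤ 1 := by
    calc _ ≤ ∫⁻ _, 1 ∂unifInterval := lintegral_mono hH1
      _ = 1 := by simp
  have hW1 : ∫⁻ a, H a ^ 2 ∂unifInterval ≤ 1 := by
    calc _ ≤ ∫⁻ _, 1 ∂unifInterval := lintegral_mono fun a => pow_le_one' (hH1 a) 2
      _ = 1 := by simp
  have hhold : ∫⁻ b, (∫⁻ a, discKernelE a b * H a ∂unifInterval) ^ ((8001 : ℝ) / 4000)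
      ∂unifInterval ≤
      (∫⁻ b, (∫⁻ a, discKernelE a b * H a ∂unifInterval) ^ 2 ∂unifInterval) ^ ((3999 : ℝ) / 4000) *
      (∫⁻ b, (∫⁻ a, discKernelE a b * H a ∂unifInterval) ^ 3 ∂unifInterval) ^ ((1 : ℝ) / 4000) := by
    refine le_trans (le_of_eq ?_) (ENNReal.lintegral_mul_norm_pow_le (hUm.pow_const 2).aemeasurable
      (hUm.pow_const 3).aemeasurable (by norm_num) (by norm_num) (by norm_num))
    refine lintegral_congr fun b => ?_
    rw [← ENNReal.rpow_natCast, ← ENNReal.rpow_mul, ← ENNReal.rpow_natCast, ← ENNReal.rpow_mul,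
      ← ENNReal.rpow_add_of_nonneg _ _ (by norm_num) (by norm_num)]
    norm_num
  refine hhold.trans ?_
  have t2 := hI 2
  have t3 := hI 3
  generalize ∫⁻ b, (∫⁻ a, discKernelE a b * H a ∂unifInterval) ^ 2 ∂unifInterval = i2 at *
  generalize ∫⁻ b, (∫⁻ a, discKernelE a b * H a ∂unifInterval) ^ 3 ∂unifInterval = i3 at *
  generalize ∫⁻ a, ENNReal.ofReal |(H a).toReal - (∫⁻ a, H a ∂unifInterval).toReal| ^ 2
    ∂unifInterval = v at *
  generalize ∫⁻ a, ∫⁻ c, ENNReal.ofReal (((H a).toReal - (H c).toReal) ^ 2)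
        ∂unifInterval ∂unifInterval = D at *
  generalize ∫⁻ a, H a ∂unifInterval = M at *
  generalize ∫⁻ a, H a ^ 2 ∂unifInterval = W at *
  have hWt : W ≠ ⊤ := ne_top_of_le_ne_top ENNReal.one_ne_top hW1
  have hMt : M ≠ ⊤ := ne_top_of_le_ne_top ENNReal.one_ne_top hM1
  have hi2 : i2 ≠ ⊤ := ne_top_of_le_ne_top ENNReal.one_ne_top t2
  have hi3 : i3 ≠ ⊤ := ne_top_of_le_ne_top ENNReal.one_ne_top t3
  have hvt : v ≠ ⊤ := ne_top_of_le_ne_top hWt (hvar ▸ le_self_add)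
  have hDt : D ≠ ⊤ := ne_top_of_le_ne_top (ENNReal.mul_ne_top ENNReal.ofNat_ne_top hWt)
    (hD ▸ le_self_add)
  have hpi : (0 : ℝ) ≤ 2 / Real.pi := by positivity
  lift W to NNReal using hWt
  lift M to NNReal using hMt
  lift i2 to NNReal using hi2
  lift i3 to NNReal using hi3
  lift v to NNReal using hvt
  lift D to NNReal using hDt
  rw [ENNReal.ofReal, ← Real.toNNReal_coe (r := W)] at h2
  rw [← ENNReal.coe_rpow_of_nonneg _ (by norm_num)] at h3
  rw [← ENNReal.coe_rpow_of_nonneg _ (by norm_num), ← ENNReal.coe_rpow_of_nonneg _ (by norm_num),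
    ← ENNReal.coe_rpow_of_nonneg _ (by norm_num)]
  simp only [Real.toNNReal_coe] at h2
  norm_cast at hvar h2 h3 hD ⊢
  rw [← NNReal.coe_le_coe] at h2 h3 ⊢
  rw [← NNReal.coe_inj] at hvar hD
  push_cast at hvar h2 h3 hD ⊢
  rw [Real.coe_toNNReal _ hpi] at h2
  have hv : (v : ℝ) = W - M ^ 2 := by linarith
  rw [hv] at h3
  refine rpow_mul_rpow_le_of_gap (NNReal.coe_nonneg M) (by linarith [NNReal.coe_nonneg v])
    (NNReal.coe_nonneg i2) (NNReal.coe_nonneg i3) ?_ h3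
  have hDe : (D : ℝ) = 2 * (W - M ^ 2) := by linarith
  rw [hDe] at h2
  linarith

/-- Two-function hypercontractive estimate for the kernel `discKernelE`. -/
theorem lintegral_lintegral_discKernelE_mul_le {H K : ℝ → ENNReal} (hH : Measurable H)
    (hH1 : ∀ a, H a ≤ 1) (hK : Measurable K) :
    ∫⁻ b, ∫⁻ a, discKernelE a b * (H a * K b) ∂unifInterval ∂unifInterval ≤
      (∫⁻ a, H a ^ 2 ∂unifInterval) ^ ((1 : ℝ) / 2) *
      (∫⁻ b, K b ^ ((8001 : ℝ) / 4001) ∂unifInterval) ^ ((4001 : ℝ) / 8001) := by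
  have hUm := measurable_lintegral_discKernelE_mul hH
  calc _ = ∫⁻ b, ((fun b => ∫⁻ a, discKernelE a b * H a ∂unifInterval) * K) b ∂unifInterval := by
        refine lintegral_congr fun b => ?_
        simp only [← mul_assoc]
        rw [lintegral_mul_const _ (by fun_prop)]
        rfl
    _ ≤ _ := ENNReal.lintegral_mul_le_Lp_mul_Lq unifInterval
        (p := 8001 / 4000) (q := 8001 / 4001) (by
          rw [Real.holderConjugate_iff]; norm_num) hUm.aemeasurable hK.aemeasurable
    _ ≤ _ := by
        rw [show (1 : ℝ) / (8001 / 4001) = 4001 / 8001 by norm_num]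
        gcongr
        refine (ENNReal.rpow_le_rpow (lintegral_discKernelE_rpow_le hH hH1) (by norm_num)).trans ?_
        rw [← ENNReal.rpow_mul]
        norm_num

/-- The projection to `ℂ` of the uniform law on the unit sphere of `ℝ³`. -/
noncomputable def discMeasure : Measure ℂ :=
  volume.withDensity fun z => 4⁻¹ * discKernelE z.re z.im

theorem lintegral_unifInterval_lintegral_unifInterval_of_support {f : ℝ → ℝ → ENNReal}
    (hf : ∀ a b, 1 ≤ a ^ 2 + b ^ 2 → f a b = 0) :
    ∫⁻ b, ∫⁻ a, f a b ∂unifInterval ∂unifInterval = 4⁻¹ * ∫⁻ b, ∫⁻ a, f a b := by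
  have hin : ∀ b, ∫⁻ a, f a b ∂unifInterval = 2⁻¹ * ∫⁻ a, f a b := by
    intro b
    rw [lintegral_unifInterval, ← lintegral_indicator measurableSet_Icc]
    congr 1
    refine lintegral_congr fun a => ?_
    rw [Set.indicator_apply]
    split_ifs with h
    · rfl
    · refine (hf a b ?_).symm
      rw [Set.mem_Icc, ← abs_le, not_le] at h
      have := (one_lt_sq_iff_one_lt_abs a).mpr h
      nlinarith [sq_nonneg b]
  simp only [hin]
  rw [lintegral_const_mul' _ _ (by simp), lintegral_unifInterval,
    ← lintegral_indicator measurableSet_Icc,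
    ← mul_assoc]
  congr 1
  · rw [← ENNReal.mul_inv (by simp) (by simp)]
    norm_num
  · refine lintegral_congr fun b => ?_
    rw [Set.indicator_apply]
    split_ifs with h
    · rfl
    · rw [Set.mem_Icc, ← abs_le, not_le] at h
      have := (one_lt_sq_iff_one_lt_abs b).mpr h
      simp [fun a => hf a b (by nlinarith [sq_nonneg a])]

theorem lintegral_discMeasure {F : ℝ → ℝ → ENNReal} (hF : Measurable (Function.uncurry F)) :
    ∫⁻ z, F z.re z.im ∂discMeasure =
      ∫⁻ b, ∫⁻ a, discKernelE a b * F a b ∂unifInterval ∂unifInterval := by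
  rw [lintegral_unifInterval_lintegral_unifInterval_of_support]
  · have hm : Measurable fun z : ℂ => F z.re z.im :=
      hF.comp (Complex.measurable_re.prodMk Complex.measurable_im)
    have hd : Measurable fun z : ℂ => discKernelE z.re z.im := by fun_prop
    rw [discMeasure, lintegral_withDensity_eq_lintegral_mul _ (hd.const_mul _) hm]
    have h := Complex.volume_preserving_equiv_real_prod.lintegral_comp_emb
      Complex.measurableEquivRealProd.measurableEmbedding
      (fun w : ℝ × ℝ => discKernelE w.1 w.2 * F w.1 w.2)
    have hw : Measurable fun w : ℝ × ℝ => discKernelE w.1 w.2 * F w.1 w.2 :=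
      (by fun_prop : Measurable fun w : ℝ × ℝ => discKernelE w.1 w.2).mul hF
    rw [Measure.volume_eq_prod, lintegral_prod_symm _ hw.aemeasurable] at h
    rw [← h]
    refine Eq.trans ?_ (lintegral_const_mul 4⁻¹ (hd.mul hm))
    refine lintegral_congr fun z => ?_
    simp [mul_assoc]
  · intro a b h
    simp [discKernelE, discKernel_eq_zero h]

theorem measurePreserving_re_discMeasure :
    MeasurePreserving Complex.re discMeasure unifInterval := by
  refine ⟨Complex.measurable_re, Measure.ext fun s hs => ?_⟩
  rw [Measure.map_apply Complex.measurable_re hs, ← lintegral_indicator_one hs,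
    ← lintegral_indicator_one (Complex.measurable_re hs)]
  have hi : Measurable (s.indicator (1 : ℝ → ENNReal)) := measurable_one.indicator hs
  have h := lintegral_discMeasure (F := fun a _ => s.indicator 1 a) (hi.comp measurable_fst)
  rw [lintegral_discKernelE_swap hi] at h
  exact h

instance : IsProbabilityMeasure discMeasure := ⟨by
  have := measurePreserving_re_discMeasure.measure_preimage MeasurableSet.univ.nullMeasurableSet
  simpa using this⟩

theorem measurePreserving_rotation_discMeasure (t : ℝ) :
    MeasurePreserving (fun z : ℂ => Complex.exp (t * Complex.I) * z) discMeasure discMeasure := by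
  have hrot : MeasurePreserving (rotation (Circle.exp t)) (volume : Measure ℂ) volume :=
    (rotation (Circle.exp t)).measurePreserving
  have e : (fun z : ℂ => Complex.exp (t * Complex.I) * z) = rotation (Circle.exp t) := by
    ext z
    simp [rotation_apply, Circle.coe_exp]
  rw [e]
  have hm : Measurable (rotation (Circle.exp t)) := hrot.measurable
  have hinv : ∀ z : ℂ, discKernelE (rotation (Circle.exp t) z).re (rotation (Circle.exp t) z).im
      = discKernelE z.re z.im := by
    have hk : ∀ z : ℂ, discKernelE z.re z.im
        = ENNReal.ofReal (2 / Real.pi * (√(1 - ‖z‖ ^ 2))⁻¹) := by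
      intro z
      rw [discKernelE, discKernel, ← Complex.normSq_eq_norm_sq, Complex.normSq_apply]
      ring_nf
    intro z
    rw [hk, hk, LinearIsometryEquiv.norm_map]
  refine ⟨hm, Measure.ext fun s hs => ?_⟩
  rw [Measure.map_apply hm hs, discMeasure, withDensity_apply _ (hm hs), withDensity_apply _ hs]
  conv_rhs => rw [← hrot.setLIntegral_comp_preimage_emb
      (rotation (Circle.exp t)).toHomeomorph.measurableEmbedding]
  simp only [hinv]

theorem lintegral_pi_fin_succ {X : Type*} [MeasurableSpace X] (μ : Measure X) [SigmaFinite μ]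
    {n : ℕ} {f : (Fin (n + 1) → X) → ENNReal} (hf : Measurable f) :
    ∫⁻ x, f x ∂Measure.pi (fun _ => μ) =
      ∫⁻ a, ∫⁻ w, f (Fin.cons a w : Fin (n + 1) → X) ∂Measure.pi (fun _ => μ) ∂μ := by
  have h := (measurePreserving_piFinSuccAbove (fun _ : Fin (n + 1) => μ) 0).symm
  rw [← h.lintegral_comp hf, lintegral_prod]
  · refine lintegral_congr fun a => lintegral_congr fun w => ?_
    congr 1
    simp [MeasurableEquiv.piFinSuccAbove]
    rfl
  · exact (hf.comp h.measurable).aemeasurable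

theorem measurable_fin_cons {X : Type*} [MeasurableSpace X] {n : ℕ} :
    Measurable fun w : X × (Fin n → X) => (Fin.cons w.1 w.2 : Fin (n + 1) → X) := by
  refine measurable_pi_iff.mpr fun i => ?_
  refine Fin.cases ?_ (fun j => ?_) i
  · simp only [Fin.cons_zero]
    fun_prop
  · simp only [Fin.cons_succ]
    fun_prop

theorem lintegral_pi_discMeasure_mul_le {n : ℕ} {H K : (Fin n → ℝ) → ENNReal} (hH : Measurable H)
    (hH1 : ∀ a, H a ≤ 1) (hK : Measurable K) :
    ∫⁻ z, H (fun i => (z i).re) * K (fun i => (z i).im) ∂Measure.pi (fun _ : Fin n => discMeasure) ≤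
      (∫⁻ a, H a ^ 2 ∂Measure.pi (fun _ => unifInterval)) ^ ((1 : ℝ) / 2) *
      (∫⁻ b, K b ^ ((8001 : ℝ) / 4001) ∂Measure.pi (fun _ => unifInterval)) ^
        ((4001 : ℝ) / 8001) := by
  induction n with
  | zero =>
    rw [Measure.pi_of_empty, Measure.pi_of_empty (fun _ : Fin 0 => unifInterval),
      lintegral_dirac, lintegral_dirac, lintegral_dirac, ← ENNReal.rpow_natCast,
      ← ENNReal.rpow_mul, ← ENNReal.rpow_mul]
    norm_num
    rw [Subsingleton.elim (fun i : Fin 0 => _) (fun a => isEmptyElim a : Fin 0 → ℝ)]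
    rw [Subsingleton.elim (fun i : Fin 0 => Complex.im _) (fun a => isEmptyElim a : Fin 0 → ℝ)]
  | succ n ih =>
    have hre : Measurable fun z : Fin (n + 1) → ℂ => fun i => (z i).re := by fun_prop
    have him : Measurable fun z : Fin (n + 1) → ℂ => fun i => (z i).im := by fun_prop
    have hHK : Measurable fun z : Fin (n + 1) → ℂ =>
        H (fun i => (z i).re) * K (fun i => (z i).im) :=
      (hH.comp hre).mul (hK.comp him)
    rw [lintegral_pi_fin_succ _ hHK,
      lintegral_pi_fin_succ _ (hH.pow_const 2), lintegral_pi_fin_succ _ (hK.pow_const _)]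
    set h : ℝ → ENNReal := fun a => (∫⁻ w, H (Fin.cons a w : Fin (n + 1) → ℝ) ^ 2
      ∂Measure.pi (fun _ => unifInterval)) ^ ((1 : ℝ) / 2) with hh
    set k : ℝ → ENNReal := fun a => (∫⁻ w, K (Fin.cons a w : Fin (n + 1) → ℝ) ^ ((8001 : ℝ) / 4001)
      ∂Measure.pi (fun _ => unifInterval)) ^ ((4001 : ℝ) / 8001) with hk
    have hcons : ∀ a : ℝ, Measurable fun w : Fin n → ℝ => (Fin.cons a w : Fin (n + 1) → ℝ) :=
      fun a => measurable_fin_cons.comp measurable_prodMk_left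
    have hhm : Measurable h :=
      ((hH.comp measurable_fin_cons).pow_const 2).lintegral_prod_right'.pow_const _
    have hkm : Measurable k :=
      ((hK.comp measurable_fin_cons).pow_const _).lintegral_prod_right'.pow_const _
    have hh1 : ∀ a, h a ≤ 1 := by
      intro a
      refine ENNReal.rpow_le_one ?_ (by norm_num)
      calc _ ≤ ∫⁻ _, 1 ∂Measure.pi (fun _ : Fin n => unifInterval) :=
            lintegral_mono fun w => pow_le_one' (hH1 _) 2
        _ = 1 := by simp
    have hsplit : ∀ z : ℂ, ∫⁻ w, H (fun i => ((Fin.cons z w : Fin (n + 1) → ℂ) i).re) *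
        K (fun i => ((Fin.cons z w : Fin (n + 1) → ℂ) i).im)
        ∂Measure.pi (fun _ : Fin n => discMeasure) ≤ h z.re * k z.im := by
      intro z
      have e1 : ∀ w : Fin n → ℂ, (fun i => ((Fin.cons z w : Fin (n + 1) → ℂ) i).re)
          = (Fin.cons z.re fun i => (w i).re : Fin (n + 1) → ℝ) := by
        intro w; ext i; refine Fin.cases ?_ (fun j => ?_) i <;> simp
      have e2 : ∀ w : Fin n → ℂ, (fun i => ((Fin.cons z w : Fin (n + 1) → ℂ) i).im)
          = (Fin.cons z.im fun i => (w i).im : Fin (n + 1) → ℝ) := by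
        intro w; ext i; refine Fin.cases ?_ (fun j => ?_) i <;> simp
      simp only [e1, e2]
      exact ih (H := fun w => H (Fin.cons z.re w)) (K := fun w => K (Fin.cons z.im w))
        (hH.comp (hcons _)) (fun _ => hH1 _) (hK.comp (hcons _))
    refine (lintegral_mono hsplit).trans ?_
    rw [lintegral_discMeasure (F := fun a b => h a * k b)
      ((hhm.comp measurable_fst).mul (hkm.comp measurable_snd))]
    refine (lintegral_lintegral_discKernelE_mul_le hhm hh1 hkm).trans (le_of_eq ?_)
    congr 2
    · refine lintegral_congr fun a => ?_
      rw [hh, ← ENNReal.rpow_natCast, ← ENNReal.rpow_mul]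
      norm_num
    · refine lintegral_congr fun a => ?_
      rw [hk, ← ENNReal.rpow_mul]
      norm_num

theorem pi_discMeasure_re_im_le {n : ℕ} {E : Set (Fin n → ℝ)} (hE : MeasurableSet E) :
    Measure.pi (fun _ : Fin n => discMeasure)
      {z | (fun i => (z i).re) ∈ E ∧ (fun i => (z i).im) ∈ E} ≤
      Measure.pi (fun _ : Fin n => unifInterval) E ^ (1 + (1 : ℝ) / 16002) := by
  have hi : Measurable (E.indicator (1 : (Fin n → ℝ) → ENNReal)) := measurable_one.indicator hE
  have hre : Measurable fun z : Fin n → ℂ => fun i => (z i).re := by fun_prop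
  have him : Measurable fun z : Fin n → ℂ => fun i => (z i).im := by fun_prop
  have h := lintegral_pi_discMeasure_mul_le hi (fun a => Set.indicator_le_self' (by simp) a) hi
  have h2 : ∀ r : ℝ, 0 < r → ∀ a, (E.indicator (1 : (Fin n → ℝ) → ENNReal) a) ^ r
      = E.indicator 1 a := by
    intro r hr a
    by_cases ha : a ∈ E <;> simp [ha, hr]
  simp only [← ENNReal.rpow_natCast] at h
  simp only [h2 _ (show (0 : ℝ) < (2 : ℕ) by norm_num),
    h2 _ (show (0 : ℝ) < 8001 / 4001 by norm_num)] at h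
  rw [lintegral_indicator_one hE, ← ENNReal.rpow_add_of_nonneg _ _ (by norm_num) (by norm_num)] at h
  rw [show (1 : ℝ) / 2 + 4001 / 8001 = 1 + 1 / 16002 by norm_num] at h
  refine le_trans (le_of_eq ?_) h
  have hm : MeasurableSet {z : Fin n → ℂ | (fun i => (z i).re) ∈ E ∧ (fun i => (z i).im) ∈ E} :=
    (hre hE).inter (him hE)
  rw [← lintegral_indicator_one hm]
  refine lintegral_congr fun z => ?_
  by_cases h1 : (fun i => (z i).re) ∈ E <;> by_cases h2 : (fun i => (z i).im) ∈ E <;>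
    simp [h1, h2]

/-- The uniform law on the cube `[-1, 1]ⁿ`. -/
noncomputable abbrev cubeMeasure (n : ℕ) : Measure (Fin n → ℝ) :=
  Measure.pi fun _ => unifInterval

/-- The law on `ℂⁿ` whose coordinates are independent with law `discMeasure`. -/
noncomputable abbrev polydiscMeasure (n : ℕ) : Measure (Fin n → ℂ) :=
  Measure.pi fun _ => discMeasure

/-- Simultaneous rotation of all coordinates by the angle `t`. -/
noncomputable def rotPi {n : ℕ} (t : ℝ) (z : Fin n → ℂ) : Fin n → ℂ :=
  fun i => Complex.exp (t * Complex.I) * z i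

theorem rotRe_rotPi {n : ℕ} (s t : ℝ) (z : Fin n → ℂ) : rotRe (rotPi s z) t = rotRe z (t + s) := by
  ext i
  simp only [rotRe, rotPi, ← mul_assoc, ← Complex.exp_add]
  push_cast
  ring_nf

theorem measurePreserving_rotPi {n : ℕ} (t : ℝ) :
    MeasurePreserving (rotPi t) (polydiscMeasure n) (polydiscMeasure n) :=
  measurePreserving_pi _ _ fun _ => measurePreserving_rotation_discMeasure t

theorem measurePreserving_rotRe {n : ℕ} (t : ℝ) :
    MeasurePreserving (fun z => rotRe z t) (polydiscMeasure n) (cubeMeasure n) :=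
  measurePreserving_pi _ _ fun _ =>
    measurePreserving_re_discMeasure.comp (measurePreserving_rotation_discMeasure t)

theorem rotRe_zero {n : ℕ} (z : Fin n → ℂ) : rotRe z 0 = fun i => (z i).re := by
  ext i
  simp [rotRe]

theorem rotRe_neg_pi_div_two {n : ℕ} (z : Fin n → ℂ) :
    rotRe z (-(Real.pi / 2)) = fun i => (z i).im := by
  ext i
  have : ((-(Real.pi / 2) : ℝ) : ℂ) * Complex.I = -(Real.pi / 2 * Complex.I) := by push_cast; ring
  rw [rotRe, this, Complex.exp_neg, Complex.exp_pi_div_two_mul_I]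
  simp

theorem continuous_polyEval {n : ℕ} (S : Finset (Fin n →₀ ℕ)) (c : (Fin n →₀ ℕ) → ℝ) :
    Continuous (polyEval S c) := by
  unfold polyEval
  fun_prop

/-- The set of points on whose whole rotation orbit `polyEval S c` is at most `s`. -/
def orbitSublevel {n : ℕ} (S : Finset (Fin n →₀ ℕ)) (c : (Fin n →₀ ℕ) → ℝ) (s : ℝ) :
    Set (Fin n → ℂ) :=
  {z | ∀ t, |polyEval S c (rotRe z t)| ≤ s}

theorem measurableSet_orbitSublevel {n : ℕ} (S : Finset (Fin n →₀ ℕ)) (c : (Fin n →₀ ℕ) → ℝ)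
    (s : ℝ) : MeasurableSet (orbitSublevel S c s) := by
  have : orbitSublevel S c s = ⋂ t, {z | |polyEval S c (rotRe z t)| ≤ s} := by
    ext z
    simp [orbitSublevel]
  rw [this]
  refine (isClosed_iInter fun t => isClosed_le ?_ continuous_const).measurableSet
  have := continuous_polyEval S c
  unfold rotRe
  fun_prop

theorem rotPi_mem_orbitSublevel {n : ℕ} {S : Finset (Fin n →₀ ℕ)} {c : (Fin n →₀ ℕ) → ℝ}
    {s : ℝ} (t : ℝ) {z : Fin n → ℂ} :
    rotPi t z ∈ orbitSublevel S c s ↔ z ∈ orbitSublevel S c s := by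
  simp only [orbitSublevel, Set.mem_ofPred_eq, rotRe_rotPi]
  exact ⟨fun h u => by simpa using h (u - t), fun h u => h _⟩

theorem measurableSet_abs_polyEval_le {n : ℕ} (S : Finset (Fin n →₀ ℕ)) (c : (Fin n →₀ ℕ) → ℝ)
    (s : ℝ) : MeasurableSet {x | |polyEval S c x| ≤ s} :=
  (isClosed_le (continuous_polyEval S c).abs continuous_const).measurableSet

theorem measurableSet_abs_polyEval_rotRe_le {n : ℕ} (S : Finset (Fin n →₀ ℕ))
    (c : (Fin n →₀ ℕ) → ℝ) (s t : ℝ) : MeasurableSet {z | |polyEval S c (rotRe z t)| ≤ s} :=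
  (measurePreserving_rotRe t).measurable (measurableSet_abs_polyEval_le S c s)

/-- Averaging over a grid of rotations: off the sublevel set of the orbit supremum, the polynomial
is rarely small at a given angle. -/
theorem card_mul_polydiscMeasure_diff_le {n d N : ℕ} (hN : 0 < N) {S : Finset (Fin n →₀ ℕ)}
    {c : (Fin n →₀ ℕ) → ℝ} (hS : ∀ m ∈ S, ∑ i, m i = d) {ε : ℝ} (hε : 0 ≤ ε)
    {T : Set (Fin n → ℂ)} (hT : MeasurableSet T) (hrot : ∀ t z, rotPi t z ∈ T ↔ z ∈ T) :
    (polydiscMeasure n).real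
      (({z | |polyEval S c (rotRe z 0)| ≤ ε} ∩ T) \ orbitSublevel S c ((d + 1) * N ^ d * ε)) ≤
      d / N * (polydiscMeasure n).real T := by
  set B := orbitSublevel S c ((d + 1) * N ^ d * ε) with hB
  set D := ({z | |polyEval S c (rotRe z 0)| ≤ ε} ∩ T) \ B with hD
  have hDm : MeasurableSet D := ((measurableSet_abs_polyEval_rotRe_le S c ε 0).inter hT).diff
    (measurableSet_orbitSublevel _ _ _)
  have hN' : (0 : ℝ) < N := by exact_mod_cast hN
  have hkey : N * polydiscMeasure n D ≤ d * polydiscMeasure n T := by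
    have h1 : ∀ l : ℕ, polydiscMeasure n D
        = ∫⁻ z, (rotPi (Real.pi * l / N) ⁻¹' D).indicator 1 z ∂polydiscMeasure n := by
      intro l
      rw [lintegral_indicator_one ((measurePreserving_rotPi _).measurable hDm),
        (measurePreserving_rotPi _).measure_preimage hDm.nullMeasurableSet]
    calc (N : ENNReal) * polydiscMeasure n D
        = ∑ l ∈ Finset.range N, polydiscMeasure n D := by simp
      _ = ∫⁻ z, ∑ l ∈ Finset.range N, (rotPi (Real.pi * l / N) ⁻¹' D).indicator 1 z
            ∂polydiscMeasure n := by
          rw [lintegral_finsetSum]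
          · exact Finset.sum_congr rfl fun l _ => h1 l
          · exact fun l _ => measurable_one.indicator ((measurePreserving_rotPi _).measurable hDm)
      _ ≤ ∫⁻ z, d * T.indicator 1 z ∂polydiscMeasure n := by
          refine lintegral_mono fun z => ?_
          by_cases hex : ∃ l ∈ Finset.range N, rotPi (Real.pi * l / N) z ∈ D
          · obtain ⟨l₀, -, hl₀⟩ := hex
            have hzT : z ∈ T := (hrot _ _).mp hl₀.1.2
            have hzB : z ∉ B := fun h => hl₀.2 ((rotPi_mem_orbitSublevel _).mpr h)
            have hcard : ((Finset.range N).filter fun l : ℕ =>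
                |polyEval S c (rotRe z (0 + Real.pi * l / N))| ≤ ε).card ≤ d := by
              by_contra! hlt
              exact hzB (polyEval_rotRe_le_of_card hS z 0 hε hlt).1
            have hle : ∑ l ∈ Finset.range N, (rotPi (Real.pi * l / N) ⁻¹' D).indicator
                (1 : (Fin n → ℂ) → ENNReal) z ≤
                ∑ l ∈ Finset.range N,
                  if |polyEval S c (rotRe z (0 + Real.pi * l / N))| ≤ ε then 1 else 0 := by
              refine Finset.sum_le_sum fun l _ => ?_
              by_cases hl : z ∈ rotPi (Real.pi * l / N) ⁻¹' D
              · have := hl.1.1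
                rw [Set.mem_ofPred_eq, rotRe_rotPi] at this
                rw [Set.indicator_of_mem hl, if_pos this]
                rfl
              · simp [Set.indicator_of_notMem hl]
            refine hle.trans ?_
            rw [Finset.sum_boole]
            simp only [Set.indicator_of_mem hzT, Pi.one_apply, mul_one]
            exact_mod_cast hcard
          · push Not at hex
            have h0 : ∑ l ∈ Finset.range N, (rotPi (Real.pi * l / N) ⁻¹' D).indicator
                (1 : (Fin n → ℂ) → ENNReal) z = 0 :=
              Finset.sum_eq_zero fun l hl =>
                Set.indicator_of_notMem (show z ∉ rotPi (Real.pi * l / N) ⁻¹' D from hex l hl) _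
            exact h0.trans_le zero_le
      _ = d * polydiscMeasure n T := by
          rw [lintegral_const_mul _ (measurable_one.indicator hT), lintegral_indicator_one hT]
  have hreal := ENNReal.toReal_mono (by finiteness) hkey
  rw [ENNReal.toReal_mul, ENNReal.toReal_mul, ENNReal.toReal_natCast, ENNReal.toReal_natCast]
    at hreal
  rw [div_mul_eq_mul_div, le_div_iff₀ hN', mul_comm]
  exact hreal

theorem polydiscMeasure_real_zero_and_neg_pi_div_two_le {n : ℕ} {E : Set (Fin n → ℝ)}
    (hE : MeasurableSet E) :
    (polydiscMeasure n).real {z | rotRe z 0 ∈ E ∧ rotRe z (-(Real.pi / 2)) ∈ E} ≤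
      (cubeMeasure n).real E ^ (1 + (1 : ℝ) / 16002) := by
  simp only [rotRe_zero, rotRe_neg_pi_div_two]
  rw [Measure.real, Measure.real, ENNReal.toReal_rpow]
  exact ENNReal.toReal_mono (ENNReal.rpow_ne_top_of_nonneg (by norm_num) (by finiteness))
    (pi_discMeasure_re_im_le hE)

theorem polydiscMeasure_real_orbitSublevel_le {n : ℕ} (S : Finset (Fin n →₀ ℕ))
    (c : (Fin n →₀ ℕ) → ℝ) (s : ℝ) :
    (polydiscMeasure n).real (orbitSublevel S c s) ≤
      (cubeMeasure n).real {x | |polyEval S c x| ≤ s} ^ (1 + (1 : ℝ) / 16002) := by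
  refine le_trans (measureReal_mono ?_)
    (polydiscMeasure_real_zero_and_neg_pi_div_two_le (measurableSet_abs_polyEval_le S c s))
  exact fun z hz => ⟨hz _, hz _⟩

theorem polydiscMeasure_real_preimage_rotRe {n : ℕ} (t : ℝ) {E : Set (Fin n → ℝ)}
    (hE : MeasurableSet E) :
    (polydiscMeasure n).real {z | rotRe z t ∈ E} = (cubeMeasure n).real E :=
  congrArg ENNReal.toReal ((measurePreserving_rotRe t).measure_preimage hE.nullMeasurableSet)

theorem cubeMeasure_real_le_rpow_add {n d N : ℕ} (hN : 0 < N) {S : Finset (Fin n →₀ ℕ)}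
    {c : (Fin n →₀ ℕ) → ℝ} (hS : ∀ m ∈ S, ∑ i, m i = d) {ε : ℝ} (hε : 0 ≤ ε) :
    (cubeMeasure n).real {x | |polyEval S c x| ≤ ε} ≤
      (cubeMeasure n).real {x | |polyEval S c x| ≤ (d + 1) * N ^ d * ε} ^ (1 + (1 : ℝ) / 16002)
        + d / N := by
  rw [← polydiscMeasure_real_preimage_rotRe 0 (measurableSet_abs_polyEval_le S c ε)]
  have h1 := card_mul_polydiscMeasure_diff_le (c := c) hN hS hε MeasurableSet.univ (by simp)
  have h2 := polydiscMeasure_real_orbitSublevel_le S c ((d + 1) * N ^ d * ε)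
  rw [Set.inter_univ, probReal_univ, mul_one] at h1
  refine le_trans ?_ (add_le_add h2 h1)
  refine le_trans (measureReal_mono ?_) (measureReal_union_le _ _)
  intro z hz
  by_cases h : z ∈ orbitSublevel S c ((d + 1) * N ^ d * ε)
  · exact Or.inl h
  · exact Or.inr ⟨hz, h⟩

theorem cubeMeasure_real_le_sum_rpow_add {n d : ℕ} {S : Finset (Fin n →₀ ℕ)}
    {c : (Fin n →₀ ℕ) → ℝ} (hS : ∀ m ∈ S, ∑ i, m i = d) {ε : ℝ} (hε : 0 ≤ ε) (J : ℕ) :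
    (cubeMeasure n).real {x | |polyEval S c x| ≤ ε} ≤
      (cubeMeasure n).real {x | |polyEval S c x| ≤ (d + 1) * ε} ^ (1 + (1 : ℝ) / 16002)
      + ∑ j ∈ Finset.range J, d / 2 ^ j * (cubeMeasure n).real
          {x | |polyEval S c x| ≤ (d + 1) * (2 ^ (j + 1)) ^ d * ε} ^ (1 + (1 : ℝ) / 16002)
      + d / 2 ^ J := by
  rw [← polydiscMeasure_real_preimage_rotRe 0 (measurableSet_abs_polyEval_le S c ε)]
  have hcast : ∀ j : ℕ, (((2 ^ j : ℕ) : ℝ)) = 2 ^ j := fun j => by push_cast; rfl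
  set A : Set (Fin n → ℂ) := {z | |polyEval S c (rotRe z 0)| ≤ ε} with hA
  set B : ℕ → Set (Fin n → ℂ) := fun j => orbitSublevel S c ((d + 1) * (2 ^ j) ^ d * ε) with hB
  have hstep : ∀ j (T : Set (Fin n → ℂ)), MeasurableSet T → (∀ t z, rotPi t z ∈ T ↔ z ∈ T) →
      (polydiscMeasure n).real ((A ∩ T) \ B j) ≤ d / 2 ^ j * (polydiscMeasure n).real T := by
    intro j T hT hr
    have := card_mul_polydiscMeasure_diff_le (c := c) (N := 2 ^ j) (by positivity) hS hε hT hr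
    rwa [hcast] at this
  have hmain : (polydiscMeasure n).real A ≤ (polydiscMeasure n).real (B 0)
      + ∑ j ∈ Finset.range J, d / 2 ^ j * (polydiscMeasure n).real (B (j + 1))
      + (polydiscMeasure n).real (A \ B J) := by
    induction J with
    | zero =>
      rw [Finset.sum_range_zero, add_zero]
      refine le_trans (measureReal_mono ?_) (measureReal_union_le _ _)
      intro z hz
      by_cases h : z ∈ B 0
      · exact Or.inl h
      · exact Or.inr ⟨hz, h⟩
    | succ J ih =>
      refine ih.trans ?_
      rw [Finset.sum_range_succ, ← add_assoc, add_assoc _ (_ * _)]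
      gcongr
      refine le_trans ?_ (add_le_add_left (hstep J (B (J + 1)) (measurableSet_orbitSublevel _ _ _)
        fun t z => rotPi_mem_orbitSublevel t) _)
      refine le_trans (measureReal_mono ?_) (measureReal_union_le _ _)
      rintro z ⟨hz, hz'⟩
      by_cases h : z ∈ B (J + 1)
      · exact Or.inl ⟨⟨hz, h⟩, hz'⟩
      · exact Or.inr ⟨hz, h⟩
  refine hmain.trans ?_
  gcongr with j _
  · refine (polydiscMeasure_real_orbitSublevel_le S c _).trans (le_of_eq ?_)
    simp
  · exact polydiscMeasure_real_orbitSublevel_le S c _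
  · have := hstep J Set.univ MeasurableSet.univ (by simp)
    rwa [Set.inter_univ, probReal_univ, mul_one] at this

theorem cubeMeasure_real_lt_abs_le_rpow {n d : ℕ} (hd : 0 < d) {S : Finset (Fin n →₀ ℕ)}
    {c : (Fin n →₀ ℕ) → ℝ} (hS : ∀ m ∈ S, ∑ i, m i = d) {s : ℝ} (hs : 0 ≤ s) :
    (cubeMeasure n).real {x | (d + 1) * (4 * d) ^ d * s < |polyEval S c x|} ≤
      2 * (cubeMeasure n).real {x | s < |polyEval S c x|} ^ (1 + (1 : ℝ) / 16002) := by
  have hE : ∀ s, MeasurableSet {x | s < |polyEval S c x|} := by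
    intro s
    have := (measurableSet_abs_polyEval_le S c s).compl
    convert this using 1
    ext x
    simp
  set B := orbitSublevel S c ((d + 1) * (4 * d) ^ d * s) with hB
  have hBm : MeasurableSet B := measurableSet_orbitSublevel _ _ _
  have hd' : (d : ℝ) ≠ 0 := by exact_mod_cast hd.ne'
  have h1 : (polydiscMeasure n).real ({z | |polyEval S c (rotRe z 0)| ≤ s} ∩ Bᶜ) ≤
      1 / 4 * (polydiscMeasure n).real Bᶜ := by
    have := card_mul_polydiscMeasure_diff_le (c := c) (N := 4 * d) (by positivity) hS hs hBm.compl
      (fun t z => not_congr (rotPi_mem_orbitSublevel t))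
    push_cast at this
    rw [show (d : ℝ) / (4 * d) = 1 / 4 by field_simp, Set.sdiff_eq, Set.inter_assoc,
      Set.inter_self] at this
    exact this
  have h2 : (polydiscMeasure n).real ({z | |polyEval S c (rotRe z (-(Real.pi / 2)))| ≤ s} ∩ Bᶜ)
      ≤ 1 / 4 * (polydiscMeasure n).real Bᶜ := by
    refine le_trans (le_of_eq ?_) h1
    have hm := (measurableSet_abs_polyEval_rotRe_le S c s 0).inter hBm.compl
    rw [Measure.real, Measure.real,
      ← (measurePreserving_rotPi (-(Real.pi / 2))).measure_preimage hm.nullMeasurableSet]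
    congr 2
    ext z
    simp only [Set.mem_inter_iff, Set.mem_ofPred_eq, Set.mem_compl_iff, Set.preimage_inter,
      Set.mem_preimage, rotRe_rotPi, zero_add, hB, rotPi_mem_orbitSublevel]
  have h3 := polydiscMeasure_real_zero_and_neg_pi_div_two_le (hE s)
  have h4 : (polydiscMeasure n).real Bᶜ ≤
      (polydiscMeasure n).real ({z | |polyEval S c (rotRe z 0)| ≤ s} ∩ Bᶜ) +
      (polydiscMeasure n).real ({z | |polyEval S c (rotRe z (-(Real.pi / 2)))| ≤ s} ∩ Bᶜ) +
      (polydiscMeasure n).real {z | rotRe z 0 ∈ {x | s < |polyEval S c x|} ∧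
        rotRe z (-(Real.pi / 2)) ∈ {x | s < |polyEval S c x|}} := by
    refine le_trans (measureReal_mono ?_) ((measureReal_union_le _ _).trans
      (add_le_add_left (measureReal_union_le _ _) _))
    intro z hz
    by_cases ha : |polyEval S c (rotRe z 0)| ≤ s
    · exact Or.inl (Or.inl ⟨ha, hz⟩)
    by_cases hb : |polyEval S c (rotRe z (-(Real.pi / 2)))| ≤ s
    · exact Or.inl (Or.inr ⟨hb, hz⟩)
    · exact Or.inr ⟨not_le.mp ha, not_le.mp hb⟩
  have h5 : (cubeMeasure n).real {x | (d + 1) * (4 * d) ^ d * s < |polyEval S c x|} ≤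
      (polydiscMeasure n).real Bᶜ := by
    rw [← polydiscMeasure_real_preimage_rotRe 0 (hE _)]
    refine measureReal_mono fun z hz hzB => ?_
    exact absurd (hzB 0) (not_le.mpr hz)
  linarith

theorem ae_discMeasure_norm_le_two : ∀ᵐ z ∂discMeasure, ‖z‖ ≤ 2 := by
  have h1 := measurePreserving_re_discMeasure.quasiMeasurePreserving.ae ae_unifInterval_abs_lt_one
  have h2 := (measurePreserving_rotation_discMeasure
    (-(Real.pi / 2))).quasiMeasurePreserving.ae h1
  have h3 : ((-(Real.pi / 2) : ℝ) : ℂ) * Complex.I = -(Real.pi / 2 * Complex.I) := by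
    push_cast; ring
  filter_upwards [h1, h2] with z hz1 hz2
  rw [h3, Complex.exp_neg, Complex.exp_pi_div_two_mul_I] at hz2
  simp at hz2
  exact (Complex.norm_le_abs_re_add_abs_im z).trans (by linarith)

theorem integrable_pow_mul_conj_pow (a b : ℕ) :
    Integrable (fun z : ℂ => z ^ a * (starRingEnd ℂ) z ^ b) discMeasure := by
  refine Integrable.of_bound (by fun_prop) (2 ^ a * 2 ^ b) ?_
  filter_upwards [ae_discMeasure_norm_le_two] with z hz
  rw [norm_mul, norm_pow, norm_pow, RCLike.norm_conj]
  gcongr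

theorem integral_pow_mul_conj_pow_of_ne {a b : ℕ} (hab : a ≠ b) :
    ∫ z : ℂ, z ^ a * (starRingEnd ℂ) z ^ b ∂discMeasure = 0 := by
  set J := ∫ z : ℂ, z ^ a * (starRingEnd ℂ) z ^ b ∂discMeasure with hJ
  have hrot : ∀ t : ℝ, J = Complex.exp (((a : ℂ) - b) * t * Complex.I) * J := by
    intro t
    rw [hJ, ← integral_const_mul]
    nth_rewrite 1 [← (measurePreserving_rotation_discMeasure t).map_eq]
    rw [integral_map (measurePreserving_rotation_discMeasure t).measurable.aemeasurable
      (by fun_prop)]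
    refine integral_congr_ae (Filter.Eventually.of_forall fun z => ?_)
    simp only [map_mul, mul_pow, ← Complex.exp_conj, ← Complex.exp_nat_mul, Complex.conj_ofReal,
      Complex.conj_I]
    rw [show ((a : ℂ) - b) * t * Complex.I
      = a * (t * Complex.I) + b * (t * -Complex.I) by ring, Complex.exp_add]
    ring
  have hab' : (a : ℝ) - b ≠ 0 := sub_ne_zero.mpr (by exact_mod_cast hab)
  have := hrot (Real.pi / ((a : ℝ) - b))
  have harg : ((a : ℂ) - b) * ((Real.pi / ((a : ℝ) - b) : ℝ) : ℂ) = Real.pi := by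
    rw [← Complex.ofReal_natCast, ← Complex.ofReal_natCast, ← Complex.ofReal_sub,
      ← Complex.ofReal_mul, mul_div_cancel₀ _ hab']
  rw [harg, Complex.exp_pi_mul_I] at this
  linear_combination this / 2

theorem integral_even_pow_unifInterval (a : ℕ) :
    ∫ x : ℝ, x ^ (2 * a) ∂unifInterval = 1 / (2 * a + 1) := by
  rw [unifInterval, integral_smul_measure, integral_Icc_eq_integral_Ioc,
    ← intervalIntegral.integral_of_le (by norm_num), integral_pow,
    Odd.neg_one_pow ⟨a, rfl⟩, ENNReal.toReal_inv, ENNReal.toReal_ofNat, smul_eq_mul]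
  push_cast
  ring

theorem inv_three_pow_le_integral_norm_pow (a : ℕ) :
    (3⁻¹ : ℝ) ^ a ≤ ∫ z : ℂ, (‖z‖ ^ 2) ^ a ∂discMeasure := by
  have hinteg : ∀ a : ℕ, Integrable (fun z : ℂ => (‖z‖ ^ 2) ^ a) discMeasure := by
    intro a
    refine Integrable.of_bound (by fun_prop) ((2 ^ 2) ^ a) ?_
    filter_upwards [ae_discMeasure_norm_le_two] with z hz
    rw [Real.norm_of_nonneg (by positivity)]
    gcongr
  calc (3⁻¹ : ℝ) ^ a ≤ 1 / (2 * a + 1) := by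
        rw [inv_pow, one_div]
        have := one_add_mul_le_pow (show (-2 : ℝ) ≤ 2 by norm_num) a
        norm_num at this
        gcongr
        linarith
    _ = ∫ x : ℝ, x ^ (2 * a) ∂unifInterval := (integral_even_pow_unifInterval a).symm
    _ = ∫ z : ℂ, z.re ^ (2 * a) ∂discMeasure := by
        rw [← measurePreserving_re_discMeasure.map_eq,
          integral_map measurePreserving_re_discMeasure.measurable.aemeasurable (by fun_prop)]
    _ ≤ ∫ z : ℂ, (‖z‖ ^ 2) ^ a ∂discMeasure := by
        have hle : ∀ z : ℂ, z.re ^ (2 * a) ≤ (‖z‖ ^ 2) ^ a := by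
          intro z
          rw [pow_mul]
          refine pow_le_pow_left₀ (sq_nonneg _) ?_ _
          rw [Complex.sq_norm, Complex.normSq_apply]
          nlinarith [mul_self_nonneg z.im]
        refine integral_mono_of_nonneg (Filter.Eventually.of_forall fun z => ?_) (hinteg a)
          (Filter.Eventually.of_forall hle)
        show 0 ≤ z.re ^ (2 * a)
        rw [pow_mul]
        positivity

theorem integral_norm_sq_polyEvalC {n : ℕ} (S : Finset (Fin n →₀ ℕ)) (c : (Fin n →₀ ℕ) → ℝ) :
    ∫ z, ‖polyEvalC S c z‖ ^ 2 ∂polydiscMeasure n =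
      ∑ m ∈ S, c m ^ 2 * ∏ i, ∫ z : ℂ, (‖z‖ ^ 2) ^ m i ∂discMeasure := by
  have hexp : ∀ z : Fin n → ℂ, ((‖polyEvalC S c z‖ ^ 2 : ℝ) : ℂ) =
      ∑ m ∈ S, ∑ m' ∈ S, (c m * c m' : ℂ) * ∏ i, (z i ^ m i * (starRingEnd ℂ) (z i) ^ m' i) := by
    intro z
    push_cast
    rw [← Complex.mul_conj', polyEvalC, map_sum, Finset.sum_mul_sum]
    refine Finset.sum_congr rfl fun m _ => Finset.sum_congr rfl fun m' _ => ?_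
    simp only [map_mul, map_prod, map_pow, Complex.conj_ofReal, Finset.prod_mul_distrib]
    ring
  have hinteg : ∀ m m' : Fin n →₀ ℕ, Integrable (fun z : Fin n → ℂ => (c m * c m' : ℂ) *
      ∏ i, (z i ^ m i * (starRingEnd ℂ) (z i) ^ m' i)) (polydiscMeasure n) := fun m m' =>
    (Integrable.fintype_prod (f := fun i (w : ℂ) => w ^ m i * (starRingEnd ℂ) w ^ m' i)
      fun i => integrable_pow_mul_conj_pow _ _).const_mul _
  have hval : ∀ m m' : Fin n →₀ ℕ, ∫ z : Fin n → ℂ, (c m * c m' : ℂ) *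
      ∏ i, (z i ^ m i * (starRingEnd ℂ) (z i) ^ m' i) ∂polydiscMeasure n =
      if m = m' then ((c m ^ 2 * ∏ i, ∫ z : ℂ, (‖z‖ ^ 2) ^ m i ∂discMeasure : ℝ) : ℂ) else 0 := by
    intro m m'
    rw [integral_const_mul,
      integral_fintype_prod_eq_prod (f := fun i (w : ℂ) => w ^ m i * (starRingEnd ℂ) w ^ m' i)]
    split_ifs with h
    · subst h
      push_cast
      rw [sq]
      congr 1
      refine Finset.prod_congr rfl fun i _ => ?_
      rw [← integral_complex_ofReal]
      refine integral_congr_ae (Filter.Eventually.of_forall fun z => ?_)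
      simp only []
      push_cast
      rw [← mul_pow, Complex.mul_conj']
    · obtain ⟨i, hi⟩ := Finsupp.ne_iff.mp h
      rw [Finset.prod_eq_zero (Finset.mem_univ i) (integral_pow_mul_conj_pow_of_ne hi), mul_zero]
  apply Complex.ofReal_injective
  rw [← integral_complex_ofReal]
  simp only [hexp]
  rw [integral_finsetSum _ fun m _ => integrable_finsetSum _ fun m' _ => hinteg m m']
  push_cast
  refine Finset.sum_congr rfl fun m hm => ?_
  rw [integral_finsetSum _ fun m' _ => hinteg m m']
  simp only [hval]
  rw [Finset.sum_ite_eq, if_pos hm]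
  push_cast
  rfl

theorem ae_cubeMeasure_abs_le_one (n : ℕ) : ∀ᵐ x ∂cubeMeasure n, ∀ i, |x i| ≤ 1 := by
  rw [ae_all_iff]
  intro i
  have := (measurePreserving_eval (fun _ : Fin n => unifInterval) i).quasiMeasurePreserving.ae
    ae_unifInterval_abs_lt_one
  filter_upwards [this] with x hx
  exact hx.le

theorem abs_polyEval_le_of_abs_le_one {n : ℕ} (S : Finset (Fin n →₀ ℕ)) (c : (Fin n →₀ ℕ) → ℝ)
    {x : Fin n → ℝ} (hx : ∀ i, |x i| ≤ 1) : |polyEval S c x| ≤ ∑ m ∈ S, |c m| := by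
  refine (Finset.abs_sum_le_sum_abs _ _).trans (Finset.sum_le_sum fun m _ => ?_)
  rw [abs_mul, Finset.abs_prod]
  refine mul_le_of_le_one_right (abs_nonneg _) (Finset.prod_le_one (fun _ _ => abs_nonneg _) ?_)
  intro i _
  rw [abs_pow]
  exact pow_le_one₀ (abs_nonneg _) (hx i)

theorem integrable_polyEval_sq {n : ℕ} (S : Finset (Fin n →₀ ℕ)) (c : (Fin n →₀ ℕ) → ℝ) :
    Integrable (fun x => polyEval S c x ^ 2) (cubeMeasure n) := by
  refine Integrable.of_bound ((continuous_polyEval S c).pow 2).aestronglyMeasurable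
    ((∑ m ∈ S, |c m|) ^ 2) ?_
  filter_upwards [ae_cubeMeasure_abs_le_one n] with x hx
  rw [norm_pow, Real.norm_eq_abs]
  exact pow_le_pow_left₀ (abs_nonneg _) (abs_polyEval_le_of_abs_le_one S c hx) _

theorem sum_sq_le_mul_integral_polyEval_sq {n d : ℕ} {S : Finset (Fin n →₀ ℕ)}
    {c : (Fin n →₀ ℕ) → ℝ} (hS : ∀ m ∈ S, ∑ i, m i = d) :
    (3⁻¹ : ℝ) ^ d * ∑ m ∈ S, c m ^ 2 ≤ (2 ^ d * ((d + 1) * (d + 1) ^ d)) ^ 2 * (d + 1) *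
      ∫ x, polyEval S c x ^ 2 ∂cubeMeasure n := by
  have hpt : ∀ z : Fin n → ℂ, ‖polyEvalC S c z‖ ^ 2 ≤ (2 ^ d * ((d + 1) * (d + 1) ^ d)) ^ 2 *
      ∑ l ∈ Finset.range (d + 1),
        polyEval S c (rotRe z (0 + Real.pi * l / (d + 1 : ℕ))) ^ 2 := by
    intro z
    set G := ∑ l ∈ Finset.range (d + 1),
        polyEval S c (rotRe z (0 + Real.pi * l / (d + 1 : ℕ))) ^ 2 with hG
    have hG0 : 0 ≤ G := Finset.sum_nonneg fun _ _ => sq_nonneg _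
    have := (polyEval_rotRe_le_of_card (c := c) (N := d + 1) hS z 0 (Real.sqrt_nonneg G) (by
      rw [Finset.filter_true_of_mem, Finset.card_range]
      · exact Nat.lt_succ_self d
      · intro l hl
        apply Real.abs_le_sqrt
        exact Finset.single_le_sum (f := fun l : ℕ =>
          polyEval S c (rotRe z (0 + Real.pi * l / (d + 1 : ℕ))) ^ 2)
          (fun _ _ => sq_nonneg _) hl)).2
    calc ‖polyEvalC S c z‖ ^ 2 ≤ _ := pow_le_pow_left₀ (norm_nonneg _) this 2
      _ = _ := by
        push_cast
        rw [← mul_assoc, ← mul_assoc, mul_pow, Real.sq_sqrt hG0]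
  have hmp : ∀ t, Integrable (fun z => polyEval S c (rotRe z t) ^ 2) (polydiscMeasure n) ∧
      ∫ z, polyEval S c (rotRe z t) ^ 2 ∂polydiscMeasure n
        = ∫ x, polyEval S c x ^ 2 ∂cubeMeasure n := by
    intro t
    refine ⟨(measurePreserving_rotRe t).integrable_comp_of_integrable
      (integrable_polyEval_sq S c), ?_⟩
    have hcont : Continuous fun x : Fin n → ℝ => polyEval S c x ^ 2 :=
      (continuous_polyEval S c).pow 2
    rw [← (measurePreserving_rotRe t).map_eq, integral_map
      (measurePreserving_rotRe t).measurable.aemeasurable hcont.aestronglyMeasurable]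
  calc (3⁻¹ : ℝ) ^ d * ∑ m ∈ S, c m ^ 2
      ≤ ∫ z, ‖polyEvalC S c z‖ ^ 2 ∂polydiscMeasure n := by
        rw [integral_norm_sq_polyEvalC, Finset.mul_sum]
        refine Finset.sum_le_sum fun m hm => ?_
        rw [mul_comm, ← hS m hm, ← Finset.prod_pow_eq_pow_sum]
        refine mul_le_mul_of_nonneg_left ?_ (sq_nonneg _)
        exact Finset.prod_le_prod (fun _ _ => by positivity)
          fun i _ => inv_three_pow_le_integral_norm_pow _
    _ ≤ ∫ z, (2 ^ d * ((d + 1) * (d + 1) ^ d)) ^ 2 * ∑ l ∈ Finset.range (d + 1),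
          polyEval S c (rotRe z (0 + Real.pi * l / (d + 1 : ℕ))) ^ 2 ∂polydiscMeasure n :=
        integral_mono_of_nonneg (Filter.Eventually.of_forall fun _ => sq_nonneg _)
          ((integrable_finsetSum _ fun l _ => (hmp _).1).const_mul _)
          (Filter.Eventually.of_forall hpt)
    _ = _ := by
        rw [integral_const_mul, integral_finsetSum _ fun l _ => (hmp _).1]
        simp only [(hmp _).2, Finset.sum_const, Finset.card_range, nsmul_eq_mul]
        push_cast
        ring

theorem sq_le_sq_add_sum_indicator {K s y : ℝ} (M : ℕ)
    (hy : |y| ≤ K ^ M * s) :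
    y ^ 2 ≤ s ^ 2 + ∑ k ∈ Finset.range M,
      if K ^ k * s < |y| then (K ^ (k + 1) * s) ^ 2 else 0 := by
  induction M with
  | zero =>
    rw [pow_zero, one_mul] at hy
    simpa using sq_le_sq' (abs_le.mp hy).1 (abs_le.mp hy).2
  | succ M ih =>
    rw [Finset.sum_range_succ]
    split_ifs with h
    · have h1 : y ^ 2 ≤ (K ^ (M + 1) * s) ^ 2 := sq_le_sq' (abs_le.mp hy).1 (abs_le.mp hy).2
      have h2 : 0 ≤ ∑ k ∈ Finset.range M,
          if K ^ k * s < |y| then (K ^ (k + 1) * s) ^ 2 else 0 :=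
        Finset.sum_nonneg fun k _ => by split_ifs <;> positivity
      nlinarith [sq_nonneg s]
    · linarith [ih (not_lt.mp h)]

theorem integral_polyEval_sq_le_of_real_lt_abs_le {n : ℕ} {S : Finset (Fin n →₀ ℕ)}
    {c : (Fin n →₀ ℕ) → ℝ} {K s γ c₀ : ℝ} (hK : 1 < K) (hs : 0 < s) (hγ : 0 < γ)
    (hc : 2 * c₀ ^ γ ≤ (2 * K ^ 2)⁻¹) (hc1 : c₀ ≤ 1)
    (hrec : ∀ s, 0 ≤ s → (cubeMeasure n).real {x | K * s < |polyEval S c x|} ≤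
      2 * (cubeMeasure n).real {x | s < |polyEval S c x|} ^ (1 + γ))
    (h0 : (cubeMeasure n).real {x | s < |polyEval S c x|} ≤ c₀) :
    ∫ x, polyEval S c x ^ 2 ∂cubeMeasure n ≤ s ^ 2 * (1 + 2 * K ^ 2) := by
  have hK0 : 0 < K := by linarith
  have hθ : (2 * K ^ 2)⁻¹ ≤ 1 := by
    rw [inv_le_one₀ (by positivity)]
    nlinarith
  have hdecay : ∀ k : ℕ, (cubeMeasure n).real {x | K ^ k * s < |polyEval S c x|} ≤
      c₀ * (2 * K ^ 2)⁻¹ ^ k := by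
    have hc₀ : 0 ≤ c₀ := measureReal_nonneg.trans h0
    intro k
    induction k with
    | zero => simpa using h0
    | succ k ih =>
      have h1 := hrec (K ^ k * s) (by positivity)
      set τ := (cubeMeasure n).real {x | K ^ k * s < |polyEval S c x|} with hτ
      have hτ0 : 0 ≤ τ := measureReal_nonneg
      have hτc : τ ≤ c₀ := ih.trans (mul_le_of_le_one_right hc₀
        (pow_le_one₀ (by positivity) hθ))
      have h2 : τ ^ γ ≤ c₀ ^ γ := Real.rpow_le_rpow hτ0 hτc hγ.le
      rw [Real.rpow_add_of_nonneg hτ0 zero_le_one hγ.le, Real.rpow_one] at h1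
      rw [pow_succ' K, mul_assoc, pow_succ]
      calc _ ≤ 2 * (τ * τ ^ γ) := h1
        _ = τ * (2 * τ ^ γ) := by ring
        _ ≤ (c₀ * (2 * K ^ 2)⁻¹ ^ k) * (2 * K ^ 2)⁻¹ := by
            gcongr
            linarith
        _ = _ := by ring
  obtain ⟨M, hM⟩ := pow_unbounded_of_one_lt ((∑ m ∈ S, |c m|) / s) hK
  rw [div_lt_iff₀ hs] at hM
  have hE : ∀ s, MeasurableSet {x | s < |polyEval S c x|} := fun s =>
    (isOpen_lt continuous_const (continuous_polyEval S c).abs).measurableSet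
  have hinteg : ∀ k ∈ Finset.range M, Integrable (fun x =>
      {x | K ^ k * s < |polyEval S c x|}.indicator (fun _ => (K ^ (k + 1) * s) ^ 2) x)
      (cubeMeasure n) := fun k _ => (integrable_const _).indicator (hE _)
  calc ∫ x, polyEval S c x ^ 2 ∂cubeMeasure n
      ≤ ∫ x, (s ^ 2 + ∑ k ∈ Finset.range M,
          {x | K ^ k * s < |polyEval S c x|}.indicator (fun _ => (K ^ (k + 1) * s) ^ 2) x)
          ∂cubeMeasure n := by
        refine integral_mono_ae (integrable_polyEval_sq S c)
          ((integrable_const _).add (integrable_finsetSum _ hinteg)) ?_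
        filter_upwards [ae_cubeMeasure_abs_le_one n] with x hx
        have := sq_le_sq_add_sum_indicator M
          ((abs_polyEval_le_of_abs_le_one S c hx).trans hM.le)
        simpa only [Set.indicator_apply, Set.mem_ofPred_eq] using this
    _ = s ^ 2 + ∑ k ∈ Finset.range M, (K ^ (k + 1) * s) ^ 2 *
          (cubeMeasure n).real {x | K ^ k * s < |polyEval S c x|} := by
        rw [integral_add (integrable_const _) (integrable_finsetSum _ hinteg),
          integral_finsetSum _ hinteg]
        simp [integral_indicator_const _ (hE _), mul_comm]
    _ ≤ s ^ 2 + ∑ k ∈ Finset.range M, K ^ 2 * s ^ 2 * (1 / 2) ^ k := by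
        refine add_le_add_right (Finset.sum_le_sum fun k _ => ?_) _
        calc (K ^ (k + 1) * s) ^ 2 * (cubeMeasure n).real {x | K ^ k * s < |polyEval S c x|}
            ≤ (K ^ (k + 1) * s) ^ 2 * (1 * (2 * K ^ 2)⁻¹ ^ k) := by
              refine mul_le_mul_of_nonneg_left ((hdecay k).trans ?_) (sq_nonneg _)
              gcongr
          _ = K ^ 2 * s ^ 2 * (K ^ 2 * (2 * K ^ 2)⁻¹) ^ k := by ring
          _ = K ^ 2 * s ^ 2 * (1 / 2) ^ k := by
              rw [show K ^ 2 * (2 * K ^ 2)⁻¹ = 1 / 2 by field_simp]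
    _ ≤ s ^ 2 * (1 + 2 * K ^ 2) := by
        rw [← Finset.mul_sum]
        have h2 : ∑ k ∈ Finset.range M, ((1 : ℝ) / 2) ^ k ≤ 2 := sum_geometric_two_le M
        have h3 : 0 ≤ K ^ 2 * s ^ 2 := by positivity
        nlinarith [mul_le_mul_of_nonneg_left h2 h3]

theorem exists_cubeMeasure_real_le {d : ℕ} (hd : 0 < d) :
    ∃ C > 0, ∀ (n : ℕ) (S : Finset (Fin n →₀ ℕ)) (c : (Fin n →₀ ℕ) → ℝ),
      (∀ m ∈ S, ∑ i, m i = d) → 0 < ∑ m ∈ S, c m ^ 2 → ∀ ε > 0,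
      (cubeMeasure n).real {x | |polyEval S c x| ≤ ε} ≤
        C * (ε / √(∑ m ∈ S, c m ^ 2)) ^ ((1 : ℝ) / d) := by
  have hd1 : (1 : ℝ) ≤ d := by exact_mod_cast hd
  set K : ℝ := (d + 1) * (4 * d) ^ d with hK
  have hK1 : 1 < K := by
    have : (1 : ℝ) ≤ (4 * d) ^ d := one_le_pow₀ (by linarith)
    nlinarith
  set γ : ℝ := 1 / 16002 with hγ
  have hγ0 : 0 < γ := by positivity
  set c₀ : ℝ := ((2 * K ^ 2)⁻¹ / 2) ^ (1 / γ) with hc₀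
  have hc₀0 : 0 < c₀ := by positivity
  have hc₀1 : c₀ < 1 := by
    refine Real.rpow_lt_one (by positivity) ?_ (by positivity)
    have : (2 * K ^ 2)⁻¹ ≤ 1 := by
      rw [inv_le_one₀ (by positivity)]
      nlinarith
    linarith
  have hc₀γ : 2 * c₀ ^ γ ≤ (2 * K ^ 2)⁻¹ := by
    rw [hc₀, ← Real.rpow_mul (by positivity), one_div_mul_cancel hγ0.ne', Real.rpow_one]
    linarith
  set A : ℝ := (2 ^ d * ((d + 1) * (d + 1) ^ d)) ^ 2 * (d + 1) with hA
  have hA0 : 0 < A := by positivity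
  set κ : ℝ := √((3⁻¹ : ℝ) ^ d / (2 * A * (1 + 2 * K ^ 2))) with hκ
  have hκ0 : 0 < κ := by positivity
  have hκ2 : A * (κ ^ 2 * (1 + 2 * K ^ 2)) < (3⁻¹ : ℝ) ^ d := by
    have : A * (κ ^ 2 * (1 + 2 * K ^ 2)) = (3⁻¹ : ℝ) ^ d / 2 := by
      rw [hκ, Real.sq_sqrt (by positivity)]
      field_simp
    rw [this]
    exact half_lt_self (by positivity)
  obtain ⟨C, hC, hmain⟩ := small_ball_of_recursion hd hγ0 hc₀0 hc₀1
  refine ⟨C * κ⁻¹ ^ ((1 : ℝ) / d), by positivity, fun n S c hS hpos ε hε => ?_⟩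
  have hcont : 0 < √(∑ m ∈ S, c m ^ 2) := Real.sqrt_pos.mpr hpos
  have hE : ∀ s, (cubeMeasure n).real {x | |polyEval S c x| ≤ s} =
      1 - (cubeMeasure n).real {x | s < |polyEval S c x|} := by
    intro s
    rw [← probReal_compl_eq_one_sub
      (isOpen_lt continuous_const (continuous_polyEval S c).abs).measurableSet]
    congr 1
    ext x
    simp
  have hbase : (cubeMeasure n).real {x | |polyEval S c x| ≤ κ * √(∑ m ∈ S, c m ^ 2)} ≤
      1 - c₀ := by
    rw [hE]
    by_contra! hlt
    have h1 := integral_polyEval_sq_le_of_real_lt_abs_le hK1 (mul_pos hκ0 hcont) hγ0 hc₀γ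
      hc₀1.le (fun s hs => cubeMeasure_real_lt_abs_le_rpow hd hS hs)
      (by linarith : (cubeMeasure n).real
        {x | κ * √(∑ m ∈ S, c m ^ 2) < |polyEval S c x|} ≤ c₀)
    have h2 := sum_sq_le_mul_integral_polyEval_sq (c := c) hS
    rw [mul_pow, Real.sq_sqrt hpos.le] at h1
    have h3 := h2.trans (mul_le_mul_of_nonneg_left h1 hA0.le)
    nlinarith [mul_lt_mul_of_pos_right hκ2 hpos]
  have hfin := hmain (fun s => (cubeMeasure n).real {x | |polyEval S c x| ≤ s})
    (κ * √(∑ m ∈ S, c m ^ 2)) (fun a b hab => measureReal_mono fun x hx => le_trans hx hab)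
    (fun _ => measureReal_nonneg) (fun _ => measureReal_le_one) (mul_pos hκ0 hcont) hbase
    (fun ε hε N hN => cubeMeasure_real_le_rpow_add hN hS hε.le)
    (fun ε hε J => cubeMeasure_real_le_sum_rpow_add hS hε.le J) ε hε
  refine hfin.trans (le_of_eq ?_)
  rw [mul_assoc, ← Real.mul_rpow (by positivity) (by positivity)]
  congr 2
  field_simp

/-- The measure on `ℝ` with density `exp (-|x| ^ p)`. -/
noncomputable def expMeasure (p : ℝ) : Measure ℝ :=
  volume.withDensity fun x => ENNReal.ofReal (Real.exp (-|x| ^ p))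

/-- The radius of the superlevel set of `exp (-|x| ^ p)` at height `s`. -/
noncomputable def levelRadius (p s : ℝ) : ℝ := (-Real.log s) ^ (1 / p)

theorem levelRadius_pos (p : ℝ) {s : ℝ} (hs : s ∈ Set.Ioo 0 1) : 0 < levelRadius p s :=
  Real.rpow_pos_of_pos (neg_pos.mpr (Real.log_neg hs.1 hs.2)) _

theorem measurable_levelRadius (p : ℝ) : Measurable (levelRadius p) := by
  unfold levelRadius
  fun_prop

theorem rpow_one_div_le_levelRadius_iff {p s y : ℝ} (hp : 0 < p) (hs : s ∈ Set.Ioo 0 1)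
    (hy : 0 ≤ y) : y ^ (1 / p) ≤ levelRadius p s ↔ y ≤ -Real.log s :=
  Real.rpow_le_rpow_iff hy (neg_pos.mpr (Real.log_neg hs.1 hs.2)).le (by positivity)

theorem abs_le_levelRadius_iff {p s x : ℝ} (hp : 0 < p) (hs : s ∈ Set.Ioo 0 1) :
    |x| ≤ levelRadius p s ↔ |x| ^ p ≤ -Real.log s := by
  rw [← rpow_one_div_le_levelRadius_iff hp hs (by positivity), one_div,
    Real.rpow_rpow_inv (abs_nonneg x) hp.ne']

theorem restrict_Ioo_le_neg_log {y : ℝ} (hy : 0 ≤ y) :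
    volume.restrict (Set.Ioo (0 : ℝ) 1) {s | y ≤ -Real.log s} = ENNReal.ofReal (Real.exp (-y)) := by
  have hmeas : MeasurableSet {s : ℝ | y ≤ -Real.log s} :=
    measurableSet_le measurable_const Real.measurable_log.neg
  rw [Measure.restrict_apply hmeas]
  have hle : Real.exp (-y) ≤ 1 := Real.exp_le_one_iff.mpr (by linarith)
  apply le_antisymm
  · calc volume ({s : ℝ | y ≤ -Real.log s} ∩ Set.Ioo 0 1)
        ≤ volume (Set.Ioc 0 (Real.exp (-y))) := by
          refine measure_mono fun s hs => ⟨hs.2.1, ?_⟩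
          rw [← Real.log_le_iff_le_exp hs.2.1]
          linarith [hs.1.out]
      _ = _ := by rw [Real.volume_Ioc, sub_zero]
  · calc ENNReal.ofReal (Real.exp (-y)) = volume (Set.Ioo 0 (Real.exp (-y))) := by
          rw [Real.volume_Ioo, sub_zero]
      _ ≤ _ := by
          refine measure_mono fun s hs => ⟨?_, hs.1, hs.2.trans_le hle⟩
          have := (Real.log_lt_iff_lt_exp hs.1).mpr hs.2
          show y ≤ -Real.log s
          linarith

theorem lintegral_mul_exp_neg {X : Type*} [MeasurableSpace X] {μ : Measure X} [SFinite μ]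
    {g : X → ENNReal} (hg : Measurable g) {h : X → ℝ} (hh : Measurable h) (h0 : ∀ x, 0 ≤ h x) :
    ∫⁻ x, g x * ENNReal.ofReal (Real.exp (-h x)) ∂μ =
      ∫⁻ s in Set.Ioo 0 1, ∫⁻ x in {x | h x ≤ -Real.log s}, g x ∂μ := by
  have hm : MeasurableSet {q : X × ℝ | h q.1 ≤ -Real.log q.2} :=
    measurableSet_le (hh.comp measurable_fst) (Real.measurable_log.comp measurable_snd).neg
  have hF : Measurable fun q : X × ℝ =>
      {q : X × ℝ | h q.1 ≤ -Real.log q.2}.indicator (fun q => g q.1) q :=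
    (hg.comp measurable_fst).indicator hm
  calc ∫⁻ x, g x * ENNReal.ofReal (Real.exp (-h x)) ∂μ
      = ∫⁻ x, (∫⁻ s in Set.Ioo (0 : ℝ) 1,
          {q : X × ℝ | h q.1 ≤ -Real.log q.2}.indicator (fun q => g q.1) (x, s)) ∂μ := by
        refine lintegral_congr fun x => ?_
        have hmx : MeasurableSet {s : ℝ | h x ≤ -Real.log s} :=
          measurableSet_le measurable_const Real.measurable_log.neg
        rw [← restrict_Ioo_le_neg_log (h0 x), ← lintegral_indicator_const hmx]
        rfl
    _ = ∫⁻ s in Set.Ioo (0 : ℝ) 1, ∫⁻ x,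
          {q : X × ℝ | h q.1 ≤ -Real.log q.2}.indicator (fun q => g q.1) (x, s) ∂μ :=
        lintegral_lintegral_swap hF.aemeasurable
    _ = _ := by
        refine lintegral_congr fun s => ?_
        rw [← lintegral_indicator (measurableSet_le hh measurable_const)]
        rfl

theorem unifInterval_preimage_mul {r : ℝ} (hr : 0 < r) {B : Set ℝ} (hB : MeasurableSet B) :
    ENNReal.ofReal (2 * r) * unifInterval ((fun u => r * u) ⁻¹' B) =
      volume (B ∩ {x | |x| ≤ r}) := by
  have hBm : MeasurableSet ((fun u => r * u) ⁻¹' B) := (measurable_const_mul r) hB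
  have hset : (fun u => r * u) ⁻¹' B ∩ Set.Icc (-1) 1 =
      (fun u => r * u) ⁻¹' (B ∩ {x | |x| ≤ r}) := by
    ext u
    simp only [Set.mem_inter_iff, Set.mem_preimage, Set.mem_ofPred_eq, abs_mul, abs_of_pos hr,
      ← abs_le, Set.mem_Icc]
    rw [mul_le_iff_le_one_right hr]
  rw [unifInterval, Measure.smul_apply, Measure.restrict_apply hBm, hset,
    Real.volume_preimage_mul_left hr.ne', smul_eq_mul, abs_of_pos (inv_pos.mpr hr),
    ENNReal.ofReal_mul zero_le_two, ENNReal.ofReal_inv_of_pos hr, ENNReal.ofReal_ofNat]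
  have hr0 : ENNReal.ofReal r ≠ 0 := by simpa using hr
  calc 2 * ENNReal.ofReal r * (2⁻¹ * ((ENNReal.ofReal r)⁻¹ * volume (B ∩ {x | |x| ≤ r})))
      = (2 * 2⁻¹) * (ENNReal.ofReal r * (ENNReal.ofReal r)⁻¹) * volume (B ∩ {x | |x| ≤ r}) := by
        ring
    _ = _ := by
        rw [ENNReal.mul_inv_cancel two_ne_zero ENNReal.ofNat_ne_top,
          ENNReal.mul_inv_cancel hr0 ENNReal.ofReal_ne_top, one_mul, one_mul]

/-- The mixing measure writing `expMeasure p` as a mixture of uniform laws on intervals. -/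
noncomputable def levelMeasure (p : ℝ) : Measure ℝ :=
  (volume.restrict (Set.Ioo 0 1)).withDensity fun s => ENNReal.ofReal (2 * levelRadius p s)

theorem measurable_expMeasure_density (p : ℝ) :
    Measurable fun x : ℝ => ENNReal.ofReal (Real.exp (-|x| ^ p)) := by
  fun_prop

theorem measurable_levelMeasure_density (p : ℝ) :
    Measurable fun s => ENNReal.ofReal (2 * levelRadius p s) :=
  ((measurable_levelRadius p).const_mul 2).ennreal_ofReal

instance (p : ℝ) : SigmaFinite (levelMeasure p) := by
  unfold levelMeasure
  exact SigmaFinite.withDensity_ofReal _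

instance (p : ℝ) : SigmaFinite (expMeasure p) := by
  unfold expMeasure
  exact SigmaFinite.withDensity_ofReal _

theorem expMeasure_apply {p : ℝ} (hp : 0 < p) {B : Set ℝ} (hB : MeasurableSet B) :
    expMeasure p B = ∫⁻ s, unifInterval ((fun u => levelRadius p s * u) ⁻¹' B)
      ∂levelMeasure p := by
  have hmeas : Measurable fun s => unifInterval ((fun u => levelRadius p s * u) ⁻¹' B) := by
    have : MeasurableSet ((fun q : ℝ × ℝ => levelRadius p q.1 * q.2) ⁻¹' B) :=
      (((measurable_levelRadius p).comp measurable_fst).mul measurable_snd) hB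
    exact measurable_measure_prodMk_left this
  rw [levelMeasure, lintegral_withDensity_eq_lintegral_mul _ (measurable_levelMeasure_density p)
    hmeas, expMeasure, withDensity_apply _ hB, ← lintegral_indicator hB]
  have h1 : ∀ x : ℝ, B.indicator (fun x => ENNReal.ofReal (Real.exp (-|x| ^ p))) x =
      B.indicator 1 x * ENNReal.ofReal (Real.exp (-|x| ^ p)) := by
    intro x
    by_cases hx : x ∈ B <;> simp [hx]
  simp only [h1]
  rw [lintegral_mul_exp_neg (measurable_one.indicator hB) (h := fun x => |x| ^ p) (by fun_prop)
    fun x => by positivity]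
  refine setLIntegral_congr_fun measurableSet_Ioo fun s hs => ?_
  rw [lintegral_indicator_one hB, Measure.restrict_apply hB, Pi.mul_apply,
    unifInterval_preimage_mul (levelRadius_pos p hs) hB]
  congr 2
  ext x
  exact (abs_le_levelRadius_iff hp hs).symm

theorem measurePreserving_levelRadius_mul {p : ℝ} (hp : 0 < p) :
    MeasurePreserving (fun q : ℝ × ℝ => levelRadius p q.1 * q.2)
      ((levelMeasure p).prod unifInterval) (expMeasure p) := by
  have hm : Measurable fun q : ℝ × ℝ => levelRadius p q.1 * q.2 :=
    ((measurable_levelRadius p).comp measurable_fst).mul measurable_snd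
  refine ⟨hm, Measure.ext fun B hB => ?_⟩
  rw [Measure.map_apply hm hB, Measure.prod_apply (hm hB), expMeasure_apply hp hB]
  rfl

theorem levelMeasure_univ {p : ℝ} (hp : 0 < p) :
    levelMeasure p Set.univ = expMeasure p Set.univ := by
  rw [expMeasure_apply hp MeasurableSet.univ]
  simp

theorem lintegral_inv_levelRadius (p : ℝ) :
    ∫⁻ s, ENNReal.ofReal (levelRadius p s)⁻¹ ∂levelMeasure p = 2 := by
  have hm : Measurable fun s => ENNReal.ofReal (levelRadius p s)⁻¹ :=
    (measurable_levelRadius p).inv.ennreal_ofReal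
  rw [levelMeasure, lintegral_withDensity_eq_lintegral_mul _ (measurable_levelMeasure_density p)
    hm]
  have : ∀ s ∈ Set.Ioo (0 : ℝ) 1, ((fun s => ENNReal.ofReal (2 * levelRadius p s)) *
      fun s => ENNReal.ofReal (levelRadius p s)⁻¹) s = 2 := by
    intro s hs
    have := levelRadius_pos p hs
    rw [Pi.mul_apply, ← ENNReal.ofReal_mul (by positivity), mul_assoc, mul_inv_cancel₀ this.ne']
    simp
  rw [setLIntegral_congr_fun measurableSet_Ioo this]
  simp

theorem one_add_sq_mul_exp_neg_abs_rpow_le {p : ℝ} (hp : 1 ≤ p) (x : ℝ) :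
    (1 + x ^ 2) * Real.exp (-|x| ^ p) ≤ 50 * Real.exp 1 * (1 + x ^ 2)⁻¹ := by
  have h1 : |x| - 1 ≤ |x| ^ p := by
    rcases le_total 1 |x| with h | h
    · have := Real.self_le_rpow_of_one_le h hp
      linarith
    · have : 0 ≤ |x| ^ p := by positivity
      linarith
  have h2 : Real.exp (-|x| ^ p) ≤ Real.exp 1 * (Real.exp |x|)⁻¹ := by
    rw [← Real.exp_neg, ← Real.exp_add]
    exact Real.exp_le_exp.mpr (by linarith)
  have h3 : (1 + x ^ 2) ^ 2 ≤ 50 * Real.exp |x| := by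
    have ha := Real.pow_div_factorial_le_exp |x| (abs_nonneg x) 4
    have hb := Real.one_le_exp (abs_nonneg x)
    have hc : |x| ^ 4 = x ^ 4 := by rw [Even.pow_abs ⟨2, rfl⟩]
    rw [hc, show ((Nat.factorial 4 : ℕ) : ℝ) = 24 by norm_num [Nat.factorial]] at ha
    nlinarith [sq_nonneg (x ^ 2 - 1)]
  have h4 : 0 < 1 + x ^ 2 := by positivity
  calc (1 + x ^ 2) * Real.exp (-|x| ^ p) ≤ (1 + x ^ 2) * (Real.exp 1 * (Real.exp |x|)⁻¹) := by
        gcongr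
    _ = Real.exp 1 * ((1 + x ^ 2) ^ 2 * (Real.exp |x|)⁻¹) * (1 + x ^ 2)⁻¹ := by
        field_simp
    _ ≤ Real.exp 1 * (50 * Real.exp |x| * (Real.exp |x|)⁻¹) * (1 + x ^ 2)⁻¹ := by gcongr
    _ = _ := by
        rw [mul_assoc 50, mul_inv_cancel₀ (Real.exp_pos _).ne']
        ring

theorem lintegral_one_add_sq_expMeasure_le {p : ℝ} (hp : 1 ≤ p) :
    ∫⁻ x, ENNReal.ofReal (1 + x ^ 2) ∂expMeasure p ≤
      ENNReal.ofReal (50 * Real.exp 1 * Real.pi) := by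
  rw [expMeasure, lintegral_withDensity_eq_lintegral_mul _ (measurable_expMeasure_density p)
    (by fun_prop)]
  calc _ ≤ ∫⁻ x : ℝ, ENNReal.ofReal (50 * Real.exp 1 * (1 + x ^ 2)⁻¹) := by
        refine lintegral_mono fun x => ?_
        rw [Pi.mul_apply, ← ENNReal.ofReal_mul (Real.exp_pos _).le, mul_comm]
        exact ENNReal.ofReal_le_ofReal (one_add_sq_mul_exp_neg_abs_rpow_le hp x)
    _ = _ := by
        rw [← ofReal_integral_eq_lintegral_ofReal (integrable_inv_one_add_sq.const_mul _)
          (Filter.Eventually.of_forall fun x => by positivity), integral_const_mul,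
          integral_univ_inv_one_add_sq]

theorem expMeasure_univ_ne_top {p : ℝ} (hp : 1 ≤ p) : expMeasure p Set.univ ≠ ⊤ := by
  refine ((le_trans ?_ (lintegral_one_add_sq_expMeasure_le hp)).trans_lt
    ENNReal.ofReal_lt_top).ne
  rw [← lintegral_one]
  refine lintegral_mono fun x => ?_
  rw [ENNReal.one_le_ofReal]
  nlinarith [sq_nonneg x]

theorem two_mul_exp_neg_one_le_expMeasure_univ {p : ℝ} (hp : 1 ≤ p) :
    ENNReal.ofReal (2 * Real.exp (-1)) ≤ expMeasure p Set.univ := by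
  calc ENNReal.ofReal (2 * Real.exp (-1))
      = ∫⁻ _ in Set.Icc (-1 : ℝ) 1, ENNReal.ofReal (Real.exp (-1)) := by
        rw [setLIntegral_const, Real.volume_Icc, ← ENNReal.ofReal_mul (Real.exp_pos _).le]
        ring_nf
    _ ≤ ∫⁻ x in Set.Icc (-1 : ℝ) 1, ENNReal.ofReal (Real.exp (-|x| ^ p)) := by
        refine setLIntegral_mono (measurable_expMeasure_density p) fun x hx => ?_
        refine ENNReal.ofReal_le_ofReal (Real.exp_le_exp.mpr (neg_le_neg ?_))
        exact Real.rpow_le_one (abs_nonneg x) (abs_le.mpr hx) (by linarith)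
    _ ≤ _ := by
        rw [expMeasure, withDensity_apply _ MeasurableSet.univ]
        exact lintegral_mono_set (Set.subset_univ _)

theorem lintegral_pi_prod {X : Type*} [MeasurableSpace X] (μ : Measure X) [SigmaFinite μ] {n : ℕ}
    {f : Fin n → X → ENNReal} (hf : ∀ i, Measurable (f i)) :
    ∫⁻ x, ∏ i, f i (x i) ∂Measure.pi (fun _ => μ) = ∏ i, ∫⁻ a, f i a ∂μ := by
  induction n with
  | zero => simp
  | succ n ih =>
    have hm : Measurable fun x : Fin (n + 1) → X => ∏ i, f i (x i) :=
      Finset.measurable_prod _ fun i _ => (hf i).comp (measurable_pi_apply i)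
    rw [lintegral_pi_fin_succ μ hm, Fin.prod_univ_succ]
    simp only [Fin.prod_univ_succ, Fin.cons_zero, Fin.cons_succ]
    rw [← ih fun i => hf i.succ, ← lintegral_mul_const _ (hf 0)]
    refine lintegral_congr fun a => ?_
    exact lintegral_const_mul _ (Finset.measurable_prod _ fun i _ =>
      (hf i.succ).comp (measurable_pi_apply i))

theorem pi_expMeasure_eq_withDensity (p : ℝ) (n : ℕ) :
    Measure.pi (fun _ : Fin n => expMeasure p) =
      volume.withDensity fun x => ENNReal.ofReal (Real.exp (-∑ i, |x i| ^ p)) := by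
  refine Measure.pi_eq fun s hs => ?_
  rw [withDensity_apply _ (MeasurableSet.univ_pi hs),
    ← lintegral_indicator (MeasurableSet.univ_pi hs)]
  have h1 : ∀ x : Fin n → ℝ, (Set.univ.pi s).indicator
      (fun x => ENNReal.ofReal (Real.exp (-∑ i, |x i| ^ p))) x =
      ∏ i, (s i).indicator (fun a => ENNReal.ofReal (Real.exp (-|a| ^ p))) (x i) := by
    intro x
    by_cases hx : x ∈ Set.univ.pi s
    · rw [Set.indicator_of_mem hx, ← Finset.sum_neg_distrib, Real.exp_sum,
        ENNReal.ofReal_prod_of_nonneg fun _ _ => (Real.exp_pos _).le]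
      refine Finset.prod_congr rfl fun i _ => ?_
      rw [Set.indicator_of_mem (hx i trivial)]
    · rw [Set.indicator_of_notMem hx]
      simp only [Set.mem_univ_pi, not_forall] at hx
      obtain ⟨i, hi⟩ := hx
      exact (Finset.prod_eq_zero (Finset.mem_univ i) (Set.indicator_of_notMem hi _)).symm
  simp only [h1]
  rw [volume_pi, lintegral_pi_prod volume fun i =>
    (measurable_expMeasure_density p).indicator (hs i)]
  refine Finset.prod_congr rfl fun i _ => ?_
  rw [lintegral_indicator (hs i), expMeasure, withDensity_apply _ (hs i)]

theorem lintegral_pi_eval_mul {X : Type*} [MeasurableSpace X] (μ : Measure X) [SigmaFinite μ]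
    {n : ℕ} (k : Fin n) {g : X → ENNReal} (hg : Measurable g) :
    μ Set.univ * ∫⁻ x, g (x k) ∂Measure.pi (fun _ => μ) = μ Set.univ ^ n * ∫⁻ a, g a ∂μ := by
  have h : ∫⁻ x, g (x k) ∂Measure.pi (fun _ => μ) =
      ∫⁻ a, g a ∂(Measure.pi fun _ : Fin n => μ).map (Function.eval k) :=
    (lintegral_map hg (measurable_pi_apply k)).symm
  rw [h, Measure.pi_map_eval, lintegral_smul_measure, smul_eq_mul, ← mul_assoc,
    Finset.mul_prod_erase _ (fun _ => μ Set.univ) (Finset.mem_univ k)]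
  simp

theorem polyEval_mul {n : ℕ} (S : Finset (Fin n →₀ ℕ)) (c : (Fin n →₀ ℕ) → ℝ) (v u : Fin n → ℝ) :
    polyEval S c (fun i => v i * u i) = polyEval S (fun m => c m * ∏ i, v i ^ m i) u := by
  simp only [polyEval, mul_pow, Finset.prod_mul_distrib, mul_assoc]

/-- Rescaling the coordinates changes the inverse content at most by a convex combination of the
inverse scaling factors. -/
theorem exists_weights_inv_content_le {n d : ℕ} (hd : 0 < d) {S : Finset (Fin n →₀ ℕ)}
    {c : (Fin n →₀ ℕ) → ℝ} (hS : ∀ m ∈ S, ∑ i, m i = d) (hc : 0 < ∑ m ∈ S, c m ^ 2) :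
    ∃ w : Fin n → ℝ, (∀ k, 0 ≤ w k) ∧ ∑ k, w k = 1 ∧ ∀ v : Fin n → ℝ, (∀ k, 0 < v k) →
      0 < ∑ m ∈ S, (c m * ∏ i, v i ^ m i) ^ 2 ∧
      (1 / √(∑ m ∈ S, (c m * ∏ i, v i ^ m i) ^ 2)) ^ ((1 : ℝ) / d) ≤
        (1 / √(∑ m ∈ S, c m ^ 2)) ^ ((1 : ℝ) / d) * ∑ k, w k * (v k)⁻¹ := by
  set W := ∑ m ∈ S, c m ^ 2 with hW
  have hd' : (0 : ℝ) < d := by exact_mod_cast hd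
  have hsum : ∑ m ∈ S, c m ^ 2 / W = 1 := by rw [← Finset.sum_div, div_self hc.ne']
  set w : Fin n → ℝ := fun k => ∑ m ∈ S, c m ^ 2 / W * (m k / d) with hw
  have hw0 : ∀ k, 0 ≤ w k := fun k => Finset.sum_nonneg fun m _ => by positivity
  have hw1 : ∑ k, w k = 1 := by
    rw [Finset.sum_comm, ← hsum]
    refine Finset.sum_congr rfl fun m hm => ?_
    rw [← Finset.mul_sum, ← Finset.sum_div, ← Nat.cast_sum, hS m hm, div_self hd'.ne', mul_one]
  refine ⟨w, hw0, hw1, fun v hv => ?_⟩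
  set G := ∏ k, v k ^ w k with hG
  have hG0 : 0 < G := Finset.prod_pos fun k _ => Real.rpow_pos_of_pos (hv k) _
  have hkey : W * (G ^ d) ^ 2 ≤ ∑ m ∈ S, (c m * ∏ i, v i ^ m i) ^ 2 := by
    have h1 := Real.geom_mean_le_arith_mean_weighted S (fun m => c m ^ 2 / W)
      (fun m => (∏ i, v i ^ m i) ^ 2) (fun m _ => by positivity) hsum fun m _ => sq_nonneg _
    have h2 : ∏ m ∈ S, ((∏ i, v i ^ m i) ^ 2) ^ (c m ^ 2 / W) = (G ^ d) ^ 2 := by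
      have h3 : ∀ m ∈ S, ((∏ i, v i ^ m i) ^ 2) ^ (c m ^ 2 / W) =
          ∏ i, v i ^ (2 * d * (c m ^ 2 / W * (m i / d))) := by
        intro m _
        rw [← Finset.prod_pow, ← Real.finsetProd_rpow _ _ fun i _ => by
          have := hv i; positivity]
        refine Finset.prod_congr rfl fun i _ => ?_
        rw [← pow_mul, ← Real.rpow_natCast, ← Real.rpow_mul (hv i).le]
        congr 1
        push_cast
        field_simp
      rw [Finset.prod_congr rfl h3, Finset.prod_comm, hG, ← pow_mul, ← Finset.prod_pow]
      refine Finset.prod_congr rfl fun i _ => ?_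
      rw [← Real.rpow_sum_of_pos (hv i), ← Finset.mul_sum, ← Real.rpow_natCast,
        ← Real.rpow_mul (hv i).le]
      congr 1
      push_cast
      ring
    rw [h2] at h1
    calc W * (G ^ d) ^ 2 ≤ W * ∑ m ∈ S, c m ^ 2 / W * (∏ i, v i ^ m i) ^ 2 := by gcongr
      _ = _ := by
        rw [Finset.mul_sum]
        refine Finset.sum_congr rfl fun m _ => ?_
        field_simp
  have hR : 0 < ∑ m ∈ S, (c m * ∏ i, v i ^ m i) ^ 2 := lt_of_lt_of_le (by positivity) hkey
  refine ⟨hR, ?_⟩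
  have hsqrt : √W * G ^ d ≤ √(∑ m ∈ S, (c m * ∏ i, v i ^ m i) ^ 2) := by
    refine Real.le_sqrt_of_sq_le ?_
    rwa [mul_pow, Real.sq_sqrt hc.le]
  have hW0 : 0 < √W := Real.sqrt_pos.mpr hc
  have hamgm : G⁻¹ ≤ ∑ k, w k * (v k)⁻¹ := by
    have h1 := Real.geom_mean_le_arith_mean_weighted Finset.univ w (fun k => (v k)⁻¹)
      (fun k _ => hw0 k) hw1 fun k _ => (inv_pos.mpr (hv k)).le
    refine le_trans (le_of_eq ?_) h1
    rw [hG, ← Finset.prod_inv_distrib]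
    exact Finset.prod_congr rfl fun k _ => (Real.inv_rpow (hv k).le _).symm
  calc (1 / √(∑ m ∈ S, (c m * ∏ i, v i ^ m i) ^ 2)) ^ ((1 : ℝ) / d)
      ≤ (1 / √W * G⁻¹ ^ d) ^ ((1 : ℝ) / d) := by
        refine Real.rpow_le_rpow (by positivity) ?_ (by positivity)
        calc _ ≤ 1 / (√W * G ^ d) := one_div_le_one_div_of_le (by positivity) hsqrt
          _ = _ := by rw [inv_pow, one_div, one_div, mul_inv]
    _ = (1 / √W) ^ ((1 : ℝ) / d) * G⁻¹ := by
        rw [Real.mul_rpow (by positivity) (by positivity), one_div (d : ℝ),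
          Real.pow_rpow_inv_natCast (by positivity) hd.ne']
    _ ≤ _ := by gcongr

theorem ae_levelMeasure_mem_Ioo (p : ℝ) : ∀ᵐ s ∂levelMeasure p, s ∈ Set.Ioo (0 : ℝ) 1 :=
  (withDensity_absolutelyContinuous _ _).ae_le (ae_restrict_mem measurableSet_Ioo)

theorem pi_expMeasure_apply {p : ℝ} (hp : 0 < p) {n : ℕ} {A : Set (Fin n → ℝ)}
    (hA : MeasurableSet A) :
    Measure.pi (fun _ => expMeasure p) A =
      ∫⁻ s, cubeMeasure n {u | (fun i => levelRadius p (s i) * u i) ∈ A}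
        ∂Measure.pi fun _ => levelMeasure p := by
  have h1 := measurePreserving_pi (fun _ : Fin n => (levelMeasure p).prod unifInterval)
    (fun _ => expMeasure p) fun _ => measurePreserving_levelRadius_mul hp
  have h2 := (measurePreserving_arrowProdEquivProdArrow ℝ ℝ (Fin n) (fun _ => levelMeasure p)
    fun _ => unifInterval).symm
  have h3 := h1.comp h2
  rw [← h3.measure_preimage hA.nullMeasurableSet, Measure.prod_apply (h3.measurable hA)]
  rfl

theorem exists_expMeasure_univ_mul_pi_expMeasure_le {d : ℕ} (hd : 0 < d) :
    ∃ C > 0, ∀ (p : ℝ), 1 ≤ p → ∀ (n : ℕ) (S : Finset (Fin n →₀ ℕ)) (c : (Fin n →₀ ℕ) → ℝ),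
      (∀ m ∈ S, ∑ i, m i = d) → 0 < ∑ m ∈ S, c m ^ 2 → ∀ ε > 0,
      expMeasure p Set.univ *
        Measure.pi (fun _ => expMeasure p) {x | |polyEval S c x| ≤ ε} ≤
        ENNReal.ofReal (C * (ε / √(∑ m ∈ S, c m ^ 2)) ^ ((1 : ℝ) / d)) *
          expMeasure p Set.univ ^ n := by
  obtain ⟨C, hC, hcube⟩ := exists_cubeMeasure_real_le hd
  refine ⟨C * 2, by positivity, fun p hp n S c hS hc ε hε => ?_⟩
  have hp0 : 0 < p := by linarith
  obtain ⟨w, hw0, hw1, hw⟩ := exists_weights_inv_content_le hd hS hc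
  set B : ℝ := C * (ε / √(∑ m ∈ S, c m ^ 2)) ^ ((1 : ℝ) / d) with hB
  have hB0 : 0 ≤ B := by positivity
  have hgm : ∀ k : Fin n, Measurable fun s : Fin n → ℝ =>
      ENNReal.ofReal (levelRadius p (s k))⁻¹ := fun k =>
    ((measurable_levelRadius p).comp (measurable_pi_apply k)).inv.ennreal_ofReal
  have hae : ∀ᵐ s ∂Measure.pi fun _ : Fin n => levelMeasure p,
      ∀ i, s i ∈ Set.Ioo (0 : ℝ) 1 := by
    rw [ae_all_iff]
    exact fun i => (Measure.quasiMeasurePreserving_eval _ i).ae (ae_levelMeasure_mem_Ioo p)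
  have hbound : Measure.pi (fun _ => expMeasure p) {x | |polyEval S c x| ≤ ε} ≤
      ENNReal.ofReal B * ∑ k, ENNReal.ofReal (w k) *
        ∫⁻ s, ENNReal.ofReal (levelRadius p (s k))⁻¹ ∂Measure.pi fun _ => levelMeasure p := by
    rw [pi_expMeasure_apply hp0 (measurableSet_abs_polyEval_le S c ε)]
    calc _ ≤ ∫⁻ s : Fin n → ℝ, ENNReal.ofReal B * ∑ k, ENNReal.ofReal (w k) *
            ENNReal.ofReal (levelRadius p (s k))⁻¹ ∂Measure.pi fun _ => levelMeasure p := by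
          refine lintegral_mono_ae ?_
          filter_upwards [hae] with s hs
          have hv : ∀ k, 0 < levelRadius p (s k) := fun k => levelRadius_pos p (hs k)
          obtain ⟨hpos, hle⟩ := hw _ hv
          have h1 := hcube n S _ hS hpos ε hε
          have h2 : ∑ k, ENNReal.ofReal (w k) * ENNReal.ofReal (levelRadius p (s k))⁻¹ =
              ENNReal.ofReal (∑ k, w k * (levelRadius p (s k))⁻¹) := by
            rw [ENNReal.ofReal_sum_of_nonneg fun k _ =>
              mul_nonneg (hw0 k) (inv_pos.mpr (hv k)).le]
            exact Finset.sum_congr rfl fun k _ => (ENNReal.ofReal_mul (hw0 k)).symm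
          rw [h2, ← ENNReal.ofReal_mul hB0]
          simp only [polyEval_mul]
          rw [← ENNReal.ofReal_toReal (measure_ne_top (cubeMeasure n) _)]
          refine ENNReal.ofReal_le_ofReal (h1.trans ?_)
          rw [hB, div_eq_mul_one_div, div_eq_mul_one_div ε,
            Real.mul_rpow hε.le (by positivity), Real.mul_rpow hε.le (by positivity), mul_assoc,
            mul_assoc]
          gcongr
      _ = _ := by
          rw [lintegral_const_mul _ (Finset.measurable_sum _ fun k _ => (hgm k).const_mul _),
            lintegral_finsetSum _ fun k _ => (hgm k).const_mul _]
          congr 1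
          exact Finset.sum_congr rfl fun k _ => lintegral_const_mul _ (hgm k)
  have hZ : ∀ k : Fin n, expMeasure p Set.univ *
      ∫⁻ s, ENNReal.ofReal (levelRadius p (s k))⁻¹ ∂Measure.pi (fun _ => levelMeasure p) =
      expMeasure p Set.univ ^ n * 2 := by
    intro k
    have := lintegral_pi_eval_mul (levelMeasure p) k
      (g := fun s => ENNReal.ofReal (levelRadius p s)⁻¹)
      (measurable_levelRadius p).inv.ennreal_ofReal
    rwa [lintegral_inv_levelRadius, levelMeasure_univ hp0] at this
  calc _ ≤ _ := mul_le_mul_right hbound _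
    _ = ENNReal.ofReal B * ∑ k, ENNReal.ofReal (w k) * (expMeasure p Set.univ *
          ∫⁻ s, ENNReal.ofReal (levelRadius p (s k))⁻¹
            ∂Measure.pi fun _ => levelMeasure p) := by
        rw [mul_left_comm, Finset.mul_sum]
        simp only [mul_left_comm]
    _ = ENNReal.ofReal B * (expMeasure p Set.univ ^ n * 2) := by
        simp only [hZ]
        rw [← Finset.sum_mul, ← ENNReal.ofReal_sum_of_nonneg fun k _ => hw0 k, hw1,
          ENNReal.ofReal_one, one_mul]
    _ = _ := by
        rw [mul_right_comm C, ← hB, ENNReal.ofReal_mul hB0, ENNReal.ofReal_ofNat]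
        ring

theorem measurableSet_pball (p : ℝ) (n : ℕ) (r : ℝ) : MeasurableSet (pball p n r) :=
  measurableSet_le (by fun_prop) measurable_const

theorem smul_mem_pball_iff {p : ℝ} (hp : 0 < p) {n : ℕ} {t : ℝ} (ht : 0 < t) (z : ℝ)
    (y : Fin n → ℝ) : t • y ∈ pball p n (t * z) ↔ y ∈ pball p n z := by
  have h : (∑ i, |(t • y) i| ^ p) ^ (1 / p) = t * (∑ i, |y i| ^ p) ^ (1 / p) := by
    simp only [Pi.smul_apply, smul_eq_mul, abs_mul, abs_of_pos ht]
    simp only [Real.mul_rpow ht.le (abs_nonneg _)]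
    rw [← Finset.mul_sum, Real.mul_rpow (by positivity)
      (Finset.sum_nonneg fun i _ => by positivity), one_div, Real.rpow_rpow_inv ht.le hp.ne']
  simp only [pball, Set.mem_ofPred_eq, h]
  exact mul_le_mul_iff_right₀ ht

theorem setLIntegral_pball_mul {p : ℝ} (hp : 0 < p) {n : ℕ} {t : ℝ} (ht : 0 < t) (z : ℝ)
    {g : (Fin n → ℝ) → ENNReal} (hg : Measurable g) :
    ∫⁻ x in pball p n (t * z), g x =
      ENNReal.ofReal (t ^ n) * ∫⁻ y in pball p n z, g (t • y) := by
  have hm := hg.indicator (measurableSet_pball p n (t * z))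
  have h1 : ∫⁻ y in pball p n z, g (t • y) =
      ∫⁻ x, (pball p n (t * z)).indicator g x ∂(volume.map fun y : Fin n → ℝ => t • y) := by
    rw [lintegral_map hm (by fun_prop), ← lintegral_indicator (measurableSet_pball p n z)]
    refine lintegral_congr fun y => ?_
    by_cases hy : y ∈ pball p n z
    · rw [Set.indicator_of_mem hy, Set.indicator_of_mem ((smul_mem_pball_iff hp ht z y).mpr hy)]
    · rw [Set.indicator_of_notMem hy,
        Set.indicator_of_notMem (mt (smul_mem_pball_iff hp ht z y).mp hy)]
  have htn : 0 < t ^ n := by positivity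
  have h2 : volume.map (fun y : Fin n → ℝ => t • y) =
      ENNReal.ofReal |(t ^ Module.finrank ℝ (Fin n → ℝ))⁻¹| • volume :=
    Measure.map_addHaar_smul volume ht.ne'
  rw [h1, h2, lintegral_smul_measure, lintegral_indicator (measurableSet_pball p n (t * z)),
    Module.finrank_fin_fun, abs_of_pos (inv_pos.mpr htn), smul_eq_mul, ← mul_assoc,
    ← ENNReal.ofReal_mul htn.le, mul_inv_cancel₀ htn.ne', ENNReal.ofReal_one, one_mul]

theorem lintegral_pi_expMeasure {p : ℝ} (hp : 0 < p) {n : ℕ} {g : (Fin n → ℝ) → ENNReal}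
    (hg : Measurable g) :
    ∫⁻ x, g x ∂Measure.pi (fun _ => expMeasure p) =
      ∫⁻ s in Set.Ioo 0 1, ∫⁻ x in pball p n (levelRadius p s), g x := by
  have hd : Measurable fun x : Fin n → ℝ => ENNReal.ofReal (Real.exp (-∑ i, |x i| ^ p)) := by
    fun_prop
  rw [pi_expMeasure_eq_withDensity, lintegral_withDensity_eq_lintegral_mul _ hd hg, mul_comm]
  simp only [Pi.mul_apply]
  rw [lintegral_mul_exp_neg hg (h := fun x : Fin n → ℝ => ∑ i, |x i| ^ p) (by fun_prop)
    fun x => Finset.sum_nonneg fun i _ => by positivity]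
  refine setLIntegral_congr_fun measurableSet_Ioo fun s hs => ?_
  have : {x : Fin n → ℝ | ∑ i, |x i| ^ p ≤ -Real.log s} = pball p n (levelRadius p s) := by
    ext x
    exact (rpow_one_div_le_levelRadius_iff hp hs
      (Finset.sum_nonneg fun i _ => by positivity)).symm
  simp only [this]

theorem polyEval_smul {n d : ℕ} {S : Finset (Fin n →₀ ℕ)} (hS : ∀ m ∈ S, ∑ i, m i = d)
    (c : (Fin n →₀ ℕ) → ℝ) (t : ℝ) (y : Fin n → ℝ) :
    polyEval S c (t • y) = t ^ d * polyEval S c y := by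
  simp only [polyEval, Finset.mul_sum]
  refine Finset.sum_congr rfl fun m hm => ?_
  simp only [Pi.smul_apply, smul_eq_mul, mul_pow, Finset.prod_mul_distrib]
  rw [Finset.prod_pow_eq_pow_sum, hS m hm]
  ring

/-- A uniform law on a ball whose `i`-th coordinate has unit second moment puts no more mass near
the zero set of a homogeneous polynomial than any dilated ball does, up to a Markov error term. -/
theorem unif_mul_volume_pball_le {p : ℝ} (hp : 0 < p) {n d : ℕ} {z : ℝ}
    (hV0 : volume (pball p n z) ≠ 0) (hV1 : volume (pball p n z) ≠ ⊤) {i : Fin n}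
    (hi : ∫⁻ x in pball p n z, ENNReal.ofReal (x i ^ 2) = volume (pball p n z))
    {S : Finset (Fin n →₀ ℕ)} (hS : ∀ m ∈ S, ∑ i, m i = d) (c : (Fin n →₀ ℕ) → ℝ)
    (ε : ℝ) {l : ℝ} (hl : 0 < l) {t : ℝ} (ht : 0 < t) :
    unif (pball p n z) {x | |polyEval S c x| ≤ ε} * volume (pball p n (t * z)) ≤
      (∫⁻ x in pball p n (t * z), {x | |polyEval S c x| ≤ l ^ d * ε}.indicator 1 x) +
      unif (pball p n z) {x | |polyEval S c x| ≤ ε} * (ENNReal.ofReal (l ^ 2)⁻¹ *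
        ∫⁻ x in pball p n (t * z), ENNReal.ofReal (x i ^ 2)) := by
  have hA := measurableSet_abs_polyEval_le S c ε
  have hA' := measurableSet_abs_polyEval_le S c (l ^ d * ε)
  set A := {x | |polyEval S c x| ≤ ε}
  set A' := {x | |polyEval S c x| ≤ l ^ d * ε}
  set V := volume (pball p n z)
  have hvol : volume (pball p n (t * z)) = ENNReal.ofReal (t ^ n) * V := by
    have := setLIntegral_pball_mul hp ht z (n := n) (g := fun _ => 1) measurable_const
    simpa using this
  have hsq : Measurable fun x : Fin n → ℝ => ENNReal.ofReal (x i ^ 2) := by fun_prop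
  rw [setLIntegral_pball_mul hp ht z (measurable_one.indicator hA'),
    setLIntegral_pball_mul hp ht z hsq, hvol]
  have hP : unif (pball p n z) A * V = volume.restrict (pball p n z) A := by
    rw [unif, Measure.smul_apply, smul_eq_mul, mul_comm, ← mul_assoc,
      ENNReal.mul_inv_cancel hV0 hV1, one_mul]
  rcases le_total t l with h | h
  · refine le_trans ?_ le_self_add
    rw [mul_left_comm, hP, ← lintegral_indicator_one hA]
    refine mul_le_mul_right (lintegral_mono fun y => ?_) _
    by_cases hy : y ∈ A
    · have : t • y ∈ A' := by
        simp only [A', Set.mem_ofPred_eq, polyEval_smul hS, abs_mul, abs_pow, abs_of_pos ht]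
        have : |polyEval S c y| ≤ ε := hy
        gcongr
      rw [Set.indicator_of_mem hy, Set.indicator_of_mem this]
      exact le_rfl
    · rw [Set.indicator_of_notMem hy]
      exact zero_le
  · refine le_trans ?_ le_add_self
    refine mul_le_mul_right ?_ _
    have h2 : ∫⁻ y in pball p n z, ENNReal.ofReal ((t • y) i ^ 2) = ENNReal.ofReal (t ^ 2) * V := by
      rw [← hi, ← lintegral_const_mul _ hsq]
      refine lintegral_congr fun y => ?_
      rw [← ENNReal.ofReal_mul (by positivity), Pi.smul_apply, smul_eq_mul, mul_pow]
    rw [h2, mul_left_comm, ← mul_assoc (ENNReal.ofReal (l ^ 2)⁻¹)]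
    refine mul_le_mul_right (le_mul_of_one_le_left zero_le ?_) _
    rw [← ENNReal.ofReal_mul (by positivity), ENNReal.one_le_ofReal, inv_mul_eq_div,
      one_le_div (by positivity)]
    gcongr

theorem unif_mul_expMeasure_univ_pow_le {p : ℝ} (hp : 1 ≤ p) {n d : ℕ} {z : ℝ} (hz : 0 < z)
    (hV0 : volume (pball p n z) ≠ 0) (hV1 : volume (pball p n z) ≠ ⊤) {i : Fin n}
    (hi : ∫⁻ x in pball p n z, ENNReal.ofReal (x i ^ 2) = volume (pball p n z))
    {S : Finset (Fin n →₀ ℕ)} (hS : ∀ m ∈ S, ∑ i, m i = d) (c : (Fin n →₀ ℕ) → ℝ)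
    (ε : ℝ) {l : ℝ} (hl : 0 < l) (hl2 : 50 * Real.exp 1 * Real.pi ≤ Real.exp (-1) * l ^ 2) :
    unif (pball p n z) {x | |polyEval S c x| ≤ ε} * expMeasure p Set.univ ^ (n + 1) ≤
      2 * (expMeasure p Set.univ *
        Measure.pi (fun _ => expMeasure p) {x | |polyEval S c x| ≤ l ^ d * ε}) := by
  have hp0 : 0 < p := by linarith
  have hA' := measurableSet_abs_polyEval_le S c (l ^ d * ε)
  have hkey := fun t ht => unif_mul_volume_pball_le hp0 hV0 hV1 hi hS c ε hl (t := t) ht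
  set P := unif (pball p n z) {x | |polyEval S c x| ≤ ε} with hP
  set A' := {x | |polyEval S c x| ≤ l ^ d * ε}
  set Z := expMeasure p Set.univ with hZ
  have hZtop : Z ≠ ⊤ := expMeasure_univ_ne_top hp
  have hZe := two_mul_exp_neg_one_le_expMeasure_univ hp
  have hPtop : P ≠ ⊤ := by
    refine ne_top_of_le_ne_top ENNReal.one_ne_top ?_
    rw [hP, unif, Measure.smul_apply, smul_eq_mul, ← ENNReal.inv_mul_cancel hV0 hV1]
    refine mul_le_mul_right ((measure_mono (Set.subset_univ _)).trans_eq ?_) _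
    rw [Measure.restrict_apply_univ]
  set k := ENNReal.ofReal (l ^ 2)⁻¹
  have hsq : Measurable fun x : Fin n → ℝ => ENNReal.ofReal (x i ^ 2) := by fun_prop
  have hind : Measurable (A'.indicator (1 : (Fin n → ℝ) → ENNReal)) :=
    measurable_one.indicator hA'
  have hinteg : P * Z ^ n ≤ Measure.pi (fun _ => expMeasure p) A' +
      P * (k * ∫⁻ x, ENNReal.ofReal (x i ^ 2) ∂Measure.pi fun _ => expMeasure p) := by
    calc P * Z ^ n = ∫⁻ _, P ∂Measure.pi fun _ : Fin n => expMeasure p := by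
          rw [lintegral_const, Measure.pi_univ]
          simp [hZ]
      _ = ∫⁻ s in Set.Ioo 0 1, ∫⁻ _ in pball p n (levelRadius p s), P :=
          lintegral_pi_expMeasure hp0 measurable_const
      _ ≤ ∫⁻ s in Set.Ioo 0 1, ∫⁻ x in pball p n (levelRadius p s),
            (A'.indicator 1 x + P * (k * ENNReal.ofReal (x i ^ 2))) := by
          refine setLIntegral_mono' measurableSet_Ioo fun s hs => ?_
          have h := hkey _ (div_pos (levelRadius_pos p hs) hz)
          rw [div_mul_cancel₀ _ hz.ne'] at h
          rwa [setLIntegral_const, lintegral_add_left hind,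
            lintegral_const_mul _ (hsq.const_mul _), lintegral_const_mul _ hsq]
      _ = _ := by
          have hm : Measurable fun x => A'.indicator (1 : (Fin n → ℝ) → ENNReal) x +
            P * (k * ENNReal.ofReal (x i ^ 2)) := hind.add ((hsq.const_mul _).const_mul _)
          rw [← lintegral_pi_expMeasure hp0 hm, lintegral_add_left hind,
            lintegral_indicator_one hA',
            lintegral_const_mul _ (hsq.const_mul _), lintegral_const_mul _ hsq]
  have hmom : 2 * (k * ∫⁻ a, ENNReal.ofReal (a ^ 2) ∂expMeasure p) ≤ Z := by
    have h1 : ∫⁻ a, ENNReal.ofReal (a ^ 2) ∂expMeasure p ≤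
        ENNReal.ofReal (Real.exp (-1) * l ^ 2) := by
      refine le_trans ?_ ((lintegral_one_add_sq_expMeasure_le hp).trans
        (ENNReal.ofReal_le_ofReal hl2))
      exact lintegral_mono fun a => ENNReal.ofReal_le_ofReal (by linarith)
    calc _ ≤ 2 * (k * ENNReal.ofReal (Real.exp (-1) * l ^ 2)) := by gcongr
      _ = ENNReal.ofReal (2 * Real.exp (-1)) := by
          rw [← ENNReal.ofReal_mul (by positivity), ← ENNReal.ofReal_ofNat,
            ← ENNReal.ofReal_mul (by positivity)]
          congr 1
          field_simp
      _ ≤ Z := hZe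
  have hsum : P * Z ^ (n + 1) + P * Z ^ (n + 1) ≤
      2 * (Z * Measure.pi (fun _ => expMeasure p) A') + P * Z ^ (n + 1) := by
    calc P * Z ^ (n + 1) + P * Z ^ (n + 1) = 2 * (Z * (P * Z ^ n)) := by ring
      _ ≤ 2 * (Z * (Measure.pi (fun _ => expMeasure p) A' + P * (k *
            ∫⁻ x, ENNReal.ofReal (x i ^ 2) ∂Measure.pi fun _ => expMeasure p))) := by gcongr
      _ = 2 * (Z * Measure.pi (fun _ => expMeasure p) A') + 2 * (P * (k * (Z *
            ∫⁻ x, ENNReal.ofReal (x i ^ 2) ∂Measure.pi fun _ => expMeasure p))) := by ring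
      _ = 2 * (Z * Measure.pi (fun _ => expMeasure p) A') +
            P * Z ^ n * (2 * (k * ∫⁻ a, ENNReal.ofReal (a ^ 2) ∂expMeasure p)) := by
          rw [hZ, lintegral_pi_eval_mul (expMeasure p) i
            (g := fun a => ENNReal.ofReal (a ^ 2)) (by fun_prop)]
          ring
      _ ≤ 2 * (Z * Measure.pi (fun _ => expMeasure p) A') + P * Z ^ n * Z := by gcongr
      _ = _ := by ring
  exact (ENNReal.add_le_add_iff_right (ENNReal.mul_ne_top hPtop (ENNReal.pow_ne_top hZtop))).mp
    hsum

theorem volume_and_setLIntegral_of_integral_unif {n : ℕ} {K : Set (Fin n → ℝ)} {i : Fin n}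
    (h : ∫ x, x i * x i ∂unif K = 1) :
    volume K ≠ 0 ∧ volume K ≠ ⊤ ∧ ∫⁻ x in K, ENNReal.ofReal (x i ^ 2) = volume K := by
  have hinteg : Integrable (fun x : Fin n → ℝ => x i * x i) (unif K) := by
    by_contra hcon
    rw [integral_undef hcon] at h
    exact zero_ne_one h
  have h1 := ofReal_integral_eq_lintegral_ofReal hinteg
    (Filter.Eventually.of_forall fun x => mul_self_nonneg _)
  rw [h, ENNReal.ofReal_one, unif, lintegral_smul_measure, smul_eq_mul] at h1
  simp only [← sq] at h1
  have hV0 : volume K ≠ 0 := by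
    intro h0
    rw [setLIntegral_measure_zero _ _ h0, mul_zero] at h1
    exact one_ne_zero h1
  have hV1 : volume K ≠ ⊤ := by
    intro h0
    rw [h0, ENNReal.inv_top, zero_mul] at h1
    exact one_ne_zero h1
  refine ⟨hV0, hV1, ?_⟩
  rw [← one_mul (∫⁻ x in K, _), ← ENNReal.mul_inv_cancel hV0 hV1, mul_assoc, ← h1, mul_one]

/-- small-ball estimate for homogeneous polynomials of the uniform measure on
isotropic `L_p` balls. -/
theorem stmt4 (d : ℕ) (hd : 0 < d) :
    ∃ C > 0, ∀ (p : ℝ), 1 ≤ p → ∀ (n : ℕ) (z : ℝ), 0 < z →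
      -- `z` is the isotropic normalization: the uniform measure on `z • B_{p,n}`
      -- has identity covariance matrix
      (∀ i j : Fin n, ∫ x, x i * x j ∂(unif (pball p n z)) =
          if i = j then 1 else 0) →
      ∀ f : MvPolynomial (Fin n) ℝ, f.IsHomogeneous d → 0 < coeffd d f →
        ∀ ε : ℝ, 0 < ε →
        unif (pball p n z) {x | |MvPolynomial.eval x f| ≤ ε} ≤
          ENNReal.ofReal (C * (ε / coeffd d f) ^ ((1 : ℝ) / d)) := by
  obtain ⟨C, hC, hexp⟩ := exists_expMeasure_univ_mul_pi_expMeasure_le hd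
  set l : ℝ := √(50 * Real.exp 1 * Real.pi * Real.exp 1) with hl
  have hl0 : 0 < l := Real.sqrt_pos.mpr (by positivity)
  have hl2 : 50 * Real.exp 1 * Real.pi ≤ Real.exp (-1) * l ^ 2 := by
    rw [hl, Real.sq_sqrt (by positivity), Real.exp_neg]
    refine le_of_eq ?_
    field_simp
  refine ⟨Real.exp 1 * (C * l), by positivity, fun p hp n z hz hcov f hf hpos ε hε => ?_⟩
  have hS : ∀ m ∈ f.support, ∑ i, m i = d := by
    intro m hm
    rw [← hf (MvPolynomial.mem_support_iff.mp hm), Finsupp.weight_apply,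
      Finsupp.sum_fintype _ _ (by simp)]
    simp
  have hcoeff : coeffd d f = √(∑ m ∈ f.support, f.coeff m ^ 2) := by
    rw [coeffd, Finset.filter_true_of_mem hS]
  rw [hcoeff] at hpos ⊢
  have hc : 0 < ∑ m ∈ f.support, f.coeff m ^ 2 := Real.sqrt_pos.mp hpos
  obtain ⟨i⟩ : Nonempty (Fin n) := by
    obtain ⟨m, hm, -⟩ := Finset.exists_ne_zero_of_sum_ne_zero hc.ne'
    by_contra hne
    rw [not_nonempty_iff] at hne
    have := hS m hm
    simp at this
    omega
  obtain ⟨hV0, hV1, hi⟩ := volume_and_setLIntegral_of_integral_unif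
    ((hcov i i).trans (if_pos rfl))
  have heval : ∀ x, MvPolynomial.eval x f = polyEval f.support (fun m => f.coeff m) x :=
    fun x => MvPolynomial.eval_eq' x f
  simp only [heval]
  have h1 := unif_mul_expMeasure_univ_pow_le hp hz hV0 hV1 hi hS (fun m => f.coeff m) ε hl0 hl2
  have h2 := hexp p hp n f.support (fun m => f.coeff m) hS hc (l ^ d * ε) (by positivity)
  have hZe := two_mul_exp_neg_one_le_expMeasure_univ hp
  have hZtop : expMeasure p Set.univ ≠ ⊤ := expMeasure_univ_ne_top hp
  set P := unif (pball p n z) {x | |polyEval f.support (fun m => f.coeff m) x| ≤ ε}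
  set Z := expMeasure p Set.univ
  set b := (ε / √(∑ m ∈ f.support, f.coeff m ^ 2)) ^ ((1 : ℝ) / d) with hb
  have hroot : (l ^ d * ε / √(∑ m ∈ f.support, f.coeff m ^ 2)) ^ ((1 : ℝ) / d) = l * b := by
    rw [mul_div_assoc, Real.mul_rpow (by positivity) (by positivity), one_div,
      Real.pow_rpow_inv_natCast hl0.le hd.ne', hb, one_div]
  rw [hroot] at h2
  have hZ0 : Z ≠ 0 := by
    refine (lt_of_lt_of_le ?_ hZe).ne'
    simp [Real.exp_pos]
  have h3 : P * Z ≤ 2 * ENNReal.ofReal (C * (l * b)) := by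
    refine (ENNReal.mul_le_mul_iff_left (pow_ne_zero n hZ0) (ENNReal.pow_ne_top hZtop)).mp ?_
    calc P * Z * Z ^ n = P * Z ^ (n + 1) := by ring
      _ ≤ _ := h1
      _ ≤ 2 * (ENNReal.ofReal (C * (l * b)) * Z ^ n) := by gcongr
      _ = _ := by ring
  have h4 : P * ENNReal.ofReal (2 * Real.exp (-1)) ≤
      ENNReal.ofReal (Real.exp 1 * (C * l) * b) * ENNReal.ofReal (2 * Real.exp (-1)) := by
    calc _ ≤ P * Z := by gcongr
      _ ≤ _ := h3
      _ = _ := by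
        rw [← ENNReal.ofReal_mul (by positivity), ← ENNReal.ofReal_ofNat,
          ← ENNReal.ofReal_mul (by positivity), Real.exp_neg]
        congr 1
        field_simp
  refine (ENNReal.mul_le_mul_iff_left ?_ ENNReal.ofReal_ne_top).mp h4
  simp [Real.exp_pos]
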